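/- Let E be a non-split rank two vector bundle on P^n with n ≥ 6, such that H^l_*(E) = 0 for some l with 2 ≤ l ≤ n-2. Then in the minimal monad 0 → A → P → B → 0 for E, the bundle P has no line bundle direct summands. -/

import Mathlib

/-!
Background setup (the paper works on projective space `ℙⁿ` over a field `K`):
we encode a coherent sheaf on `ℙⁿ_K` by a module `M` over the homogeneous coordinate
ring `S = K[X₀,…,Xₙ]` (namely `M = Γ_*` of the sheaf), and the intermediate cohomology
module `H^i_*(F) = ⊕_ν H^i(ℙⁿ, F(ν))` (for `i ≥ 1`) by the local cohomology module
`H^{i+1}_𝔪(M)` at the irrelevant maximal ideal `𝔪 = (X₀,…,Xₙ)`, to which it is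
canonically isomorphic.
-/

open CategoryTheory TensorProduct

noncomputable section

section Header

/-- The homogeneous coordinate ring `S = K[X₀,…,Xₙ]` of `ℙⁿ`. -/
abbrev PolyS (K : Type) [Field K] (n : ℕ) : Type := MvPolynomial (Fin (n+1)) K

variable (K : Type) [Field K] (n : ℕ)

/-- The irrelevant maximal ideal `𝔪 = (X₀,…,Xₙ)` of `S`. -/
def irrel : Ideal (PolyS K n) := Ideal.span (Set.range MvPolynomial.X)

/-- `H^i_*` of the sheaf on `ℙⁿ` associated to the `S`-module `M`, encoded (for `i ≥ 1`)
as the local cohomology module `H^{i+1}_𝔪(M)`. -/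
def Hstar (i : ℕ) (M : Type) [AddCommGroup M] [Module (PolyS K n) M] :
    ModuleCat (PolyS K n) :=
  (localCohomology (irrel K n) (i+1)).obj (ModuleCat.of (PolyS K n) M)

/-- `M` is (the module of sections `Γ_*` of) an algebraic vector bundle on `ℙⁿ`:
finitely generated, depth `≥ 2` at `𝔪` (i.e. `H⁰_𝔪(M) = H¹_𝔪(M) = 0`, so `M = Γ_*(M̃)`),
and locally free at every prime other than the irrelevant ideal. -/
structure IsBundleModule (M : Type) [AddCommGroup M] [Module (PolyS K n) M] : Prop where
  finite : Module.Finite (PolyS K n) M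
  h0 : Subsingleton ((localCohomology (irrel K n) 0).obj (ModuleCat.of (PolyS K n) M))
  h1 : Subsingleton ((localCohomology (irrel K n) 1).obj (ModuleCat.of (PolyS K n) M))
  locFree : ∀ p : PrimeSpectrum (PolyS K n), p.asIdeal ≠ irrel K n →
    Module.Free (Localization.AtPrime p.asIdeal) (LocalizedModule p.asIdeal.primeCompl M)

/-- `M` represents a vector bundle of rank two on `ℙⁿ`. -/
structure IsRankTwoBundleModule (M : Type) [AddCommGroup M] [Module (PolyS K n) M]
    extends IsBundleModule K n M : Prop where
  rank2 : ∀ p : PrimeSpectrum (PolyS K n), p.asIdeal ≠ irrel K n →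
    Module.rank (Localization.AtPrime p.asIdeal) (LocalizedModule p.asIdeal.primeCompl M) = 2

/-- A finite length module which is moreover supported at the irrelevant ideal: the
(ungraded avatar of the) notion of a *graded* `S`-module of finite length. -/
def IsGradedFiniteLength (N : Type) [AddCommGroup N] [Module (PolyS K n) N] : Prop :=
  IsFiniteLength (PolyS K n) N ∧
    ∃ c : ℕ, (irrel K n) ^ c ≤ Module.annihilator (PolyS K n) N

/-- The cohomology `ker β / im α` of a monad `A --α--> P --β--> B`. -/
def MonadHomology {R A P B : Type} [CommRing R] [AddCommGroup A] [Module R A]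
    [AddCommGroup P] [Module R P] [AddCommGroup B] [Module R B]
    (α : A →ₗ[R] P) (β : P →ₗ[R] B) : Type :=
  ↥(LinearMap.ker β) ⧸ (LinearMap.range α).comap (LinearMap.ker β).subtype

instance {R A P B : Type} [CommRing R] [AddCommGroup A] [Module R A]
    [AddCommGroup P] [Module R P] [AddCommGroup B] [Module R B]
    (α : A →ₗ[R] P) (β : P →ₗ[R] B) : AddCommGroup (MonadHomology α β) := by
  unfold MonadHomology; infer_instance

instance {R A P B : Type} [CommRing R] [AddCommGroup A] [Module R A]
    [AddCommGroup P] [Module R P] [AddCommGroup B] [Module R B]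
    (α : A →ₗ[R] P) (β : P →ₗ[R] B) : Module R (MonadHomology α β) := by
  unfold MonadHomology; infer_instance

/-- A linear map of `S`-modules which becomes an isomorphism of the associated sheaves
on `ℙⁿ`: its kernel and cokernel are annihilated by a power of the irrelevant ideal. -/
def IsSheafIso {M N' : Type} [AddCommGroup M] [Module (PolyS K n) M]
    [AddCommGroup N'] [Module (PolyS K n) N'] (f : M →ₗ[PolyS K n] N') : Prop :=
  (∃ c : ℕ, (irrel K n) ^ c ≤ Module.annihilator (PolyS K n) ↥(LinearMap.ker f)) ∧
  (∃ c : ℕ, (irrel K n) ^ c ≤ Module.annihilator (PolyS K n) (N' ⧸ LinearMap.range f))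

end Header

/-! ## Bridge -/
section Bridge
open Limits Opposite

variable {R : Type} [CommRing R]

lemma lc_dies (J : Ideal R) (i : ℕ) (M : ModuleCat.{0} R)
    (h : Subsingleton ((localCohomology J i).obj M)) (t : ℕ)
    (x : ((Ext R (ModuleCat.{0} R) i).obj (op (ModuleCat.of R (R ⧸ J ^ t)))).obj M) :
    ∃ (t' : ℕ) (ht : t ≤ t'),
      (((Ext R (ModuleCat.{0} R) i).map (Quiver.Hom.op (ModuleCat.ofHom
        (Submodule.mapQ (J ^ t') (J ^ t) LinearMap.id (Ideal.pow_le_pow_right ht))))).app M) x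
        = 0 := by
  let D := localCohomology.diagram (localCohomology.idealPowersDiagram J) i
  let F : ℕᵒᵖᵒᵖ ⥤ ModuleCat.{0} R := D ⋙ (evaluation _ _).obj M
  have hc : IsColimit (((evaluation _ _).obj M).mapCocone (colimit.cocone D)) :=
    isColimitOfPreserves _ (colimit.isColimit D)
  have hs : Subsingleton (((evaluation _ _).obj M).mapCocone (colimit.cocone D)).pt := h
  let x' : F.obj (op (op t)) := x
  have := (Concrete.isColimit_rep_eq_iff_exists F (i := op (op t)) (j := op (op t)) hc x' 0).1
    (@Subsingleton.elim _ hs _ _)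
  obtain ⟨k, f, g, hk⟩ := this
  refine ⟨k.unop.unop, f.unop.unop.down.down, ?_⟩
  rw [map_zero] at hk
  exact hk


variable {X X' : ModuleCat.{0} R}

/-- the cochain complex Hom(P, Y). -/
abbrev yonC (P : ProjectiveResolution X) (Y : ModuleCat.{0} R) : ChainComplex (ModuleCat R)ᵒᵖ ℕ :=
  ((((linearYoneda R (ModuleCat.{0} R)).obj Y).rightOp.mapHomologicalComplex _).obj P.complex)

lemma ext_old_cocycle (Y : ModuleCat.{0} R) (n : ℕ) (P : ProjectiveResolution X)
    (f : P.complex.X n ⟶ Y) (hf : P.complex.d (n+1) n ≫ f = 0) :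
    ∃ x : ((Ext R (ModuleCat.{0} R) n).obj (op X)).obj Y,
      ∀ (X' : ModuleCat.{0} R) (P' : ProjectiveResolution X') (g : X' ⟶ X)
        (φ : ProjectiveResolution.Hom P' P g),
        (((Ext R (ModuleCat.{0} R) n).map g.op).app Y) x = 0 →
          (n = 0 → φ.hom.f n ≫ f = 0) ∧
          ∀ m, m + 1 = n → ∃ g : P'.complex.X m ⟶ Y, P'.complex.d n m ≫ g = φ.hom.f n ≫ f := by
  let K := yonC P Y
  -- cocycle
  have hz : ∃ z : (K.opcycles n).unop, (K.pOpcycles n).unop z = f := by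
    have e1 := ShortComplex.exact_of_g_is_cokernel
      (S := ShortComplex.mk (K.d (n+1) n) (K.pOpcycles n) (by simp))
      (K.opcyclesIsCokernel (n+1) n (by simp))
    exact (ShortComplex.moduleCat_exact_iff _).1 e1.unop f hf
  obtain ⟨z, hz⟩ := hz
  let F := ((linearYoneda R (ModuleCat.{0} R)).obj Y).rightOp
  refine ⟨(P.isoLeftDerivedObj F n).hom.unop ((K.homologyι n).unop z), ?_⟩
  intro X' P' g φ h0
  let K' := yonC P' Y
  have nat := ProjectiveResolution.isoLeftDerivedObj_hom_naturality g P' P φ.hom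
    φ.hom_f_zero_comp_π_f_zero F n
  have nat' := congrArg Quiver.Hom.unop nat
  have h1 : ((F.leftDerived n).map g).unop ((P.isoLeftDerivedObj F n).hom.unop ((K.homologyι n).unop z)) = 0 := h0
  have h2 := congrArg (fun q => q.hom ((K.homologyι n).unop z)) nat'
  have h3 : (P'.isoLeftDerivedObj F n).hom.unop
      ((HomologicalComplex.homologyMap ((F.mapHomologicalComplex _).map φ.hom) n).unop
        ((K.homologyι n).unop z)) = 0 := by
    refine Eq.trans h2.symm h1
  have hinj : Function.Injective (P'.isoLeftDerivedObj F n).hom.unop :=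
    (ModuleCat.mono_iff_injective _).1 inferInstance
  have h4 := hinj (h3.trans (map_zero _).symm)
  have h5 := congrArg (fun q => q.unop.hom z)
    (HomologicalComplex.homologyι_naturality ((F.mapHomologicalComplex _).map φ.hom) n)
  have h6 : (K'.homologyι n).unop
      ((HomologicalComplex.opcyclesMap ((F.mapHomologicalComplex _).map φ.hom) n).unop z) = 0 := by
    refine Eq.trans h5.symm h4
  have h8 := congrArg (fun q => q.unop.hom z)
    (HomologicalComplex.p_opcyclesMap ((F.mapHomologicalComplex _).map φ.hom) n)
  have h9 : (K'.pOpcycles n).unop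
     ((HomologicalComplex.opcyclesMap ((F.mapHomologicalComplex _).map φ.hom) n).unop z) =
      φ.hom.f n ≫ f := by
    refine Eq.trans h8 ?_
    rw [← hz]
    rfl
  constructor
  · rintro rfl
    have hinj : Function.Injective (K'.homologyι 0).unop :=
      (ModuleCat.mono_iff_injective _).1 inferInstance
    rw [← h9, hinj (h6.trans (map_zero _).symm), map_zero]
    rfl
  intro m hm
  have e1 := ShortComplex.exact_of_f_is_kernel
      (S := ShortComplex.mk (K'.homologyι n) (K'.fromOpcycles n m) (by simp))
      (K'.homologyIsKernel n m (by simp [← hm]))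
  obtain ⟨w, hw⟩ := (ShortComplex.moduleCat_exact_iff _).1 e1.unop _ h6
  refine ⟨w, ?_⟩
  have h7 := congrArg (fun q => q.unop.hom w) (K'.p_fromOpcycles n m)
  rw [← h9, ← hw]
  exact h7.symm
lemma lc_ext_dies (J : Ideal R) (i : ℕ) (M : ModuleCat.{0} R)
    (h : Subsingleton ((localCohomology J i).obj M)) (t : ℕ)
    (x : Abelian.Ext (ModuleCat.of R (R ⧸ J ^ t)) M i) :
    ∃ (t' : ℕ) (ht : t ≤ t'),
      (Abelian.Ext.mk₀ (ModuleCat.ofHom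
        (Submodule.mapQ (J ^ t') (J ^ t) LinearMap.id (Ideal.pow_le_pow_right ht)))).comp x
          (zero_add i) = 0 := by
  let P := projectiveResolution (ModuleCat.of R (R ⧸ J ^ t))
  obtain ⟨f, hf, rfl⟩ := P.extMk_surjective x (i+1) rfl
  obtain ⟨y, hy⟩ := ext_old_cocycle M i P f hf
  obtain ⟨t', ht, h0⟩ := lc_dies J i M h t y
  refine ⟨t', ht, ?_⟩
  let P' := projectiveResolution (ModuleCat.of R (R ⧸ J ^ t'))
  let g := ModuleCat.ofHom
        (Submodule.mapQ (J ^ t') (J ^ t) LinearMap.id (Ideal.pow_le_pow_right ht))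
  let φ : ProjectiveResolution.Hom P' P g :=
    { hom := ProjectiveResolution.lift g P' P
      hom_f_zero_comp_π_f_zero := ProjectiveResolution.lift_commutes_zero g P' P }
  have h1 := hy _ P' g φ h0
  refine (ProjectiveResolution.mk₀_comp_extMk f (i+1) rfl hf φ).trans ?_
  rcases i with _ | m
  · simp [h1.1 rfl]
  · exact (ProjectiveResolution.extMk_eq_zero_iff _ _ _ _ _ m rfl).2 (h1.2 m rfl)

end Bridge

/-! ## Local cohomology as a delta functor -/
section LC
open CategoryTheory.Abelian

variable {R : Type} [CommRing R] (J : Ideal R)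

/-- transition quotient map -/
def trq {t t' : ℕ} (ht : t ≤ t') : ModuleCat.of R (R ⧸ J ^ t') ⟶ ModuleCat.of R (R ⧸ J ^ t) :=
  ModuleCat.ofHom (Submodule.mapQ (J ^ t') (J ^ t) LinearMap.id (Ideal.pow_le_pow_right ht))

lemma trq_refl (t : ℕ) : trq J (le_refl t) = 𝟙 _ := by
  ext; rfl

lemma trq_trans {t t' t'' : ℕ} (h : t ≤ t') (h' : t' ≤ t'') :
    trq J h' ≫ trq J h = trq J (h.trans h') := by
  ext; rfl

/-- The Ext groups in the direct system. -/
abbrev EX (i : ℕ) (M : Type) [AddCommGroup M] [Module R M] (t : ℕ) : Type :=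
  Abelian.Ext (ModuleCat.of R (R ⧸ J ^ t)) (ModuleCat.of R M) i

/-- transition maps -/
def trE (i : ℕ) (M : Type) [AddCommGroup M] [Module R M] (t t' : ℕ) (h : t ≤ t') :
    EX J i M t →ₗ[R] EX J i M t' :=
  Ext.bilinearCompOfLinear R _ _ _ 0 i i (zero_add i) (Ext.mk₀ (trq J h))

lemma trE_apply (i : ℕ) (M : Type) [AddCommGroup M] [Module R M] (t t' : ℕ) (h : t ≤ t')
    (x : EX J i M t) : trE J i M t t' h x = (Ext.mk₀ (trq J h)).comp x (zero_add i) := rfl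

instance (i : ℕ) (M : Type) [AddCommGroup M] [Module R M] :
    DirectedSystem (EX J i M) fun t t' h => trE J i M t t' h where
  map_self t x := by simp [trE_apply, trq_refl]
  map_map t t' t'' h h' x := by
    rw [trE_apply, trE_apply, trE_apply, Ext.mk₀_comp_mk₀_assoc, trq_trans]

/-- local cohomology -/
def lcH (i : ℕ) (M : Type) [AddCommGroup M] [Module R M] : Type :=
  Module.DirectLimit (EX J i M) (trE J i M)

variable {M N L M' N' L' : Type} [AddCommGroup M] [Module R M] [AddCommGroup N] [Module R N]
  [AddCommGroup L] [Module R L] [AddCommGroup M'] [Module R M'] [AddCommGroup N'] [Module R N']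
  [AddCommGroup L'] [Module R L']

instance (i : ℕ) : AddCommGroup (lcH J i M) := by unfold lcH; infer_instance
instance (i : ℕ) : Module R (lcH J i M) := by unfold lcH; infer_instance

/-- inclusion of a term -/
def lcOf (i : ℕ) (M : Type) [AddCommGroup M] [Module R M] (t : ℕ) : EX J i M t →ₗ[R] lcH J i M :=
  Module.DirectLimit.of R ℕ (EX J i M) (trE J i M) t

lemma lcOf_surj {i : ℕ} (x : lcH J i M) : ∃ t y, lcOf J i M t y = x :=
  Module.DirectLimit.exists_of x

lemma lcOf_tr {i t t' : ℕ} (h : t ≤ t') (x : EX J i M t) :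
    lcOf J i M t' ((Ext.mk₀ (trq J h)).comp x (zero_add i)) = lcOf J i M t x :=
  Module.DirectLimit.of_f (f := trE J i M)

lemma lcOf_zero {i t : ℕ} {x : EX J i M t} (h : lcOf J i M t x = 0) :
    ∃ (t' : ℕ) (ht : t ≤ t'), (Ext.mk₀ (trq J ht)).comp x (zero_add i) = 0 := by
  obtain ⟨t', ht, h⟩ := Module.DirectLimit.of.zero_exact h
  exact ⟨t', ht, h⟩

/-- the bridge -/
lemma lcH_subsingleton (i : ℕ)
    (h : Subsingleton ((localCohomology J i).obj (ModuleCat.of R M))) :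
    Subsingleton (lcH J i M) := by
  refine subsingleton_of_forall_eq 0 fun x => ?_
  obtain ⟨t, y, rfl⟩ := lcOf_surj J x
  obtain ⟨t', ht, h0⟩ := lc_ext_dies J i _ h t y
  rw [← lcOf_tr J ht]
  exact (congrArg _ h0).trans (map_zero _)

/-- composition with an Ext class -/
def lcComp {i b c : ℕ} (h : i + b = c) (e : Ext (ModuleCat.of R M) (ModuleCat.of R N) b) :
    lcH J i M →ₗ[R] lcH J c N :=
  Module.DirectLimit.map
    (fun t => (Ext.bilinearCompOfLinear R (ModuleCat.of R (R ⧸ J ^ t)) _ _ i b c h).flip e)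
    (fun t t' ht => by
      ext x
      simp only [LinearMap.comp_apply, LinearMap.flip_apply, Ext.bilinearCompOfLinear_apply_apply,
        trE_apply]
      rw [Ext.comp_assoc _ _ _ _ _ (by lia)])

lemma lcComp_of {i b c : ℕ} (h : i + b = c) (e : Ext (ModuleCat.of R M) (ModuleCat.of R N) b)
    (t : ℕ) (x : EX J i M t) : lcComp J h e (lcOf J i M t x) = lcOf J c N t (x.comp e h) :=
  Module.DirectLimit.map_apply_of _ _ _

/-- functoriality -/
def lcMap (i : ℕ) (f : M →ₗ[R] N) : lcH J i M →ₗ[R] lcH J i N :=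
  lcComp J (add_zero i) (Ext.mk₀ (ModuleCat.ofHom f))

lemma lcMap_of {i : ℕ} (f : M →ₗ[R] N) (t : ℕ) (x : EX J i M t) :
   lcMap J i f (lcOf J i M t x) =
    lcOf J i N t (x.comp (Ext.mk₀ (ModuleCat.ofHom f)) (add_zero i)) :=
  lcComp_of _ _ _ _ _

lemma lcMap_id (i : ℕ) (x : lcH J i M) : lcMap J i (LinearMap.id : M →ₗ[R] M) x = x := by
  obtain ⟨t, y, rfl⟩ := lcOf_surj J x
  rw [lcMap_of]
  congr 1
  exact Ext.comp_mk₀_id y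

lemma lcMap_comp (i : ℕ) (f : M →ₗ[R] N) (g : N →ₗ[R] L) (x : lcH J i M) :
    lcMap J i (g ∘ₗ f) x = lcMap J i g (lcMap J i f x) := by
  obtain ⟨t, y, rfl⟩ := lcOf_surj J x
  rw [lcMap_of, lcMap_of, lcMap_of, Ext.comp_assoc _ _ _ _ (add_zero 0) (by lia),
    Ext.mk₀_comp_mk₀]
  rfl

lemma lcMap_add (i : ℕ) (f g : M →ₗ[R] N) (x : lcH J i M) :
    lcMap J i (f + g) x = lcMap J i f x + lcMap J i g x := by
  obtain ⟨t, y, rfl⟩ := lcOf_surj J x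
  rw [lcMap_of, lcMap_of, lcMap_of, ← map_add, ← Ext.comp_add, ← Ext.mk₀_add]
  rfl

lemma lcMap_smul (i : ℕ) (r : R) (f : M →ₗ[R] N) (x : lcH J i M) :
    lcMap J i (r • f) x = r • lcMap J i f x := by
  obtain ⟨t, y, rfl⟩ := lcOf_surj J x
  rw [lcMap_of, lcMap_of, ← map_smul, ← Ext.comp_smul, ← Ext.mk₀_smul]
  rfl

lemma lcMap_zero (i : ℕ) (x : lcH J i M) : lcMap J i (0 : M →ₗ[R] N) x = 0 := by
  have := lcMap_smul J i (0 : R) (0 : M →ₗ[R] N) x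
  simpa using this

lemma lcMap_neg (i : ℕ) (f : M →ₗ[R] N) (x : lcH J i M) :
    lcMap J i (-f) x = - lcMap J i f x := by
  have := lcMap_smul J i (-1 : R) f x
  simpa using this

lemma lcMap_sub (i : ℕ) (f g : M →ₗ[R] N) (x : lcH J i M) :
    lcMap J i (f - g) x = lcMap J i f x - lcMap J i g x := by
  rw [sub_eq_add_neg, lcMap_add, lcMap_neg, sub_eq_add_neg]

/-- A short exact sequence of modules. -/
structure SES (f : M →ₗ[R] N) (g : N →ₗ[R] L) : Prop where
  inj : Function.Injective f
  exact : Function.Exact f g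
  surj : Function.Surjective g

lemma SES.comp_zero {f : M →ₗ[R] N} {g : N →ₗ[R] L} (h : SES f g) : g ∘ₗ f = 0 :=
  h.exact.linearMap_comp_eq_zero

/-- associated short complex -/
def SES.sc {f : M →ₗ[R] N} {g : N →ₗ[R] L} (h : SES f g) : ShortComplex (ModuleCat.{0} R) :=
  ShortComplex.mk (ModuleCat.ofHom f) (ModuleCat.ofHom g)
    (by rw [← ModuleCat.ofHom_comp, h.comp_zero]; rfl)

lemma SES.se {f : M →ₗ[R] N} {g : N →ₗ[R] L} (h : SES f g) : h.sc.ShortExact where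
  exact := (ShortComplex.ShortExact.moduleCat_exact_iff_function_exact _).2 h.exact
  mono_f := (ModuleCat.mono_iff_injective _).2 h.inj
  epi_g := (ModuleCat.epi_iff_surjective _).2 h.surj

/-- the Ext class -/
def SES.ec {f : M →ₗ[R] N} {g : N →ₗ[R] L} (h : SES f g) :
    Ext (ModuleCat.of R L) (ModuleCat.of R M) 1 := h.se.extClass

/-- connecting map -/
def lcδ {f : M →ₗ[R] N} {g : N →ₗ[R] L} (h : SES f g) (i : ℕ) : lcH J i L →ₗ[R] lcH J (i+1) M :=
  lcComp J rfl h.ec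

lemma lcδ_of {f : M →ₗ[R] N} {g : N →ₗ[R] L} (h : SES f g) (i t : ℕ) (x : EX J i L t) :
    lcδ J h i (lcOf J i L t x) = lcOf J (i+1) M t (x.comp h.ec rfl) :=
  lcComp_of _ _ _ _ _

lemma lc_exact1 {f : M →ₗ[R] N} {g : N →ₗ[R] L} (h : SES f g) (i : ℕ) (x : lcH J (i+1) M)
    (hx : lcMap J (i+1) f x = 0) : ∃ y, lcδ J h i y = x := by
  obtain ⟨t, x, rfl⟩ := lcOf_surj J x
  rw [lcMap_of] at hx
  obtain ⟨t', ht, hx⟩ := lcOf_zero J hx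
  rw [← Ext.comp_assoc _ _ _ (zero_add (i+1)) _ (by lia)] at hx
  obtain ⟨y, hy⟩ : ∃ y : EX J i L t', y.comp h.ec rfl = _ := Ext.covariant_sequence_exact₁ _ h.se _ hx (n₀ := i) rfl
  refine ⟨lcOf J i L t' y, ?_⟩
  rw [lcδ_of, ← lcOf_tr J ht x]
  exact congrArg _ hy

lemma lc_exact2 {f : M →ₗ[R] N} {g : N →ₗ[R] L} (h : SES f g) (i : ℕ) (x : lcH J i N)
    (hx : lcMap J i g x = 0) : ∃ y, lcMap J i f y = x := by
  obtain ⟨t, x, rfl⟩ := lcOf_surj J x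
  rw [lcMap_of] at hx
  obtain ⟨t', ht, hx⟩ := lcOf_zero J hx
  rw [← Ext.comp_assoc _ _ _ (zero_add i) _ (by lia)] at hx
  obtain ⟨y, hy⟩ : ∃ y : EX J i M t', y.comp (Ext.mk₀ (ModuleCat.ofHom f)) (add_zero i) = _ :=
    Ext.covariant_sequence_exact₂ _ h.se _ hx
  refine ⟨lcOf J i M t' y, ?_⟩
  rw [lcMap_of, ← lcOf_tr J ht x]
  exact congrArg _ hy

lemma lc_exact3 {f : M →ₗ[R] N} {g : N →ₗ[R] L} (h : SES f g) (i : ℕ) (x : lcH J i L)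
    (hx : lcδ J h i x = 0) : ∃ y, lcMap J i g y = x := by
  obtain ⟨t, x, rfl⟩ := lcOf_surj J x
  rw [lcδ_of] at hx
  obtain ⟨t', ht, hx⟩ := lcOf_zero J hx
  rw [← Ext.comp_assoc _ _ _ (zero_add i) _ (by lia)] at hx
  obtain ⟨y, hy⟩ : ∃ y : EX J i N t', y.comp (Ext.mk₀ (ModuleCat.ofHom g)) (add_zero i) = _ :=
    Ext.covariant_sequence_exact₃ _ h.se _ rfl hx
  refine ⟨lcOf J i N t' y, ?_⟩
  rw [lcMap_of, ← lcOf_tr J ht x]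
  exact congrArg _ hy

lemma lc_map_δ {f : M →ₗ[R] N} {g : N →ₗ[R] L} (h : SES f g) (i : ℕ) (x : lcH J i L) :
    lcMap J (i+1) f (lcδ J h i x) = 0 := by
  obtain ⟨t, x, rfl⟩ := lcOf_surj J x
  rw [lcδ_of, lcMap_of, Ext.comp_assoc (a₂₃ := 1) _ _ _ _ (add_zero 1) (by lia)]
  have : h.ec.comp (Ext.mk₀ (ModuleCat.ofHom f)) (add_zero 1) = 0 := h.se.extClass_comp
  rw [this, Ext.comp_zero, map_zero]

lemma lc_δ_map {f : M →ₗ[R] N} {g : N →ₗ[R] L} (h : SES f g) (i : ℕ) (x : lcH J i N) :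
    lcδ J h i (lcMap J i g x) = 0 := by
  obtain ⟨t, x, rfl⟩ := lcOf_surj J x
  rw [lcMap_of, lcδ_of, Ext.comp_assoc (a₂₃ := 1) _ _ _ _ (by lia) (by lia)]
  have : (Ext.mk₀ (ModuleCat.ofHom g)).comp h.ec (zero_add 1) = 0 := h.se.comp_extClass
  rw [this, Ext.comp_zero, map_zero]

lemma lc_δ_nat {f : M →ₗ[R] N} {g : N →ₗ[R] L} (h : SES f g)
    {f' : M' →ₗ[R] N'} {g' : N' →ₗ[R] L'} (h' : SES f' g')
    (a : M →ₗ[R] M') (b : N →ₗ[R] N') (c : L →ₗ[R] L')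
    (hab : b ∘ₗ f = f' ∘ₗ a) (hbc : c ∘ₗ g = g' ∘ₗ b) (i : ℕ) (x : lcH J i L) :
    lcMap J (i+1) a (lcδ J h i x) = lcδ J h' i (lcMap J i c x) := by
  obtain ⟨t, x, rfl⟩ := lcOf_surj J x
  rw [lcδ_of, lcMap_of, lcMap_of, lcδ_of, Ext.comp_assoc (a₂₃ := 1) _ _ _ _ (add_zero 1) (by lia),
    Ext.comp_assoc (a₂₃ := 1) _ _ _ _ (by lia) (by lia)]
  let φ : h.sc ⟶ h'.sc :=
    { τ₁ := ModuleCat.ofHom a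
      τ₂ := ModuleCat.ofHom b
      τ₃ := ModuleCat.ofHom c
      comm₁₂ := by
        change ModuleCat.ofHom a ≫ ModuleCat.ofHom f' = ModuleCat.ofHom f ≫ ModuleCat.ofHom b
        rw [← ModuleCat.ofHom_comp, ← ModuleCat.ofHom_comp, hab]
      comm₂₃ := by
        change ModuleCat.ofHom b ≫ ModuleCat.ofHom g' = ModuleCat.ofHom g ≫ ModuleCat.ofHom c
        rw [← ModuleCat.ofHom_comp, ← ModuleCat.ofHom_comp, hbc] }
  have : h.ec.comp (Ext.mk₀ (ModuleCat.ofHom a)) (add_zero 1) =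
    (Ext.mk₀ (ModuleCat.ofHom c)).comp h'.ec (zero_add 1) :=
    ShortComplex.ShortExact.extClass_naturality h.se h'.se φ
  rw [this]

lemma lc_inj0 (f : M →ₗ[R] N) (hf : Function.Injective f) :
    Function.Injective (lcMap J 0 f) := by
  rw [injective_iff_map_eq_zero]
  intro x hx
  obtain ⟨t, x, rfl⟩ := lcOf_surj J x
  rw [lcMap_of] at hx
  obtain ⟨t', ht, hx⟩ := lcOf_zero J hx
  rw [← Ext.comp_assoc _ _ _ (zero_add 0) _ (by lia)] at hx
  have : Mono (ModuleCat.ofHom f) := (ModuleCat.mono_iff_injective _).2 hf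
  have := Ext.postcomp_mk₀_injective_of_mono (ModuleCat.of R (R ⧸ J ^ t')) (ModuleCat.ofHom f)
    (hx.trans (Ext.zero_comp _ _ _ _ (add_zero 0)).symm)
  rw [← lcOf_tr J ht x, this, map_zero]

end LC

/-! ## torsion -/
section LC3
open CategoryTheory.Abelian

variable {R : Type} [CommRing R] (J : Ideal R)
variable {M N L M' N' L' : Type} [AddCommGroup M] [Module R M] [AddCommGroup N] [Module R N]
  [AddCommGroup L] [Module R L] [AddCommGroup M'] [Module R M'] [AddCommGroup N'] [Module R N']
  [AddCommGroup L'] [Module R L']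

/-- killed by a power -/
def TorsE (x : M) : Prop := ∃ t : ℕ, ∀ r ∈ J ^ t, r • x = 0

/-- every element killed by a power -/
def Tors (M : Type) [AddCommGroup M] [Module R M] : Prop := ∀ x : M, TorsE J x

lemma TorsE.map {x : M} (h : TorsE J x) (f : M →ₗ[R] N) : TorsE J (f x) := by
  obtain ⟨t, h⟩ := h
  exact ⟨t, fun r hr => by rw [← map_smul, h r hr, map_zero]⟩

lemma TorsE.of_inj {x : M} (f : M →ₗ[R] N) (hf : Function.Injective f) (h : TorsE J (f x)) :
    TorsE J x := by
  obtain ⟨t, h⟩ := h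
  exact ⟨t, fun r hr => hf (by rw [map_smul, h r hr, map_zero])⟩

lemma Tors.of_surj (h : Tors J M) (f : M →ₗ[R] N) (hf : Function.Surjective f) : Tors J N := by
  intro y
  obtain ⟨x, rfl⟩ := hf y
  exact (h x).map J f

lemma Tors.of_inj (h : Tors J N) (f : M →ₗ[R] N) (hf : Function.Injective f) : Tors J M :=
  fun x => TorsE.of_inj J f hf (h _)

lemma TorsE.add {x y : M} (hx : TorsE J x) (hy : TorsE J y) : TorsE J (x + y) := by
  obtain ⟨t, hx⟩ := hx
  obtain ⟨s, hy⟩ := hy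
  refine ⟨max t s, fun r hr => ?_⟩
  rw [smul_add, hx r (Ideal.pow_le_pow_right (le_max_left _ _) hr),
    hy r (Ideal.pow_le_pow_right (le_max_right _ _) hr), add_zero]

lemma TorsE.smul {x : M} (hx : TorsE J x) (r : R) : TorsE J (r • x) := by
  obtain ⟨t, hx⟩ := hx
  exact ⟨t, fun s hs => by rw [smul_comm, hx s hs, smul_zero]⟩

lemma TorsE.zero : TorsE J (0 : M) := ⟨0, fun _ _ => smul_zero _⟩

/-- the torsion submodule -/
def gam (M : Type) [AddCommGroup M] [Module R M] : Submodule R M where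
  carrier := {x | TorsE J x}
  add_mem' := fun h h' => TorsE.add J h h'
  zero_mem' := TorsE.zero J
  smul_mem' := fun r _ h => TorsE.smul J h r

lemma mem_gam {x : M} : x ∈ gam J M ↔ TorsE J x := Iff.rfl

lemma lcH_tors (i : ℕ) : Tors J (lcH J i M) := by
  intro x
  obtain ⟨t, y, rfl⟩ := lcOf_surj J x
  refine ⟨t, fun r hr => ?_⟩
  rw [← map_smul]
  have h1 : r • y = (r • Ext.mk₀ (𝟙 (ModuleCat.of R (R ⧸ J ^ t)))).comp y (zero_add i) := by
    rw [Ext.smul_comp, Ext.mk₀_id_comp]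
  have h2 : r • 𝟙 (ModuleCat.of R (R ⧸ J ^ t)) = 0 := by
    have hx : ∀ x : R ⧸ J ^ t, r • x = 0 := by
      intro x
      obtain ⟨x, rfl⟩ := Submodule.Quotient.mk_surjective _ x
      rw [← Submodule.Quotient.mk_smul, Submodule.Quotient.mk_eq_zero]
      exact Ideal.mul_mem_right _ _ hr
    apply ModuleCat.hom_ext
    apply LinearMap.ext
    intro x
    exact hx x
  rw [h1, ← Ext.mk₀_smul, h2, Ext.mk₀_zero, Ext.zero_comp, map_zero]

/-- evaluation at one -/
def lcθt (M : Type) [AddCommGroup M] [Module R M] (t : ℕ) : EX J 0 M t →ₗ[R] M where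
  toFun x := (Ext.linearEquiv₀ (R := R) x).hom (1 : R ⧸ J ^ t)
  map_add' x y := by rw [map_add]; rfl
  map_smul' r x := by rw [map_smul]; rfl

lemma lcθt_mk (t : ℕ) (f : ModuleCat.of R (R ⧸ J ^ t) ⟶ ModuleCat.of R M) :
    lcθt J M t (Ext.mk₀ f) = f.hom (1 : R ⧸ J ^ t) := by
  change (Ext.linearEquiv₀ (R := R) (Ext.mk₀ f)).hom (1 : R ⧸ J ^ t) = _
  congr 2
  exact Ext.homEquiv₀.right_inv f

lemma EX0_mk {t : ℕ} (x : EX J 0 M t) : ∃ f : (R ⧸ J ^ t) →ₗ[R] M,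
    x = Ext.mk₀ (ModuleCat.ofHom f) :=
  ⟨(Ext.homEquiv₀ x).hom, (Ext.mk₀_homEquiv₀_apply x).symm⟩

/-- the canonical map -/
def lcθ (M : Type) [AddCommGroup M] [Module R M] : lcH J 0 M →ₗ[R] M :=
  Module.DirectLimit.lift R ℕ (EX J 0 M) (trE J 0 M) (lcθt J M) (by
    intro t t' h x
    obtain ⟨f, rfl⟩ := EX0_mk J x
    rw [trE_apply, Ext.mk₀_comp_mk₀, lcθt_mk, lcθt_mk]
    rfl)

lemma lcθ_of (t : ℕ) (f : (R ⧸ J ^ t) →ₗ[R] M) :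
    lcθ J M (lcOf J 0 M t (Ext.mk₀ (ModuleCat.ofHom f))) = f 1 := by
  refine (Module.DirectLimit.lift_of _ _ _).trans ?_
  exact lcθt_mk _ _ _

lemma lcθ_map (f : M →ₗ[R] N) (x : lcH J 0 M) : lcθ J N (lcMap J 0 f x) = f (lcθ J M x) := by
  obtain ⟨t, y, rfl⟩ := lcOf_surj J x
  obtain ⟨g, rfl⟩ := EX0_mk J y
  rw [lcMap_of, Ext.mk₀_comp_mk₀, lcθ_of, ← ModuleCat.ofHom_comp, lcθ_of]
  rfl

lemma lcθ_inj : Function.Injective (lcθ J M) := by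
  rw [injective_iff_map_eq_zero]
  intro x hx
  obtain ⟨t, y, rfl⟩ := lcOf_surj J x
  obtain ⟨g, rfl⟩ := EX0_mk J y
  rw [lcθ_of] at hx
  have : g = 0 := by
    ext
    simpa using hx
  rw [this]
  exact (congrArg _ (Ext.mk₀_zero _ _)).trans (map_zero _)

lemma lcθ_surj {x : M} (hx : TorsE J x) : ∃ y, lcθ J M y = x := by
  obtain ⟨t, hx⟩ := hx
  refine ⟨lcOf J 0 M t (Ext.mk₀ (ModuleCat.ofHom
    (Submodule.liftQ (J ^ t) (LinearMap.toSpanSingleton R M x) (fun r hr => hx r hr)))), ?_⟩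
  rw [lcθ_of]
  exact one_smul _ _

lemma lc0_zero_iff : Subsingleton (lcH J 0 M) ↔ ∀ x : M, TorsE J x → x = 0 := by
  constructor
  · intro h x hx
    obtain ⟨y, rfl⟩ := lcθ_surj J hx
    rw [Subsingleton.elim y 0, map_zero]
  · intro h
    refine subsingleton_of_forall_eq 0 fun x => lcθ_inj J ?_
    rw [map_zero]
    exact h _ ((lcH_tors J 0 x).map J _)

lemma gam_injective [IsNoetherianRing R] (hI : Module.Injective R M) :
    Module.Injective R (gam J M) := by
  refine Module.Baer.injective ?_
  intro a g
  have ⟨t, ht⟩ : ∃ t, ∀ x : a, ∀ r ∈ J ^ t, r • g x = 0 := by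
    obtain ⟨s, hs⟩ := (inferInstance : Module.Finite R a)
    have : ∀ s : Finset a, ∃ t, ∀ x ∈ s, ∀ r ∈ J ^ t, r • g x = 0 := by
      classical
      intro s
      induction s using Finset.induction with
      | empty => exact ⟨0, by simp⟩
      | insert x s _ ih =>
        obtain ⟨t, ih⟩ := ih
        obtain ⟨t', h'⟩ := (g x).2
        refine ⟨max t t', fun y hy r hr => ?_⟩
        rcases Finset.mem_insert.1 hy with rfl | hy
        · exact Subtype.ext (h' r (Ideal.pow_le_pow_right (le_max_right _ _) hr))
        · exact ih y hy r (Ideal.pow_le_pow_right (le_max_left _ _) hr)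
    obtain ⟨t, ht⟩ := this s
    refine ⟨t, fun x r hr => ?_⟩
    have hx : x ∈ Submodule.span R (s : Set a) := by rw [hs]; trivial
    induction hx using Submodule.span_induction with
    | mem x h => exact ht x h r hr
    | zero => simp
    | add x y _ _ h h' => rw [map_add, smul_add, h, h', add_zero]
    | smul c x _ h => rw [map_smul, smul_comm, h, smul_zero]
  obtain ⟨k, hk⟩ := Ideal.exists_pow_inf_eq_pow_smul J (M := R) a
  have hk' := hk (t + k) (by lia)
  have key : ∀ x : a, (x : R) ∈ J ^ (t + k) → g x = 0 := by
    intro x hx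
    have : (x : R) ∈ J ^ t • (J ^ k • (⊤ : Ideal R) ⊓ a) := by
      rw [show t = t + k - k by lia, ← hk']
      refine ⟨?_, x.2⟩
      simpa using hx
    have h3 : (x : R) ∈ J ^ t • a := Submodule.smul_mono le_rfl inf_le_right this
    have h4 : ∀ y ∈ J ^ t • a, ∃ hy : y ∈ a, g ⟨y, hy⟩ = 0 := by
      intro y hy
      refine Submodule.smul_induction_on hy ?_ ?_
      · intro r hr z hz
        refine ⟨a.smul_mem r hz, ?_⟩
        have := ht ⟨z, hz⟩ r hr
        rw [← map_smul] at this
        exact this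
      · rintro y z ⟨hy, h⟩ ⟨hz, h'⟩
        refine ⟨a.add_mem hy hz, ?_⟩
        have := map_add g ⟨y, hy⟩ ⟨z, hz⟩
        rw [h, h', add_zero] at this
        exact this
    exact (h4 _ h3).2
  obtain ⟨h, hh⟩ := hI.out (Submodule.mapQ (Submodule.comap a.subtype (J ^ (t + k))) (J ^ (t+k))
    a.subtype le_rfl) (by
      rw [← LinearMap.ker_eq_bot, LinearMap.ker_eq_bot']
      intro x hx
      obtain ⟨x, rfl⟩ := Submodule.Quotient.mk_surjective _ x
      rw [Submodule.mapQ_apply, Submodule.Quotient.mk_eq_zero] at hx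
      rw [Submodule.Quotient.mk_eq_zero]
      exact hx)
    (Submodule.liftQ _ ((gam J M).subtype ∘ₗ g) (fun x hx => by
      have := key x hx
      simp [this]))
  refine ⟨LinearMap.toSpanSingleton R _ ⟨h (Submodule.Quotient.mk 1), ⟨t + k, fun r hr => ?_⟩⟩, ?_⟩
  · rw [← map_smul, ← Submodule.Quotient.mk_smul, (Submodule.Quotient.mk_eq_zero _).2, map_zero]
    simpa using hr
  · intro x hx
    have := hh (Submodule.Quotient.mk ⟨x, hx⟩)
    rw [Submodule.mapQ_apply, Submodule.liftQ_apply] at this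
    apply Subtype.ext
    refine Eq.trans ?_ this
    change x • h (Submodule.Quotient.mk 1) = h (Submodule.Quotient.mk x)
    rw [← map_smul, ← Submodule.Quotient.mk_smul, smul_eq_mul, mul_one]

lemma lc_injective (hI : Module.Injective R M) (i : ℕ) : Subsingleton (lcH J (i+1) M) := by
  have := Module.injective_object_of_injective_module R M
  refine subsingleton_of_forall_eq 0 fun x => ?_
  obtain ⟨t, y, rfl⟩ := lcOf_surj J x
  rw [Ext.eq_zero_of_injective y, map_zero]

lemma exists_tors_ses [IsNoetherianRing R] (hM : Tors J M) :
    ∃ (I C : Type) (_ : AddCommGroup I) (_ : AddCommGroup C) (_ : Module R I) (_ : Module R C)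
      (f : M →ₗ[R] I) (g : I →ₗ[R] C), SES f g ∧ Module.Injective R I ∧ Tors J I ∧ Tors J C := by
  let I := Injective.under (ModuleCat.of R M)
  let ι := Injective.ι (ModuleCat.of R M)
  have hι : Function.Injective ι.hom := (ModuleCat.mono_iff_injective _).1 inferInstance
  have hI0 : Injective (ModuleCat.of R I) := inferInstanceAs (Injective (Injective.under _))
  have hI : Module.Injective R I := Module.injective_module_of_injective_object R I
  let f : M →ₗ[R] gam J I := ι.hom.codRestrict _ (fun x => (hM x).map J ι.hom)
  have hf : Function.Injective f := fun x y h => hι (congrArg Subtype.val h)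
  refine ⟨gam J I, gam J I ⧸ LinearMap.range f, inferInstance, inferInstance, inferInstance,
    inferInstance, f, Submodule.mkQ _, ⟨hf, ?_, Submodule.mkQ_surjective _⟩,
    gam_injective J hI, ?_, ?_⟩
  · exact LinearMap.exact_map_mkQ_range f
  · exact fun x => TorsE.of_inj J (gam J I).subtype Subtype.val_injective x.2
  · refine Tors.of_surj J (M := gam J I) ?_ (Submodule.mkQ _) (Submodule.mkQ_surjective _)
    exact fun x => TorsE.of_inj J (gam J I).subtype Subtype.val_injective x.2

lemma lc_tors_zero [IsNoetherianRing R] (hM : Tors J M) (i : ℕ) : Subsingleton (lcH J (i+1) M) := by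
  induction i generalizing M with
  | zero =>
    obtain ⟨I, C, _, _, _, _, f, g, h, hI, hI', hC⟩ := exists_tors_ses J hM
    refine subsingleton_of_forall_eq 0 fun x => ?_
    obtain ⟨y, rfl⟩ := lc_exact1 J h 0 x
      ((lc_injective J hI 0).elim _ _)
    obtain ⟨z, hz⟩ := h.surj (lcθ J _ y)
    obtain ⟨z', rfl⟩ := lcθ_surj J (hI' z)
    rw [← lcθ_map] at hz
    rw [← lcθ_inj J hz, lc_δ_map]
  | succ i ih =>
    obtain ⟨I, C, _, _, _, _, f, g, h, hI, hI', hC⟩ := exists_tors_ses J hM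
    refine subsingleton_of_forall_eq 0 fun x => ?_
    obtain ⟨y, rfl⟩ := lc_exact1 J h (i+1) x
      ((lc_injective J hI (i+1)).elim _ _)
    rw [(ih hC).elim y 0, map_zero]

end LC3

/-! ## consequences -/
section LC4

variable {R : Type} [CommRing R] (J : Ideal R)
variable {M N L M' N' L' : Type} [AddCommGroup M] [Module R M] [AddCommGroup N] [Module R N]
  [AddCommGroup L] [Module R L] [AddCommGroup M'] [Module R M'] [AddCommGroup N'] [Module R N']
  [AddCommGroup L'] [Module R L']

/-- vanishing of local cohomology -/
def LZ (i : ℕ) (M : Type) [AddCommGroup M] [Module R M] : Prop := ∀ x : lcH J i M, x = 0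

lemma LZ_iff {i : ℕ} : LZ J i M ↔ Subsingleton (lcH J i M) :=
  ⟨fun h => subsingleton_of_forall_eq 0 h, fun _ _ => Subsingleton.elim _ _⟩

lemma LZ0_iff : LZ J 0 M ↔ ∀ x : M, TorsE J x → x = 0 := (LZ_iff J).trans (lc0_zero_iff J)

/-- torsion cokernel -/
def TC (f : M →ₗ[R] N) : Prop := ∀ y : N, ∃ t : ℕ, ∀ r ∈ J ^ t, r • y ∈ LinearMap.range f

/-- torsion kernel -/
def TK (f : M →ₗ[R] N) : Prop := ∀ x : M, f x = 0 → TorsE J x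

lemma TC.tors {f : M →ₗ[R] N} (h : TC J f) : Tors J (N ⧸ LinearMap.range f) := by
  intro y
  obtain ⟨y, rfl⟩ := Submodule.Quotient.mk_surjective _ y
  obtain ⟨t, ht⟩ := h y
  exact ⟨t, fun r hr => by
    rw [← Submodule.Quotient.mk_smul, Submodule.Quotient.mk_eq_zero]; exact ht r hr⟩

lemma TC.of_surj {f : M →ₗ[R] N} (h : Function.Surjective f) : TC J f := by
  intro y
  exact ⟨0, fun r _ => h _⟩

lemma TK.of_inj {f : M →ₗ[R] N} (h : Function.Injective f) : TK J f := by
  intro x hx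
  rw [h (hx.trans (map_zero f).symm)]
  exact TorsE.zero J

lemma TK.tors {f : M →ₗ[R] N} (h : TK J f) : Tors J (LinearMap.ker f) := by
  intro x
  exact TorsE.of_inj J (LinearMap.ker f).subtype Subtype.val_injective (h x x.2)

/-- SES of a submodule -/
lemma SES.mkQ (U : Submodule R M) : SES U.subtype U.mkQ :=
  ⟨Subtype.val_injective, LinearMap.exact_subtype_mkQ U, U.mkQ_surjective⟩

/-- SES of a surjection -/
lemma SES.ofSurj {g : N →ₗ[R] L} (h : Function.Surjective g) :
    SES (LinearMap.ker g).subtype g :=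
  ⟨Subtype.val_injective, LinearMap.exact_subtype_ker_map g, h⟩

/-- SES of an injection -/
lemma SES.ofInj {g : M →ₗ[R] N} (h : Function.Injective g) :
    SES g (LinearMap.range g).mkQ :=
  ⟨h, LinearMap.exact_map_mkQ_range g, Submodule.mkQ_surjective _⟩

lemma lc_inj_of {f : M →ₗ[R] N} {g : N →ₗ[R] L} (h : SES f g) {i : ℕ} (hL : LZ J i L) :
    Function.Injective (lcMap J (i+1) f) := by
  rw [injective_iff_map_eq_zero]
  intro x hx
  obtain ⟨y, rfl⟩ := lc_exact1 J h i x hx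
  rw [hL y, map_zero]

lemma lc_inj_of' {f : M →ₗ[R] N} {g : N →ₗ[R] L} (h : SES f g) {i : ℕ} (hM : LZ J i M) :
    Function.Injective (lcMap J i g) := by
  rw [injective_iff_map_eq_zero]
  intro x hx
  obtain ⟨y, rfl⟩ := lc_exact2 J h i x hx
  rw [hM y, map_zero]

lemma lc_surj_of {f : M →ₗ[R] N} {g : N →ₗ[R] L} (h : SES f g) {i : ℕ} (hL : LZ J i L) :
    Function.Surjective (lcMap J i f) := by
  intro x
  exact lc_exact2 J h i x (hL _)

lemma lc_surj_of' {f : M →ₗ[R] N} {g : N →ₗ[R] L} (h : SES f g) {i : ℕ} (hM : LZ J (i+1) M) :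
    Function.Surjective (lcMap J i g) := by
  intro x
  exact lc_exact3 J h i x (hM _)

lemma lc_δ_inj {f : M →ₗ[R] N} {g : N →ₗ[R] L} (h : SES f g) {i : ℕ} (hN : LZ J i N) :
    Function.Injective (lcδ J h i) := by
  rw [injective_iff_map_eq_zero]
  intro x hx
  obtain ⟨y, rfl⟩ := lc_exact3 J h i x hx
  rw [hN y, map_zero]

lemma lc_δ_surj {f : M →ₗ[R] N} {g : N →ₗ[R] L} (h : SES f g) {i : ℕ} (hN : LZ J (i+1) N) :
    Function.Surjective (lcδ J h i) := by
  intro x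
  exact lc_exact1 J h i x (hN _)

lemma LZ.tors [IsNoetherianRing R] (h : Tors J M) (i : ℕ) : LZ J (i+1) M := (LZ_iff J).2 (lc_tors_zero J h i)

lemma LZ.mid {f : M →ₗ[R] N} {g : N →ₗ[R] L} (h : SES f g) {i : ℕ} (hM : LZ J i M)
    (hL : LZ J i L) : LZ J i N := by
  intro x
  obtain ⟨y, rfl⟩ := lc_exact2 J h i x (hL _)
  rw [hM y, map_zero]

lemma LZ.left {f : M →ₗ[R] N} {g : N →ₗ[R] L} (h : SES f g) {i : ℕ} (hN : LZ J (i+1) N)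
    (hL : LZ J i L) : LZ J (i+1) M := by
  intro x
  obtain ⟨y, rfl⟩ := lc_exact1 J h i x (hN _)
  rw [hL y, map_zero]

lemma LZ.right {f : M →ₗ[R] N} {g : N →ₗ[R] L} (h : SES f g) {i : ℕ} (hN : LZ J i N)
    (hM : LZ J (i+1) M) : LZ J i L := by
  intro x
  obtain ⟨y, rfl⟩ := lc_exact3 J h i x (hM _)
  rw [hN y, map_zero]

lemma LZ0.sub {f : M →ₗ[R] N} (h : Function.Injective f) (hN : LZ J 0 N) : LZ J 0 M := by
  intro x
  exact lc_inj0 J f h ((hN _).trans (map_zero _).symm)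

lemma LZ1.sub {f : M →ₗ[R] N} {g : N →ₗ[R] L} (h : SES f g) (hN : LZ J 1 N)
    (hL : LZ J 0 L) : LZ J 1 M := LZ.left J h hN hL

lemma LZ.retract {i : ℕ} {f : M →ₗ[R] N} {g : N →ₗ[R] M} (h : g ∘ₗ f = LinearMap.id)
    (hN : LZ J i N) : LZ J i M := by
  intro x
  rw [← lcMap_id J i x, ← h, lcMap_comp, hN (lcMap J i f x), map_zero]

lemma LZ.congr {i : ℕ} (e : M ≃ₗ[R] N) (hN : LZ J i N) : LZ J i M :=
  LZ.retract J (f := e.toLinearMap) (g := e.symm.toLinearMap) (by ext; simp) hN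

/-- surjective with torsion kernel -/
lemma lc_bij_of_surj [IsNoetherianRing R] {g : N →ₗ[R] L} (h : Function.Surjective g) (hk : TK J g) (i : ℕ) :
    Function.Bijective (lcMap J (i+1) g) :=
  ⟨lc_inj_of' J (SES.ofSurj h) (LZ.tors J (hk.tors J) i),
   lc_surj_of' J (SES.ofSurj h) (LZ.tors J (hk.tors J) _)⟩

/-- factoring through the range -/
lemma rangeRes_surj (g : M →ₗ[R] N) : Function.Surjective g.rangeRestrict :=
  g.surjective_rangeRestrict

lemma lc_surj_tors [IsNoetherianRing R] {f : M →ₗ[R] N} (hk : TK J f) (hc : TC J f) (i : ℕ) :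
    Function.Surjective (lcMap J (i+1) f) := by
  have h1 : f = (LinearMap.range f).subtype ∘ₗ f.rangeRestrict := rfl
  intro x
  obtain ⟨y, rfl⟩ := lc_surj_of J (SES.mkQ (LinearMap.range f)) (LZ.tors J (hc.tors J) i) x
  have hk' : TK J f.rangeRestrict := fun x hx => hk x (congrArg Subtype.val hx)
  obtain ⟨z, rfl⟩ := (lc_bij_of_surj J (rangeRes_surj f) hk' i).2 y
  refine ⟨z, ?_⟩
  rw [← lcMap_comp]
  rfl

lemma lc_inj_tors [IsNoetherianRing R] {f : M →ₗ[R] N} (hk : TK J f) (hc : TC J f) (i : ℕ) :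
    Function.Injective (lcMap J (i+2) f) := by
  rw [injective_iff_map_eq_zero]
  intro x hx
  have h1 : f = (LinearMap.range f).subtype ∘ₗ f.rangeRestrict := rfl
  rw [h1, lcMap_comp] at hx
  have h2 := lc_inj_of J (SES.mkQ (LinearMap.range f)) (LZ.tors J (hc.tors J) i)
    (hx.trans (map_zero _).symm)
  have hk' : TK J f.rangeRestrict := fun x hx => hk x (congrArg Subtype.val hx)
  exact (lc_bij_of_surj J (rangeRes_surj f) hk' (i+1)).1 (h2.trans (map_zero _).symm)

lemma LZ.of_tors_dom [IsNoetherianRing R] {f : M →ₗ[R] N} (hk : TK J f) (hc : TC J f) {i : ℕ} (h : LZ J (i+1) M) :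
    LZ J (i+1) N := by
  intro x
  obtain ⟨y, rfl⟩ := lc_surj_tors J hk hc i x
  rw [h y, map_zero]

lemma LZ.of_tors_cod [IsNoetherianRing R] {f : M →ₗ[R] N} (hk : TK J f) (hc : TC J f) {i : ℕ} (h : LZ J (i+2) N) :
    LZ J (i+2) M := by
  intro x
  exact lc_inj_tors J hk hc i ((h _).trans (map_zero _).symm)

lemma Tors.zero_of_reg {x : R} (hx : x ∈ J) (hM : Tors J M) (h : ∀ y : M, x • y = 0 → y = 0)
    (y : M) : y = 0 := by
  obtain ⟨t, ht⟩ := hM y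
  have h1 : x ^ t • y = 0 := ht _ (Ideal.pow_mem_pow hx t)
  clear ht
  induction t with
  | zero => simpa using h1
  | succ t ih => exact ih (h _ (by rw [smul_smul, ← pow_succ', h1]))

/-- free modules -/
lemma LZ.free {i : ℕ} (h : LZ J i R) [Module.Free R M] [Module.Finite R M] : LZ J i M := by
  intro x
  let b := Module.Free.chooseBasis R M
  have h1 : (LinearMap.id : M →ₗ[R] M) = ∑ j, (LinearMap.toSpanSingleton R M (b j)) ∘ₗ b.coord j := by
    ext x
    simp [LinearMap.sum_apply, b.sum_repr]
  have h2 : ∀ s : Finset (Module.Free.ChooseBasisIndex R M),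
    lcMap J i (∑ j ∈ s, (LinearMap.toSpanSingleton R M (b j)) ∘ₗ b.coord j) x = 0 := by
    classical
    intro s
    induction s using Finset.induction with
    | empty => rw [Finset.sum_empty, lcMap_zero]
    | insert j s hj ih =>
      rw [Finset.sum_insert hj, lcMap_add, ih, lcMap_comp, h (lcMap J i (b.coord j) x), map_zero, add_zero]
  rw [← lcMap_id J i x, h1, h2]

end LC4

section Poly

variable (K : Type) [Field K] (n : ℕ)

/-- partial ideals -/
def pI (k : ℕ) : Ideal (PolyS K n) := Ideal.span (MvPolynomial.X '' {i : Fin (n+1) | i.val < k})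

lemma mem_pI {k : ℕ} {f : PolyS K n} :
    f ∈ pI K n k ↔ ∀ m ∈ f.support, ∃ i : Fin (n+1), i.val < k ∧ m i ≠ 0 := by
  rw [pI, MvPolynomial.mem_ideal_span_X_image]
  rfl

lemma pI_reg {k : ℕ} (hk : k < n + 1) {f : PolyS K n}
    (h : MvPolynomial.X ⟨k, hk⟩ * f ∈ pI K n k) : f ∈ pI K n k := by
  rw [mem_pI] at h ⊢
  intro m hm
  obtain ⟨i, hi, h⟩ := h (Finsupp.single ⟨k, hk⟩ 1 + m) (by
    rw [MvPolynomial.mem_support_iff, MvPolynomial.coeff_X_mul]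
    exact MvPolynomial.mem_support_iff.1 hm)
  refine ⟨i, hi, ?_⟩
  rw [Finsupp.add_apply, Finsupp.single_apply, if_neg] at h
  · simpa using h
  · intro h'
    rw [← h'] at hi
    simp at hi

lemma pI_succ {k : ℕ} (hk : k < n + 1) {f : PolyS K n} (hf : f ∈ pI K n (k+1)) :
    ∃ g, f - MvPolynomial.X ⟨k, hk⟩ * g ∈ pI K n k := by
  have h : pI K n (k+1) = Ideal.span {MvPolynomial.X ⟨k, hk⟩} ⊔ pI K n k := by
    rw [pI, pI, ← Ideal.span_union]
    congr 1
    ext f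
    simp only [Set.mem_image, Set.mem_ofPred_eq, Set.singleton_union, Set.mem_insert_iff]
    constructor
    · rintro ⟨i, hi, rfl⟩
      rcases Nat.lt_succ_iff_lt_or_eq.1 hi with h | h
      · exact Or.inr ⟨i, h, rfl⟩
      · left
        congr 1
        exact Fin.ext h
    · rintro (rfl | ⟨i, hi, rfl⟩)
      · exact ⟨_, Nat.lt_succ_self k, rfl⟩
      · exact ⟨i, by lia, rfl⟩
  rw [h, Submodule.mem_sup] at hf
  obtain ⟨a, ha, b, hb, rfl⟩ := hf
  obtain ⟨g, rfl⟩ := Ideal.mem_span_singleton'.1 ha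
  refine ⟨g, ?_⟩
  convert hb using 1
  ring

lemma pI_mono (k : ℕ) : pI K n k ≤ pI K n (k+1) :=
  Ideal.span_mono (Set.image_mono fun i (hi : i.val < k) => by
    change i.val < k + 1
    lia)

lemma pI_ses {k : ℕ} (hk : k < n + 1) :
    SES ((MvPolynomial.X ⟨k, hk⟩ : PolyS K n) • (LinearMap.id : (PolyS K n ⧸ pI K n k) →ₗ[PolyS K n] _))
      (Submodule.mapQ (pI K n k) (pI K n (k+1)) LinearMap.id (pI_mono K n k)) where
  inj := by
    rw [injective_iff_map_eq_zero]
    intro x hx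
    obtain ⟨x, rfl⟩ := Submodule.Quotient.mk_surjective _ x
    rw [LinearMap.smul_apply, LinearMap.id_apply, ← Submodule.Quotient.mk_smul,
      Submodule.Quotient.mk_eq_zero] at hx
    rw [Submodule.Quotient.mk_eq_zero]
    exact pI_reg K n hk hx
  exact := by
    intro y
    obtain ⟨y, rfl⟩ := Submodule.Quotient.mk_surjective _ y
    constructor
    · intro h
      rw [Submodule.mapQ_apply, Submodule.Quotient.mk_eq_zero] at h
      obtain ⟨g, hg⟩ := pI_succ K n hk h
      refine ⟨Submodule.Quotient.mk g, ?_⟩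
      rw [LinearMap.smul_apply, LinearMap.id_apply, ← Submodule.Quotient.mk_smul, eq_comm,
        Submodule.Quotient.eq]
      exact hg
    · rintro ⟨x, hx⟩
      rw [← hx]
      obtain ⟨x, rfl⟩ := Submodule.Quotient.mk_surjective _ x
      rw [LinearMap.smul_apply, LinearMap.id_apply, ← Submodule.Quotient.mk_smul,
        Submodule.mapQ_apply, Submodule.Quotient.mk_eq_zero]
      refine Ideal.mul_mem_right _ _ (Ideal.subset_span ⟨_, ?_, rfl⟩)
      exact Nat.lt_succ_self k
  surj := by
    intro y
    obtain ⟨y, rfl⟩ := Submodule.Quotient.mk_surjective _ y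
    exact ⟨Submodule.Quotient.mk y, rfl⟩

lemma X_mem_irrel (i : Fin (n+1)) : (MvPolynomial.X i : PolyS K n) ∈ irrel K n :=
  Ideal.subset_span ⟨i, rfl⟩

lemma LZ_pI (i k : ℕ) (h : i + k ≤ n) : LZ (irrel K n) i (PolyS K n ⧸ pI K n k) := by
  induction i generalizing k with
  | zero =>
    refine Tors.zero_of_reg _ (X_mem_irrel K n ⟨k, by lia⟩) (lcH_tors _ _) fun y hy => ?_
    refine lc_inj0 (irrel K n) _ (pI_ses K n (k := k) (by lia)).inj ?_
    rw [lcMap_smul, lcMap_id, hy, map_zero]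
  | succ i ih =>
    refine Tors.zero_of_reg _ (X_mem_irrel K n ⟨k, by lia⟩) (lcH_tors _ _) fun y hy => ?_
    refine lc_inj_of (irrel K n) (pI_ses K n (k := k) (by lia)) (ih (k+1) (by lia)) ?_
    rw [lcMap_smul, lcMap_id, hy, map_zero]

lemma LZ_S (i : ℕ) (h : i ≤ n) : LZ (irrel K n) i (PolyS K n) := by
  have h0 : pI K n 0 = ⊥ := by
    simp [pI]
  exact LZ.congr _ (Submodule.quotEquivOfEqBot _ h0).symm (LZ_pI K n i 0 h)

end Poly

/-! ## The symplectic form -/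
section Symp

lemma torsE_of_rad {R : Type} [CommRing R] [IsNoetherianRing R] (J : Ideal R) {M : Type}
    [AddCommGroup M] [Module R M] (G : Set R)
    (hG : J ≤ (Ideal.span G).radical) (x : M) (h : ∀ f ∈ G, ∃ t : ℕ, f ^ t • x = 0) :
    TorsE J x := by
  let I : Ideal R := LinearMap.ker (LinearMap.toSpanSingleton R M x)
  have h1 : G ⊆ I.radical := by
    intro f hf
    obtain ⟨t, ht⟩ := h f hf
    exact ⟨t, ht⟩
  have h2 : J ≤ I.radical := hG.trans (by
    rw [← Ideal.radical_idem I]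
    exact Ideal.radical_mono (Ideal.span_le.2 h1))
  obtain ⟨t, ht⟩ := Ideal.exists_pow_le_of_le_radical_of_fg h2 (IsNoetherian.noetherian J)
  exact ⟨t, fun r hr => ht hr⟩

variable (K : Type) [Field K] (n : ℕ)

lemma irrel_isMaximal : (irrel K n).IsMaximal := by
  have : irrel K n = RingHom.ker (MvPolynomial.constantCoeff : PolyS K n →+* K) := by
    ext f
    rw [irrel, ← Set.image_univ, MvPolynomial.mem_ideal_span_X_image, RingHom.mem_ker,
      MvPolynomial.constantCoeff_eq]
    constructor
    · intro h
      by_contra h'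
      obtain ⟨i, -, hi⟩ := h 0 (MvPolynomial.mem_support_iff.2 h')
      exact hi rfl
    · intro h m hm
      by_contra! h'
      have : m = 0 := by
        ext i
        exact h' i (Set.mem_univ i)
      rw [this] at hm
      exact MvPolynomial.mem_support_iff.1 hm h
  rw [this]
  exact RingHom.ker_isMaximal_of_surjective _ (fun k => ⟨MvPolynomial.C k, by simp⟩)

lemma irrel_ne_bot : irrel K n ≠ ⊥ := by
  intro h
  have := X_mem_irrel K n 0
  rw [h] at this
  exact MvPolynomial.X_ne_zero (R := K) (0 : Fin (n+1)) this

lemma torsE_of_primes {M : Type} [AddCommGroup M] [Module (PolyS K n) M] (x : M)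
    (h : ∀ p : PrimeSpectrum (PolyS K n), p.asIdeal ≠ irrel K n → ∃ u ∉ p.asIdeal, u • x = 0) :
    TorsE (irrel K n) x := by
  refine torsE_of_rad (irrel K n) {u | u • x = 0} ?_ x (fun f hf => ⟨1, by rw [pow_one]; exact hf⟩)
  rw [Ideal.radical_eq_sInf]
  refine le_sInf ?_
  rintro p ⟨hp, hp'⟩
  by_contra hlt
  obtain ⟨u, hu, hu'⟩ := h ⟨p, hp'⟩ (fun h => hlt (le_of_eq h.symm))
  exact hu (hp (Ideal.subset_span hu'))

variable {K n}
variable {E : Type} [AddCommGroup E] [Module (PolyS K n) E]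

lemma E_torsionFree (hE : IsRankTwoBundleModule K n E) (s : PolyS K n) (hs : s ≠ 0) (x : E)
    (hx : s • x = 0) : x = 0 := by
  have h0 := (lc0_zero_iff (irrel K n)).1 (lcH_subsingleton _ 0 hE.h0)
  refine h0 x (torsE_of_primes K n x fun p hp => ?_)
  have := hE.locFree p hp
  have h1 : (algebraMap (PolyS K n) (Localization.AtPrime p.asIdeal) s) •
      LocalizedModule.mkLinearMap p.asIdeal.primeCompl E x = 0 := by
    rw [algebraMap_smul, ← map_smul, hx, map_zero]
  have h2 : algebraMap (PolyS K n) (Localization.AtPrime p.asIdeal) s ≠ 0 := by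
    intro h
    exact hs (IsLocalization.injective (Localization.AtPrime p.asIdeal)
      p.asIdeal.primeCompl_le_nonZeroDivisors (h.trans (map_zero _).symm))
  have : IsDomain (Localization.AtPrime p.asIdeal) :=
    IsLocalization.isDomain_localization p.asIdeal.primeCompl_le_nonZeroDivisors
  have h3 := (smul_eq_zero.1 h1).resolve_left h2
  rw [← map_zero (LocalizedModule.mkLinearMap p.asIdeal.primeCompl E),
    IsLocalizedModule.eq_iff_exists p.asIdeal.primeCompl] at h3
  obtain ⟨c, hc⟩ := h3
  exact ⟨c, c.2, by simpa [Submonoid.smul_def] using hc⟩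

/-- local generators -/
lemma E_local_gen (hE : IsRankTwoBundleModule K n E) (p : PrimeSpectrum (PolyS K n))
    (hp : p.asIdeal ≠ irrel K n) : ∃ x y : E, ∀ z : E, ∃ s ∉ p.asIdeal, ∃ a b : PolyS K n,
      s • z = a • x + b • y := by
  have hfree := hE.locFree p hp
  have hrank := hE.rank2 p hp
  let Sp := Localization.AtPrime p.asIdeal
  let Ep := LocalizedModule p.asIdeal.primeCompl E
  have := hE.finite
  have hfin : Module.Finite Sp Ep := Module.Finite.of_isLocalizedModule p.asIdeal.primeCompl
    (LocalizedModule.mkLinearMap p.asIdeal.primeCompl E)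
  have hfr : Module.finrank Sp Ep = 2 := by
    exact Module.finrank_eq_of_rank_eq (by rw [hrank]; rfl)
  let b : Module.Basis (Fin 2) Sp Ep := (Module.finBasisOfFinrankEq Sp Ep hfr)
  obtain ⟨⟨x, s⟩, hx⟩ := IsLocalizedModule.surj p.asIdeal.primeCompl
    (LocalizedModule.mkLinearMap p.asIdeal.primeCompl E) (b 0)
  obtain ⟨⟨y, t⟩, hy⟩ := IsLocalizedModule.surj p.asIdeal.primeCompl
    (LocalizedModule.mkLinearMap p.asIdeal.primeCompl E) (b 1)
  refine ⟨x, y, fun z => ?_⟩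
  let m : E →ₗ[PolyS K n] Ep := LocalizedModule.mkLinearMap p.asIdeal.primeCompl E
  obtain ⟨⟨a, u⟩, ha⟩ := IsLocalization.surj p.asIdeal.primeCompl (b.repr (m z) 0)
  obtain ⟨⟨c, v⟩, hc⟩ := IsLocalization.surj p.asIdeal.primeCompl (b.repr (m z) 1)
  have hz : m z = b.repr (m z) 0 • b 0 + b.repr (m z) 1 • b 1 := by
    conv_lhs => rw [← b.sum_repr (m z)]
    rw [Fin.sum_univ_two]
  simp only at ha hc hx hy
  have key : m ((s * t * u * v : PolyS K n) • z) =
      m ((t * v * a : PolyS K n) • x + (s * u * c : PolyS K n) • y) := by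
    rw [map_add, map_smul, map_smul, map_smul, hz]
    have e1 : (s : PolyS K n) • b 0 = m x := hx
    have e2 : (t : PolyS K n) • b 1 = m y := hy
    rw [← e1, ← e2]
    have e3 : (u : PolyS K n) • (b.repr (m z) 0 • b 0) = a • b 0 := by
      rw [← algebraMap_smul Sp (u : PolyS K n), smul_smul, mul_comm, ha, algebraMap_smul]
    have e4 : (v : PolyS K n) • (b.repr (m z) 1 • b 1) = c • b 1 := by
      rw [← algebraMap_smul Sp (v : PolyS K n), smul_smul, mul_comm, hc, algebraMap_smul]
    have e5 : (s * t * u * v : PolyS K n) • (b.repr (m z) 0 • b 0) =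
      (s * t * v : PolyS K n) • (u : PolyS K n) • (b.repr (m z) 0 • b 0) := by
      rw [smul_smul]; congr 1; ring
    have e6 : (s * t * u * v : PolyS K n) • (b.repr (m z) 1 • b 1) =
      (s * t * u : PolyS K n) • (v : PolyS K n) • (b.repr (m z) 1 • b 1) := by
      rw [smul_smul (s * t * u : PolyS K n)]
    rw [smul_add, e5, e6, e3, e4, smul_smul, smul_smul, smul_smul, smul_smul]
    congr 2 <;> ring
  rw [IsLocalizedModule.eq_iff_exists p.asIdeal.primeCompl] at key
  obtain ⟨w, hw⟩ := key
  refine ⟨w * (s * t * u * v), ?_, w * (t * v * a), w * (s * u * c), ?_⟩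
  · exact (w * (s * t * u * v)).2
  · rw [Submonoid.smul_def, Submonoid.smul_def, smul_add, smul_smul, smul_smul, smul_smul] at hw
    exact hw

/-- embedding into a free module of rank two -/
lemma E_embed (hE : IsRankTwoBundleModule K n E) : ∃ j k : E →ₗ[PolyS K n] PolyS K n,
    (∀ x, j x = 0 → k x = 0 → x = 0) ∧ ∃ x y, j x * k y - k x * j y ≠ 0 := by
  have hp : (⊥ : Ideal (PolyS K n)).IsPrime := Ideal.isPrime_bot
  let p : PrimeSpectrum (PolyS K n) := ⟨⊥, hp⟩
  have hpne : p.asIdeal ≠ irrel K n := (irrel_ne_bot K n).symm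
  have hfree := hE.locFree p hpne
  have hrank := hE.rank2 p hpne
  let Sp := Localization.AtPrime p.asIdeal
  let Ep := LocalizedModule p.asIdeal.primeCompl E
  have := hE.finite
  have hfin : Module.Finite Sp Ep := Module.Finite.of_isLocalizedModule p.asIdeal.primeCompl
    (LocalizedModule.mkLinearMap p.asIdeal.primeCompl E)
  have hfr : Module.finrank Sp Ep = 2 := by
    exact Module.finrank_eq_of_rank_eq (by rw [hrank]; rfl)
  let b : Module.Basis (Fin 2) Sp Ep := (Module.finBasisOfFinrankEq Sp Ep hfr)
  let m : E →ₗ[PolyS K n] Ep := LocalizedModule.mkLinearMap p.asIdeal.primeCompl E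
  have hinj : Function.Injective (algebraMap (PolyS K n) Sp) :=
    IsLocalization.injective (Localization.AtPrime p.asIdeal)
      p.asIdeal.primeCompl_le_nonZeroDivisors
  have hdom : IsDomain Sp :=
    IsLocalization.isDomain_localization p.asIdeal.primeCompl_le_nonZeroDivisors
  -- clearing denominators
  have key : ∀ c : E →ₗ[PolyS K n] Sp, ∃ (d : PolyS K n) (j : E →ₗ[PolyS K n] PolyS K n), d ≠ 0 ∧
      ∀ x, algebraMap (PolyS K n) Sp (j x) = d • c x := by
    intro c
    obtain ⟨s, hs⟩ := (inferInstance : Module.Finite (PolyS K n) E)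
    obtain ⟨d, hd⟩ := IsLocalization.exist_integer_multiples p.asIdeal.primeCompl s (fun x => c x)
    have h1 : ∀ x : E, (d : PolyS K n) • c x ∈ LinearMap.range (Algebra.linearMap (PolyS K n) Sp) := by
      intro x
      have hx : x ∈ Submodule.span (PolyS K n) (s : Set E) := by rw [hs]; trivial
      induction hx using Submodule.span_induction with
      | mem x h =>
        obtain ⟨y, hy⟩ := hd x h
        exact ⟨y, hy⟩
      | zero => simp
      | add x y _ _ h h' => rw [map_add, smul_add]; exact Submodule.add_mem _ h h'
      | smul c x _ h => rw [map_smul, smul_comm]; exact Submodule.smul_mem _ _ h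
    let e := LinearEquiv.ofInjective (Algebra.linearMap (PolyS K n) Sp) hinj
    refine ⟨d, e.symm.toLinearMap ∘ₗ ((d : PolyS K n) • c).codRestrict _ h1, ?_, ?_⟩
    · exact fun h => d.2 (by rw [h]; exact Ideal.zero_mem _)
    · intro x
      have := LinearEquiv.apply_symm_apply e (((d : PolyS K n) • c).codRestrict _ h1 x)
      exact congrArg Subtype.val this
  obtain ⟨d, j, hd, hj⟩ := key ((b.coord 0).restrictScalars (PolyS K n) ∘ₗ m)
  obtain ⟨d', k, hd', hk⟩ := key ((b.coord 1).restrictScalars (PolyS K n) ∘ₗ m)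
  have hj' : ∀ x, algebraMap (PolyS K n) Sp (j x) = algebraMap (PolyS K n) Sp d * b.repr (m x) 0 := by
    intro x; rw [hj x, ← algebraMap_smul Sp d]; rfl
  have hk' : ∀ x, algebraMap (PolyS K n) Sp (k x) = algebraMap (PolyS K n) Sp d' * b.repr (m x) 1 := by
    intro x; rw [hk x, ← algebraMap_smul Sp d']; rfl
  have hd0 : algebraMap (PolyS K n) Sp d ≠ 0 := fun h => hd (hinj (h.trans (map_zero _).symm))
  have hd0' : algebraMap (PolyS K n) Sp d' ≠ 0 := fun h => hd' (hinj (h.trans (map_zero _).symm))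
  refine ⟨j, k, ?_, ?_⟩
  · intro x h1 h2
    have e1 := hj' x
    have e2 := hk' x
    rw [h1, map_zero, eq_comm, mul_eq_zero, or_iff_right hd0] at e1
    rw [h2, map_zero, eq_comm, mul_eq_zero, or_iff_right hd0'] at e2
    have h3 : m x = 0 := by
      rw [← b.sum_repr (m x), Fin.sum_univ_two, e1, e2, zero_smul, zero_smul, add_zero]
    rw [← map_zero m, IsLocalizedModule.eq_iff_exists p.asIdeal.primeCompl] at h3
    obtain ⟨c, hc⟩ := h3
    refine E_torsionFree hE c ?_ x (by simpa [Submonoid.smul_def] using hc)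
    exact fun h => c.2 (by rw [h]; exact Ideal.zero_mem _)
  · obtain ⟨⟨x, s⟩, hx⟩ := IsLocalizedModule.surj p.asIdeal.primeCompl m (b 0)
    obtain ⟨⟨y, t⟩, hy⟩ := IsLocalizedModule.surj p.asIdeal.primeCompl m (b 1)
    refine ⟨x, y, fun h => ?_⟩
    have ex : m x = algebraMap (PolyS K n) Sp s • b 0 := by
      rw [algebraMap_smul]; exact hx.symm
    have ey : m y = algebraMap (PolyS K n) Sp t • b 1 := by
      rw [algebraMap_smul]; exact hy.symm
    have h2 := congrArg (algebraMap (PolyS K n) Sp) h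
    rw [map_sub, map_mul, map_mul, hj', hj', hk', hk', ex, ey] at h2
    simp only [map_smul, Finsupp.smul_apply, b.repr_self, smul_eq_mul, map_zero] at h2
    simp only [Finsupp.single_eq_same, ne_eq, zero_ne_one, one_ne_zero, not_false_eq_true,
      Finsupp.single_eq_of_ne, mul_one, mul_zero, sub_zero, mul_eq_zero, hd0, hd0', false_or] at h2
    rcases h2 with h2 | h2
    · exact s.2 (by rw [hinj (h2.trans (map_zero _).symm)]; exact Ideal.zero_mem _)
    · exact t.2 (by rw [hinj (h2.trans (map_zero _).symm)]; exact Ideal.zero_mem _)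

/-- the properties of the form -/
structure PForm {R : Type} [CommRing R] {E : Type} [AddCommGroup E] [Module R E]
    (ω : E →ₗ[R] E →ₗ[R] R) : Prop where
  alt : ∀ x, ω x x = 0
  plu : ∀ x y z, ω x y • z + ω y z • x + ω z x • y = 0

lemma PForm.neg {R : Type} [CommRing R] {E : Type} [AddCommGroup E] [Module R E]
    {ω : E →ₗ[R] E →ₗ[R] R} (h : PForm ω) (x y : E) : ω x y = - ω y x := by
  have := h.alt (x + y)
  simp only [map_add, LinearMap.add_apply, h.alt] at this
  linear_combination this

lemma form_div {ω : E →ₗ[PolyS K n] E →ₗ[PolyS K n] PolyS K n} {q : PolyS K n} (hq : q ≠ 0)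
    (h : ∀ x y, q ∣ ω x y) : ∃ ω' : E →ₗ[PolyS K n] E →ₗ[PolyS K n] PolyS K n,
      ∀ x y, ω x y = q * ω' x y := by
  choose f hf using h
  refine ⟨LinearMap.mk₂ _ f ?_ ?_ ?_ ?_, hf⟩
  · intro x y z
    apply mul_left_cancel₀ hq
    rw [mul_add, ← hf, ← hf, ← hf, map_add, LinearMap.add_apply]
  · intro c x y
    apply mul_left_cancel₀ hq
    rw [← hf, map_smul, LinearMap.smul_apply, hf, smul_eq_mul, smul_eq_mul]; ring
  · intro x y z
    apply mul_left_cancel₀ hq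
    rw [mul_add, ← hf, ← hf, ← hf, map_add]
  · intro c x y
    apply mul_left_cancel₀ hq
    rw [← hf, map_smul, hf, smul_eq_mul, smul_eq_mul]; ring

lemma exists_form (hE : IsRankTwoBundleModule K n E) :
    ∃ ω : E →ₗ[PolyS K n] E →ₗ[PolyS K n] PolyS K n, PForm ω ∧
      ∀ p : PrimeSpectrum (PolyS K n), p.asIdeal ≠ irrel K n → ∃ x y, ω x y ∉ p.asIdeal := by
  obtain ⟨j, k, hjk, x0, y0, h0⟩ := E_embed hE
  let ω0 : E →ₗ[PolyS K n] E →ₗ[PolyS K n] PolyS K n :=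
    LinearMap.mk₂ _ (fun x y => j x * k y - k x * j y)
      (by intros; simp only [map_add]; ring) (by intros; simp only [map_smul, smul_eq_mul]; ring)
      (by intros; simp only [map_add]; ring) (by intros; simp only [map_smul, smul_eq_mul]; ring)
  have hω0 : PForm ω0 := by
    refine ⟨fun x => ?_, fun x y z => ?_⟩
    · change j x * k x - k x * j x = 0
      ring
    · apply hjk
      · simp only [map_add, map_smul, smul_eq_mul, ω0, LinearMap.mk₂_apply]; ring
      · simp only [map_add, map_smul, smul_eq_mul, ω0, LinearMap.mk₂_apply]; ring
  let T : Set (PolyS K n) := {a | a ≠ 0 ∧ ∃ ω : E →ₗ[PolyS K n] E →ₗ[PolyS K n] PolyS K n,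
    PForm ω ∧ ω x0 y0 = a}
  obtain ⟨a, ⟨ha0, ω, hω, hωa⟩, hmin⟩ := (wellFounded_dvdNotUnit
    (α := PolyS K n)).has_min T ⟨ω0 x0 y0, h0, ω0, hω0, rfl⟩
  have hq : ∀ q : PolyS K n, Prime q → ¬ ∀ x y, q ∣ ω x y := by
    intro q hq h
    obtain ⟨ω', hω'⟩ := form_div hq.ne_zero h
    refine hmin (ω' x0 y0) ⟨?_, ω', ⟨?_, ?_⟩, rfl⟩ ⟨?_, q, hq.not_unit, ?_⟩
    · intro h; apply ha0; rw [← hωa, hω', h, mul_zero]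
    · intro x
      apply mul_left_cancel₀ hq.ne_zero
      rw [← hω', hω.alt, mul_zero]
    · intro x y z
      refine E_torsionFree hE q hq.ne_zero _ ?_
      rw [smul_add, smul_add, smul_smul, smul_smul, smul_smul, ← hω', ← hω', ← hω', hω.plu]
    · intro h; apply ha0; rw [← hωa, hω', h, mul_zero]
    · rw [← hωa, hω', mul_comm]
  refine ⟨ω, hω, fun p hp => ?_⟩
  by_contra! hall
  obtain ⟨x, y, hxy⟩ := E_local_gen hE p hp
  have hval : ∀ z w, ∃ s ∉ p.asIdeal, ω x y ∣ s * ω z w := by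
    intro z w
    obtain ⟨s, hs, a, b, h1⟩ := hxy z
    obtain ⟨t, ht, c, d, h2⟩ := hxy w
    refine ⟨s * t, fun h => (p.2.mem_or_mem h).elim hs ht, a * d - b * c, ?_⟩
    have : ω (s • z) (t • w) = s * t * ω z w := by
      simp only [map_smul, LinearMap.smul_apply, smul_eq_mul]; ring
    rw [← this, h1, h2]
    simp only [map_add, map_smul, LinearMap.add_apply, LinearMap.smul_apply, smul_eq_mul, hω.alt,
      hω.neg y x]
    ring
  have hg0 : ω x y ≠ 0 := by
    intro h
    obtain ⟨s, hs, h'⟩ := hval x0 y0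
    rw [h, zero_dvd_iff, mul_eq_zero, hωa] at h'
    rcases h' with h' | h'
    · exact hs (by rw [h']; exact Ideal.zero_mem _)
    · exact ha0 h'
  obtain ⟨F, hF, u, hu⟩ := UniqueFactorizationMonoid.exists_prime_factors (ω x y) hg0
  have hmem : F.prod ∈ p.asIdeal := by
    have h1 : F.prod * u ∈ p.asIdeal := by rw [hu]; exact hall x y
    rcases p.2.mem_or_mem h1 with h | h
    · exact h
    · exact absurd (Ideal.eq_top_of_isUnit_mem _ h u.isUnit) p.2.ne_top
  obtain ⟨q, hqF, hqp⟩ := (Ideal.IsPrime.multiset_prod_mem_iff_exists_mem p.2 F).1 hmem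
  refine hq q (hF q hqF) fun z w => ?_
  obtain ⟨s, hs, h⟩ := hval z w
  have : q ∣ s * ω z w := ((Multiset.dvd_prod hqF).trans ⟨u, hu.symm⟩).trans h
  rcases (hF q hqF).dvd_or_dvd this with h | ⟨c, hc⟩
  · obtain ⟨c, rfl⟩ := h
    exact absurd (Ideal.mul_mem_right _ _ hqp) hs
  · exact ⟨c, hc⟩

end Symp

/-! ## Second exterior and symmetric powers -/
section Ext2
variable (R : Type) [CommRing R]
variable (M : Type) {N L A B : Type} [AddCommGroup M] [Module R M] [AddCommGroup N] [Module R N]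
  [AddCommGroup L] [Module R L] [AddCommGroup A] [Module R A] [AddCommGroup B] [Module R B]

/-- the diagonal relations -/
def diagSub : Submodule R (M ⊗[R] M) := Submodule.span R {z | ∃ x : M, z = x ⊗ₜ[R] x}

/-- second exterior power -/
def L2 : Type := (M ⊗[R] M) ⧸ diagSub R M

instance : AddCommGroup (L2 R M) := inferInstanceAs (AddCommGroup ((M ⊗[R] M) ⧸ diagSub R M))
instance : Module R (L2 R M) := inferInstanceAs (Module R ((M ⊗[R] M) ⧸ diagSub R M))

variable {M}

/-- projection -/
def L2.mkT : M ⊗[R] M →ₗ[R] L2 R M := (diagSub R M).mkQ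

/-- wedge -/
def wg : M →ₗ[R] M →ₗ[R] L2 R M := (TensorProduct.mk R M M).compr₂ (L2.mkT R)

variable {R}

lemma L2.mkT_tmul (x y : M) : L2.mkT R (x ⊗ₜ[R] y) = wg R x y := rfl

lemma L2.mkT_surj : Function.Surjective (L2.mkT R : M ⊗[R] M →ₗ[R] L2 R M) :=
  Submodule.mkQ_surjective _

lemma wg_self (x : M) : wg R x x = 0 := by
  refine (Submodule.Quotient.mk_eq_zero _).2 ?_
  exact Submodule.subset_span ⟨x, rfl⟩

lemma wg_swap (x y : M) : wg R x y = - wg R y x := by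
  have := wg_self (R := R) (x + y)
  simp only [map_add, LinearMap.add_apply, wg_self, zero_add, add_zero] at this
  rw [eq_neg_iff_add_eq_zero, add_comm]
  exact this

/-- universal property -/
def L2.lift (φ : M →ₗ[R] M →ₗ[R] N) (h : ∀ x, φ x x = 0) : L2 R M →ₗ[R] N :=
  (diagSub R M).liftQ (TensorProduct.lift φ) (by
    refine Submodule.span_le.2 ?_
    rintro _ ⟨x, rfl⟩
    simp [h])

@[simp] lemma L2.lift_wg (φ : M →ₗ[R] M →ₗ[R] N) (h : ∀ x, φ x x = 0) (x y : M) :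
    L2.lift φ h (wg R x y) = φ x y := by
  change TensorProduct.lift φ (x ⊗ₜ y) = _
  rw [TensorProduct.lift.tmul]

lemma L2.hom_ext {f g : L2 R M →ₗ[R] N} (h : ∀ x y, f (wg R x y) = g (wg R x y)) : f = g := by
  have : f ∘ₗ L2.mkT R = g ∘ₗ L2.mkT R := by
    apply TensorProduct.ext'
    exact h
  ext z
  obtain ⟨z, rfl⟩ := L2.mkT_surj z
  exact LinearMap.congr_fun this z

/-- functoriality -/
def L2.map (f : M →ₗ[R] N) : L2 R M →ₗ[R] L2 R N :=
  L2.lift ((wg R).compl₁₂ f f) (fun _ => wg_self _)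

@[simp] lemma L2.map_wg (f : M →ₗ[R] N) (x y : M) :
    L2.map f (wg R x y) = wg R (f x) (f y) := L2.lift_wg _ _ _ _

lemma L2.map_comp (f : M →ₗ[R] N) (g : N →ₗ[R] L) : L2.map (g ∘ₗ f) = L2.map g ∘ₗ L2.map f :=
  L2.hom_ext (by simp)

lemma L2.map_smul_id (r : R) : L2.map (r • (LinearMap.id : M →ₗ[R] M)) = (r * r) • LinearMap.id :=
  L2.hom_ext (by simp [smul_smul])

lemma L2.map_surj {f : M →ₗ[R] N} (h : Function.Surjective f) : Function.Surjective (L2.map f) := by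
  intro z
  obtain ⟨z, rfl⟩ := L2.mkT_surj z
  induction z using TensorProduct.induction_on with
  | zero => exact ⟨0, by simp⟩
  | tmul x y =>
    obtain ⟨x, rfl⟩ := h x
    obtain ⟨y, rfl⟩ := h y
    exact ⟨wg R x y, by rw [L2.map_wg, L2.mkT_tmul]⟩
  | add x y hx hy =>
    obtain ⟨x', hx⟩ := hx
    obtain ⟨y', hy⟩ := hy
    exact ⟨x' + y', by rw [map_add, map_add, hx, hy]⟩

/-- antisymmetrisation -/
def L2.anti : L2 R M →ₗ[R] M ⊗[R] M :=
  L2.lift (TensorProduct.mk R M M - (TensorProduct.mk R M M).flip) (by simp)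

@[simp] lemma L2.anti_wg (x y : M) : L2.anti (wg R x y) = x ⊗ₜ[R] y - y ⊗ₜ[R] x := by
  rw [L2.anti, L2.lift_wg]
  rfl

lemma half_map [Module.Free R B] [Module.Finite R B] (φ : B →ₗ[R] B →ₗ[R] N) (h : ∀ x, φ x x = 0) :
    ∃ ψ : B →ₗ[R] B →ₗ[R] N, ∀ u v, φ u v = ψ u v - ψ v u := by
  let b0 := Module.Free.chooseBasis R B
  let b := b0.reindex (Fintype.equivFin _)
  have hs : ∀ u v, φ u v = - φ v u := by
    intro u v
    have := h (u + v)
    simp only [map_add, LinearMap.add_apply, h, zero_add, add_zero] at this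
    rw [eq_neg_iff_add_eq_zero, add_comm]
    exact this
  let ψ : B →ₗ[R] B →ₗ[R] N := b.constr R (fun i => b.constr R
    (fun j => if i < j then φ (b i) (b j) else 0))
  have hψ : ∀ i j, ψ (b i) (b j) = if i < j then φ (b i) (b j) else 0 := by
    intro i j
    simp only [ψ, Module.Basis.constr_basis]
  refine ⟨ψ, ?_⟩
  have : φ = ψ - ψ.flip := by
    refine b.ext fun i => b.ext fun j => ?_
    simp only [LinearMap.sub_apply, LinearMap.flip_apply, hψ]
    rcases lt_trichotomy i j with hij | hij | hij
    · rw [if_pos hij, if_neg (lt_asymm hij), sub_zero]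
    · subst hij
      simp [h]
    · rw [if_neg (lt_asymm hij), if_pos hij, zero_sub]
      exact hs _ _
  intro u v
  conv_lhs => rw [this]
  rfl

lemma L2.anti_retract [Module.Free R B] [Module.Finite R B] :
    ∃ ψ : B ⊗[R] B →ₗ[R] L2 R B, ψ ∘ₗ L2.anti = LinearMap.id := by
  obtain ⟨ψ, hψ⟩ := half_map (wg R : B →ₗ[R] B →ₗ[R] L2 R B) wg_self
  refine ⟨TensorProduct.lift ψ, L2.hom_ext fun x y => ?_⟩
  rw [LinearMap.comp_apply, L2.anti_wg, map_sub, TensorProduct.lift.tmul, TensorProduct.lift.tmul,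
    LinearMap.id_apply, hψ x y]

/-- the commutator relations -/
def commSub (R M : Type) [CommRing R] [AddCommGroup M] [Module R M] :
    Submodule R (M ⊗[R] M) := Submodule.span R {z | ∃ x y : M, z = x ⊗ₜ[R] y - y ⊗ₜ[R] x}

/-- second symmetric power -/
def S2 (R M : Type) [CommRing R] [AddCommGroup M] [Module R M] : Type :=
  (M ⊗[R] M) ⧸ commSub R M

instance : AddCommGroup (S2 R M) := inferInstanceAs (AddCommGroup ((M ⊗[R] M) ⧸ commSub R M))
instance : Module R (S2 R M) := inferInstanceAs (Module R ((M ⊗[R] M) ⧸ commSub R M))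

/-- projection -/
def S2.mkT : M ⊗[R] M →ₗ[R] S2 R M := (commSub R M).mkQ

lemma S2.mkT_surj : Function.Surjective (S2.mkT : M ⊗[R] M →ₗ[R] S2 R M) :=
  Submodule.mkQ_surjective _

lemma S2.mkT_comm (x y : M) : S2.mkT (x ⊗ₜ[R] y) = S2.mkT (y ⊗ₜ[R] x) := by
  refine (Submodule.Quotient.eq _).2 ?_
  exact Submodule.subset_span ⟨x, y, rfl⟩

lemma S2.exact : Function.Exact (L2.anti : L2 R M →ₗ[R] M ⊗[R] M) S2.mkT := by
  intro z
  constructor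
  · intro h
    have h2 : z ∈ commSub R M := (Submodule.Quotient.mk_eq_zero _).1 h
    have h3 : commSub R M ≤ LinearMap.range (L2.anti : L2 R M →ₗ[R] M ⊗[R] M) := by
      refine Submodule.span_le.2 ?_
      rintro _ ⟨x, y, rfl⟩
      exact ⟨wg R x y, L2.anti_wg x y⟩
    exact h3 h2
  · rintro ⟨w, rfl⟩
    have : (S2.mkT : M ⊗[R] M →ₗ[R] S2 R M) ∘ₗ L2.anti = 0 := L2.hom_ext fun x y => by
      rw [LinearMap.comp_apply, L2.anti_wg, map_sub, S2.mkT_comm, sub_self, LinearMap.zero_apply]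
    exact LinearMap.congr_fun this w

lemma S2.ses [Module.Free R B] [Module.Finite R B] :
    SES (L2.anti : L2 R B →ₗ[R] B ⊗[R] B) S2.mkT := by
  obtain ⟨ψ, hψ⟩ := L2.anti_retract (R := R) (B := B)
  refine ⟨fun x y h => ?_, S2.exact, S2.mkT_surj⟩
  have := congrArg ψ h
  rwa [← LinearMap.comp_apply, ← LinearMap.comp_apply, hψ] at this

variable (J : Ideal R)

/-- r kills cohomology -/
def Kill (i : ℕ) (r : R) (M : Type) [AddCommGroup M] [Module R M] : Prop :=
  ∀ x : lcH J i M, r • x = 0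

lemma Kill_one {i : ℕ} : Kill J i 1 M ↔ LZ J i M := by
  simp [Kill, LZ]

lemma lcMap_sum {ι : Type} (s : Finset ι) (i : ℕ) (f : ι → M →ₗ[R] N) (x : lcH J i M) :
    lcMap J i (∑ j ∈ s, f j) x = ∑ j ∈ s, lcMap J i (f j) x := by
  classical
  induction s using Finset.induction with
  | empty => simp [lcMap_zero]
  | insert j s hj ih => rw [Finset.sum_insert hj, Finset.sum_insert hj, lcMap_add, ih]

lemma tens_id [Module.Free R B] [Module.Finite R B] :
    (LinearMap.id : M ⊗[R] B →ₗ[R] M ⊗[R] B) = ∑ j,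
      ((TensorProduct.mk R M B).flip (Module.Free.chooseBasis R B j)) ∘ₗ
      ((TensorProduct.rid R M).toLinearMap ∘ₗ
        ((Module.Free.chooseBasis R B).coord j).lTensor M) := by
  apply TensorProduct.ext'
  intro x y
  simp only [LinearMap.id_apply, LinearMap.sum_apply, LinearMap.comp_apply,
    LinearMap.lTensor_tmul, LinearMap.flip_apply, LinearEquiv.coe_coe, TensorProduct.rid_tmul,
    TensorProduct.mk_apply]
  conv_lhs => rw [← (Module.Free.chooseBasis R B).sum_repr y]
  rw [TensorProduct.tmul_sum]
  simp [TensorProduct.smul_tmul]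

lemma Kill.tens [Module.Free R B] [Module.Finite R B] {i : ℕ} {r : R} (h : Kill J i r M) :
    Kill J i r (M ⊗[R] B) := by
  intro x
  rw [← lcMap_id J i x, tens_id, lcMap_sum, Finset.smul_sum]
  refine Finset.sum_eq_zero fun j _ => ?_
  rw [lcMap_comp, ← map_smul, h, map_zero]

lemma LZ.tens [Module.Free R B] [Module.Finite R B] {i : ℕ} (h : LZ J i M) : LZ J i (M ⊗[R] B) := by
  rw [← Kill_one] at h ⊢
  exact h.tens J

lemma LZ.tens' [Module.Free R A] [Module.Finite R A] {i : ℕ} (h : LZ J i M) : LZ J i (A ⊗[R] M) :=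
  LZ.congr J (TensorProduct.comm R A M) (LZ.tens J h)

lemma LZ.L2 [Module.Free R B] [Module.Finite R B] {i : ℕ} (h : LZ J i R) : LZ J i (L2 R B) := by
  obtain ⟨ψ, hψ⟩ := L2.anti_retract (R := R) (B := B)
  exact LZ.retract J hψ (LZ.tens J (LZ.free J h))

lemma LZ.S2 [Module.Free R B] [Module.Finite R B] {i : ℕ} (h : LZ J i R) (h' : LZ J (i+1) R) :
    LZ J i (S2 R B) :=
  LZ.right J S2.ses (LZ.tens J (LZ.free J h)) (LZ.L2 J h')

lemma LZ.prod {i : ℕ} (h : LZ J i M) (h' : LZ J i N) : LZ J i (M × N) := by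
  intro x
  have : (LinearMap.id : M × N →ₗ[R] M × N) = LinearMap.inl R M N ∘ₗ LinearMap.fst R M N +
    LinearMap.inr R M N ∘ₗ LinearMap.snd R M N := by
    ext <;> simp
  rw [← lcMap_id J i x, this, lcMap_add, lcMap_comp, lcMap_comp,
    h (lcMap J i (LinearMap.fst R M N) x), h' (lcMap J i (LinearMap.snd R M N) x), map_zero,
    map_zero, add_zero]

end Ext2

/-! ## The Koszul type maps -/
section Kos
variable {R : Type} [CommRing R]
variable {A P C B E M N : Type} [AddCommGroup A] [Module R A] [AddCommGroup P] [Module R P]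
  [AddCommGroup C] [Module R C] [AddCommGroup B] [Module R B] [AddCommGroup E] [Module R E]
  [AddCommGroup M] [Module R M] [AddCommGroup N] [Module R N]

lemma TC_of_rad [IsNoetherianRing R] (J : Ideal R) (G : Set R) (hG : J ≤ (Ideal.span G).radical)
    {φ : M →ₗ[R] N} (h : ∀ y : N, ∀ f ∈ G, ∃ t : ℕ, f ^ t • y ∈ LinearMap.range φ) : TC J φ := by
  intro y
  obtain ⟨t, ht⟩ := torsE_of_rad J G hG (Submodule.Quotient.mk (p := LinearMap.range φ) y)
    (fun f hf => by
      obtain ⟨t, ht⟩ := h y f hf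
      exact ⟨t, by rwa [← Submodule.Quotient.mk_smul, Submodule.Quotient.mk_eq_zero]⟩)
  refine ⟨t, fun r hr => ?_⟩
  have := ht r hr
  rwa [← Submodule.Quotient.mk_smul, Submodule.Quotient.mk_eq_zero] at this

lemma TK_of_rad [IsNoetherianRing R] (J : Ideal R) (G : Set R) (hG : J ≤ (Ideal.span G).radical)
    {φ : M →ₗ[R] N} (h : ∀ y : M, φ y = 0 → ∀ f ∈ G, ∃ t : ℕ, f ^ t • y = 0) : TK J φ :=
  fun y hy => torsE_of_rad J G hG y (h y hy)

/-- kernel as a type -/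
def Ke (f : M →ₗ[R] N) : Type := LinearMap.ker f

instance (f : M →ₗ[R] N) : AddCommGroup (Ke f) := inferInstanceAs (AddCommGroup (LinearMap.ker f))
instance (f : M →ₗ[R] N) : Module R (Ke f) := inferInstanceAs (Module R (LinearMap.ker f))

/-- inclusion of the kernel -/
def Ke.inc (f : M →ₗ[R] N) : Ke f →ₗ[R] M := (LinearMap.ker f).subtype

lemma Ke.inj (f : M →ₗ[R] N) : Function.Injective (Ke.inc f) := Subtype.val_injective

lemma Ke.zero (f : M →ₗ[R] N) (x : Ke f) : f (Ke.inc f x) = 0 := x.2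

lemma Ke.exists (f : M →ₗ[R] N) (x : M) (h : f x = 0) : ∃ y, Ke.inc f y = x := ⟨⟨x, h⟩, rfl⟩

lemma Ke.exact (f : M →ₗ[R] N) : Function.Exact (Ke.inc f) f := fun x =>
  ⟨fun h => Ke.exists f x h, by rintro ⟨y, rfl⟩; exact Ke.zero f y⟩

/-- lifting to the kernel -/
def Ke.lift (f : M →ₗ[R] N) (g : A →ₗ[R] M) (h : ∀ x, f (g x) = 0) : A →ₗ[R] Ke f :=
  g.codRestrict (LinearMap.ker f) h

lemma Ke.inc_lift (f : M →ₗ[R] N) (g : A →ₗ[R] M) (h : ∀ x, f (g x) = 0) (x : A) :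
    Ke.inc f (Ke.lift f g h x) = g x := rfl

lemma Ke.inc_lift_comp (f : M →ₗ[R] N) (g : A →ₗ[R] M) (h : ∀ x, f (g x) = 0) :
    Ke.inc f ∘ₗ Ke.lift f g h = g := rfl

/-- image as a type -/
def Im (f : M →ₗ[R] N) : Type := LinearMap.range f

instance (f : M →ₗ[R] N) : AddCommGroup (Im f) := inferInstanceAs (AddCommGroup (LinearMap.range f))
instance (f : M →ₗ[R] N) : Module R (Im f) := inferInstanceAs (Module R (LinearMap.range f))

/-- inclusion of the image -/
def Im.inc (f : M →ₗ[R] N) : Im f →ₗ[R] N := (LinearMap.range f).subtype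

/-- projection to the image -/
def Im.res (f : M →ₗ[R] N) : M →ₗ[R] Im f := f.rangeRestrict

lemma Im.inj (f : M →ₗ[R] N) : Function.Injective (Im.inc f) := Subtype.val_injective

lemma Im.surj (f : M →ₗ[R] N) : Function.Surjective (Im.res f) := f.surjective_rangeRestrict

lemma Im.inc_res (f : M →ₗ[R] N) (x : M) : Im.inc f (Im.res f x) = f x := rfl

lemma Im.inc_res_comp (f : M →ₗ[R] N) : Im.inc f ∘ₗ Im.res f = f := rfl

lemma SES.keIm (f : M →ₗ[R] N) : SES (Ke.inc f) (Im.res f) := by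
  refine ⟨Ke.inj f, fun x => ⟨fun h => Ke.exists f x ?_, ?_⟩, Im.surj f⟩
  · rw [← Im.inc_res, h, map_zero]
  · rintro ⟨y, rfl⟩
    apply Im.inj f
    rw [Im.inc_res, Ke.zero, map_zero]

lemma SES.im (f : M →ₗ[R] N) : SES (Im.inc f) (LinearMap.range f).mkQ :=
  SES.mkQ (LinearMap.range f)

lemma SES.ke {f : M →ₗ[R] N} (h : Function.Surjective f) : SES (Ke.inc f) f :=
  ⟨Ke.inj f, Ke.exact f, h⟩

/-- the Koszul map -/
def lam (b : M →ₗ[R] B) : L2 R M →ₗ[R] M ⊗[R] B :=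
  L2.lift ((TensorProduct.mk R M B).compl₂ b - ((TensorProduct.mk R M B).compl₂ b).flip)
    (by intro x; simp)

@[simp] lemma lam_wg (b : M →ₗ[R] B) (x y : M) :
    lam b (wg R x y) = x ⊗ₜ[R] b y - y ⊗ₜ[R] b x := by
  rw [lam, L2.lift_wg]; rfl

/-- the multiplication map -/
def sig (b : M →ₗ[R] B) : M ⊗[R] B →ₗ[R] S2 R B := S2.mkT ∘ₗ b.rTensor B

@[simp] lemma sig_tmul (b : M →ₗ[R] B) (x : M) (v : B) :
    sig b (x ⊗ₜ[R] v) = S2.mkT (b x ⊗ₜ[R] v) := rfl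

lemma sig_lam (b : M →ₗ[R] B) : sig b ∘ₗ lam b = 0 := L2.hom_ext fun x y => by
  rw [LinearMap.comp_apply, lam_wg, map_sub, sig_tmul, sig_tmul, S2.mkT_comm, sub_self,
    LinearMap.zero_apply]

lemma lam_nat (b : N →ₗ[R] B) (g : M →ₗ[R] N) :
    g.rTensor B ∘ₗ lam (b ∘ₗ g) = lam b ∘ₗ L2.map g := L2.hom_ext fun x y => by
  simp

/-- multiplication by A -/
def mu (α : A →ₗ[R] P) : A ⊗[R] P →ₗ[R] L2 R P := L2.mkT R ∘ₗ α.rTensor P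

@[simp] lemma mu_tmul (α : A →ₗ[R] P) (a : A) (x : P) : mu α (a ⊗ₜ[R] x) = wg R (α a) x := rfl

lemma lam_mu (α : A →ₗ[R] P) (b : P →ₗ[R] B) (h : ∀ a, b (α a) = 0) :
    lam b ∘ₗ mu α = α.rTensor B ∘ₗ b.lTensor A := by
  apply TensorProduct.ext'
  intro a x
  simp [h]

/-- kernel of the second exterior power of a surjection -/
lemma L2.ker_map {α : A →ₗ[R] P} {p : P →ₗ[R] C} (h : SES α p) (w : L2 R P)
    (hw : L2.map p w = 0) : ∃ z, mu α z = w := by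
  obtain ⟨t, rfl⟩ := L2.mkT_surj w
  have h1 : L2.map p ∘ₗ L2.mkT R = L2.mkT R ∘ₗ TensorProduct.map p p := by
    apply TensorProduct.ext'
    intro x y
    simp [L2.mkT_tmul]
  have h2 : L2.mkT R (TensorProduct.map p p t) = 0 := by
    rw [← LinearMap.comp_apply, ← h1]; exact hw
  have h3 : TensorProduct.map p p t ∈ diagSub R C := (Submodule.Quotient.mk_eq_zero _).1 h2
  have h4 : diagSub R C ≤ (diagSub R P).map (TensorProduct.map p p) := by
    refine Submodule.span_le.2 ?_
    rintro _ ⟨c, rfl⟩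
    obtain ⟨x, rfl⟩ := h.surj c
    exact ⟨x ⊗ₜ x, Submodule.subset_span ⟨x, rfl⟩, by simp⟩
  obtain ⟨d, hd, hdt⟩ := h4 h3
  have h5 : t - d ∈ LinearMap.ker (TensorProduct.map p p) := by
    rw [LinearMap.mem_ker, map_sub, hdt, sub_self]
  rw [TensorProduct.map_ker h.exact h.surj h.exact h.surj, Submodule.mem_sup] at h5
  obtain ⟨u, ⟨u', rfl⟩, v, ⟨v', rfl⟩, huv⟩ := h5
  have hd0 : L2.mkT R d = 0 := (Submodule.Quotient.mk_eq_zero _).2 hd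
  refine ⟨v' - (TensorProduct.comm R P A) u', ?_⟩
  have h6 : mu α ∘ₗ (TensorProduct.comm R P A).toLinearMap = - L2.mkT R ∘ₗ α.lTensor P := by
    apply TensorProduct.ext'
    intro x a
    simp only [LinearMap.comp_apply, LinearEquiv.coe_coe, TensorProduct.comm_tmul, mu_tmul,
      LinearMap.neg_apply, LinearMap.lTensor_tmul, L2.mkT_tmul]
    exact wg_swap _ _
  have h7 : mu α ((TensorProduct.comm R P A) u') = - L2.mkT R (α.lTensor P u') :=
    LinearMap.congr_fun h6 u'
  rw [map_sub, h7, sub_neg_eq_add]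
  have h8 : t = d + (α.lTensor P u' + α.rTensor P v') := by rw [huv]; abel
  conv_rhs => rw [h8]
  rw [map_add, map_add, hd0, zero_add, add_comm]
  rfl

/-- the combined map -/
def Phi (α : A →ₗ[R] P) (b : P →ₗ[R] B) : L2 R P × (A ⊗[R] B) →ₗ[R] P ⊗[R] B :=
  (lam b).coprod (α.rTensor B)

lemma sig_rTensor {α : A →ₗ[R] P} {b : P →ₗ[R] B} (h : ∀ a, b (α a) = 0) :
    sig b ∘ₗ α.rTensor B = 0 := by
  apply TensorProduct.ext'
  intro a v
  simp [h]

lemma sig_Phi {α : A →ₗ[R] P} {b : P →ₗ[R] B} (h : ∀ a, b (α a) = 0)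
    (z : L2 R P × (A ⊗[R] B)) : Phi α b z ∈ LinearMap.ker (sig b) := by
  rw [LinearMap.mem_ker, Phi, LinearMap.coprod_apply, map_add]
  have h1 := LinearMap.congr_fun (sig_lam b) z.1
  have h2 := LinearMap.congr_fun (sig_rTensor h) z.2
  rw [LinearMap.comp_apply] at h1 h2
  rw [h1, h2]; simp

/-- the syzygy map -/
def mu' (α : A →ₗ[R] P) (b : P →ₗ[R] B) : A ⊗[R] P →ₗ[R] L2 R P × (A ⊗[R] B) :=
  (mu α).prod (- b.lTensor A)

lemma Phi_mu' {α : A →ₗ[R] P} {b : P →ₗ[R] B} (h : ∀ a, b (α a) = 0) (z : A ⊗[R] P) :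
    mu' α b z ∈ LinearMap.ker (Phi α b) := by
  have := LinearMap.congr_fun (lam_mu α b h) z
  rw [LinearMap.comp_apply] at this
  change lam b (mu α z) + α.rTensor B (- b.lTensor A z) = 0
  rw [this, map_neg]
  exact add_neg_cancel _

/-- f-splittings -/
def Spl (α : A →ₗ[R] P) (p : P →ₗ[R] C) (β : C →ₗ[R] B) (ι : E →ₗ[R] C) (f : R) : Prop :=
  ∃ (τ : B →ₗ[R] P) (ρE : C →ₗ[R] E) (σ : C →ₗ[R] P) (ρ : P →ₗ[R] A),
    (∀ v, β (p (τ v)) = f • v) ∧ (∀ c, ι (ρE c) + p (τ (β c)) = f • c) ∧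
    (∀ c, p (σ c) = f • c) ∧ (∀ x, α (ρ x) + σ (p x) = f • x)

/-- The standing assumptions. -/
structure MonD (J : Ideal R) (α : A →ₗ[R] P) (p : P →ₗ[R] C) (β : C →ₗ[R] B) (ι : E →ₗ[R] C)
    (ω : E →ₗ[R] E →ₗ[R] R) : Prop where
  ses : SES α p
  inj : Function.Injective ι
  exact : Function.Exact ι β
  form : PForm ω
  rad0 : J ≤ (Ideal.span {g | ∃ x y, g = ω x y}).radical
  spl : J ≤ (Ideal.span {f | Spl α p β ι f}).radical

variable {J : Ideal R} {α : A →ₗ[R] P} {p : P →ₗ[R] C} {β : C →ₗ[R] B} {ι : E →ₗ[R] C}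
    {ω : E →ₗ[R] E →ₗ[R] R}

lemma MonD.pα (M : MonD J α p β ι ω) (a : A) : p (α a) = 0 :=
  LinearMap.congr_fun M.ses.comp_zero a

lemma MonD.bα (M : MonD J α p β ι ω) (a : A) : (β ∘ₗ p) (α a) = 0 := by
  rw [LinearMap.comp_apply, M.pα, map_zero]

lemma MonD.βι (M : MonD J α p β ι ω) (e : E) : β (ι e) = 0 :=
  M.exact.apply_apply_eq_zero e

lemma MonD.TC_Phi [IsNoetherianRing R] (M : MonD J α p β ι ω) :
    TC J (Ke.lift (sig (β ∘ₗ p)) (Phi α (β ∘ₗ p)) (sig_Phi M.bα)) := by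
  refine TC_of_rad J _ M.spl ?_
  rintro ⟨y, hy⟩ f ⟨τ, ρE, σ, ρ, h1, h2, h3, h4⟩
  refine ⟨2, ?_⟩
  let Θ : P ⊗[R] B →ₗ[R] L2 R P := TensorProduct.lift ((wg R).compl₂ τ)
  have hΘ : f • LinearMap.id = lam (β ∘ₗ p) ∘ₗ Θ + τ.rTensor B ∘ₗ
      (TensorProduct.comm R B B).toLinearMap ∘ₗ (β ∘ₗ p).rTensor B := by
    apply TensorProduct.ext'
    intro x v
    simp [Θ, h1]
  obtain ⟨w, hw⟩ := (S2.exact ((β ∘ₗ p).rTensor B y)).1 hy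
  have hA : f • (τ.rTensor B ∘ₗ (TensorProduct.comm R B B).toLinearMap ∘ₗ L2.anti) =
      - (lam (β ∘ₗ p) ∘ₗ L2.map τ) := L2.hom_ext fun u v => by
    simp [h1, smul_sub]
  refine ⟨(f • Θ y - L2.map τ w, 0), Subtype.ext ?_⟩
  have e1 : f • y = lam (β ∘ₗ p) (Θ y) + τ.rTensor B
    ((TensorProduct.comm R B B) ((β ∘ₗ p).rTensor B y)) := LinearMap.congr_fun hΘ y
  have e2 : f • (τ.rTensor B ((TensorProduct.comm R B B) (L2.anti w))) =
      - lam (β ∘ₗ p) (L2.map τ w) := LinearMap.congr_fun hA w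
  change lam (β ∘ₗ p) (f • Θ y - L2.map τ w) + α.rTensor B 0 = f ^ 2 • y
  rw [pow_two, mul_smul, e1, smul_add, ← hw, e2, map_sub, map_smul, map_zero, add_zero,
    sub_eq_add_neg]

/-- The relation module of C is R modulo torsion -/
lemma MonD.LZ_L2E [IsNoetherianRing R] (M : MonD J α p β ι ω) {i : ℕ} (h : LZ J (i+2) R) :
    LZ J (i+2) (L2 R E) := by
  let Ω : L2 R E →ₗ[R] R := L2.lift ω M.form.alt
  refine LZ.of_tors_cod J (f := Ω) ?_ ?_ h
  · refine TK_of_rad J _ M.rad0 ?_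
    rintro ζ hζ _ ⟨x, y, rfl⟩
    refine ⟨2, ?_⟩
    have hs : ∀ u v, ω u v = - ω v u := fun u v => M.form.neg u v
    have key : (ω x y ^ 2) • (LinearMap.id : L2 R E →ₗ[R] L2 R E) =
        LinearMap.toSpanSingleton R _ (wg R x y) ∘ₗ (ω x y • Ω) := L2.hom_ext fun z w => by
      have hz : ∀ z, ω x y • z = ω z y • x + ω x z • y := fun z => by
        have := M.form.plu x y z
        rw [hs y z, hs z x] at this
        rw [← sub_eq_zero, ← this]
        module
      have e : (ω x y ^ 2) • wg R z w = wg R (ω x y • z) (ω x y • w) := by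
        rw [map_smul, map_smul, LinearMap.smul_apply, smul_smul, pow_two]
      have e2 : ω x y * ω z w = ω z y * ω x w + ω x z * ω y w := by
        have := congrArg (fun u => ω u w) (hz z)
        simpa using this
      rw [LinearMap.smul_apply, LinearMap.id_apply, e, hz z, hz w, LinearMap.comp_apply,
        LinearMap.smul_apply, L2.lift_wg, LinearMap.toSpanSingleton_apply, smul_eq_mul, e2]
      simp only [map_add, LinearMap.add_apply, map_smul, LinearMap.smul_apply, wg_self, smul_zero,
        zero_add, add_zero]
      rw [wg_swap y x, hs y w]
      module
    have := LinearMap.congr_fun key ζ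
    have e3 : (ω x y • Ω) ζ = 0 := by rw [LinearMap.smul_apply, hζ, smul_zero]
    rw [LinearMap.comp_apply, e3, map_zero] at this
    exact this
  · refine TC_of_rad J _ M.rad0 ?_
    rintro r _ ⟨x, y, rfl⟩
    refine ⟨1, r • wg R x y, ?_⟩
    rw [map_smul, L2.lift_wg, pow_one, smul_eq_mul, smul_eq_mul, mul_comm]

lemma MonD.LZ_R2 [IsNoetherianRing R] [Module.Free R B] [Module.Finite R B]
    (M : MonD J α p β ι ω) {i : ℕ} (h : LZ J (i+2) R) :
    LZ J (i+2) (Ke (lam β)) := by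
  have h0 : ∀ z, L2.map ι z ∈ LinearMap.ker (lam β) := fun z => by
    have : lam β ∘ₗ L2.map ι = 0 := L2.hom_ext fun x y => by
      simp [M.βι]
    exact LinearMap.congr_fun this z
  refine LZ.of_tors_dom J (f := Ke.lift (lam β) (L2.map ι) h0) (i := i+1) ?_ ?_ (M.LZ_L2E h)
  · refine TK_of_rad J _ M.spl ?_
    rintro ζ hζ f ⟨τ, ρE, σ, ρ, h1, h2, h3, h4⟩
    refine ⟨2, ?_⟩
    have h5 : ρE ∘ₗ ι = f • LinearMap.id := by
      ext x
      apply M.inj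
      have := h2 (ι x)
      rw [M.βι, map_zero, map_zero, add_zero] at this
      simpa using this
    have h6 : L2.map ι ζ = 0 := congrArg Subtype.val hζ
    have h7 := LinearMap.congr_fun (L2.map_comp ι ρE) ζ
    rw [h5, L2.map_smul_id, LinearMap.comp_apply, h6, map_zero] at h7
    rw [pow_two]
    exact h7
  · refine TC_of_rad J _ M.spl ?_
    rintro ⟨z, hz⟩ f ⟨τ, ρE, σ, ρ, h1, h2, h3, h4⟩
    refine ⟨2, L2.map ρE z, Subtype.ext ?_⟩
    change L2.map ι (L2.map ρE z) = f ^ 2 • z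
    obtain ⟨ψ, hψ⟩ := L2.anti_retract (R := R) (B := B)
    let Θ : C ⊗[R] B →ₗ[R] L2 R C := TensorProduct.lift ((wg R).compl₁₂ (ι ∘ₗ ρE) (p ∘ₗ τ))
    have key : (f ^ 2) • LinearMap.id = L2.map ι ∘ₗ L2.map ρE + Θ ∘ₗ lam β +
        L2.map (p ∘ₗ τ) ∘ₗ L2.map β := L2.hom_ext fun x y => by
      have e : (f ^ 2) • wg R x y = wg R (f • x) (f • y) := by
        rw [map_smul, map_smul, LinearMap.smul_apply, smul_smul, pow_two]
      rw [LinearMap.smul_apply, LinearMap.id_apply, e, ← h2 x, ← h2 y]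
      simp only [Θ, LinearMap.add_apply, LinearMap.comp_apply, L2.map_wg, lam_wg, map_sub,
        TensorProduct.lift.tmul, LinearMap.compl₁₂_apply, map_add]
      rw [wg_swap (ι (ρE y)) (p (τ (β x)))]
      abel
    have h8 : L2.anti ∘ₗ L2.map β = β.rTensor B ∘ₗ lam β := L2.hom_ext fun x y => by simp
    have h9 : L2.map β z = 0 := by
      have e := LinearMap.congr_fun h8 z
      rw [LinearMap.comp_apply, LinearMap.comp_apply, hz, map_zero] at e
      have e2 := LinearMap.congr_fun hψ (L2.map β z)
      rw [LinearMap.comp_apply, e, map_zero] at e2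
      exact e2.symm
    have := LinearMap.congr_fun key z
    simp only [LinearMap.add_apply, LinearMap.comp_apply] at this
    rw [h9, hz, map_zero, map_zero, add_zero, add_zero] at this
    exact this.symm

end Kos

/-! ## The syzygy module and Lemma M -/
section Syz
variable {R : Type} [CommRing R]
variable {A P C B E X W Z : Type} [AddCommGroup A] [Module R A] [AddCommGroup P] [Module R P]
  [AddCommGroup C] [Module R C] [AddCommGroup B] [Module R B] [AddCommGroup E] [Module R E]
  [AddCommGroup X] [Module R X] [AddCommGroup W] [Module R W] [AddCommGroup Z] [Module R Z]

lemma exists_factor {g : X →ₗ[R] W} (hg : Function.Surjective g) (φ : X →ₗ[R] Z)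
    (h : ∀ x, g x = 0 → φ x = 0) : ∃ χ : W →ₗ[R] Z, ∀ x, χ (g x) = φ x := by
  have h' : LinearMap.ker g ≤ LinearMap.ker φ := h
  refine ⟨(LinearMap.ker g).liftQ φ h' ∘ₗ (g.quotKerEquivOfSurjective hg).symm.toLinearMap,
    fun x => ?_⟩
  have : (g.quotKerEquivOfSurjective hg).symm (g x) = Submodule.Quotient.mk x := by
    rw [LinearEquiv.symm_apply_eq]; rfl
  rw [LinearMap.comp_apply, LinearEquiv.coe_coe, this, Submodule.liftQ_apply]

lemma SES.lT (A : Type) [AddCommGroup A] [Module R A] [Module.Free R A] {f : X →ₗ[R] W}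
    {g : W →ₗ[R] Z} (h : SES f g) : SES (f.lTensor A) (g.lTensor A) :=
  ⟨Module.Flat.lTensor_preserves_injective_linearMap f h.inj, lTensor_exact A h.exact h.surj,
    LinearMap.lTensor_surjective A h.surj⟩

lemma SES.rT (A : Type) [AddCommGroup A] [Module R A] [Module.Free R A] {f : X →ₗ[R] W}
    {g : W →ₗ[R] Z} (h : SES f g) : SES (f.rTensor A) (g.rTensor A) :=
  ⟨Module.Flat.rTensor_preserves_injective_linearMap f h.inj, rTensor_exact A h.exact h.surj,
    LinearMap.rTensor_surjective A h.surj⟩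

variable {J : Ideal R} {α : A →ₗ[R] P} {p : P →ₗ[R] C} {β : C →ₗ[R] B} {ι : E →ₗ[R] C}
    {ω : E →ₗ[R] E →ₗ[R] R}

/-- the syzygy map with restricted codomain -/
def MonD.muK (M : MonD J α p β ι ω) : A ⊗[R] P →ₗ[R] Ke (Phi α (β ∘ₗ p)) :=
  Ke.lift _ (mu' α (β ∘ₗ p)) (Phi_mu' M.bα)

lemma MonD.muK_zero [IsNoetherianRing R] [Module.Free R A] [Module.Finite R A]
    (M : MonD J α p β ι ω) (hC0 : LZ J 0 C) (z : A ⊗[R] P) (hz : mu α z = 0) :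
    p.lTensor A z = 0 := by
  have h0 : LZ J 0 (A ⊗[R] C) := LZ.tens' J hC0
  refine (LZ0_iff J).1 h0 _ (torsE_of_rad J _ M.spl _ ?_)
  rintro f ⟨τ, ρE, σ, ρ, h1, h2, h3, h4⟩
  refine ⟨1, ?_⟩
  let φ : P →ₗ[R] P →ₗ[R] A ⊗[R] C := (TensorProduct.mk R A C).compl₁₂ ρ p
  let κ : L2 R P →ₗ[R] A ⊗[R] C := L2.lift (φ - φ.flip) (by intro x; simp)
  have hρ : ∀ a, ρ (α a) = f • a := fun a => M.ses.inj (by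
    have := h4 (α a)
    rw [M.pα, map_zero, add_zero] at this
    rw [this, map_smul])
  have key : κ ∘ₗ mu α = f • p.lTensor A := by
    apply TensorProduct.ext'
    intro a x
    simp only [LinearMap.comp_apply, mu_tmul, κ, L2.lift_wg, LinearMap.sub_apply,
      LinearMap.flip_apply, φ, LinearMap.compl₁₂_apply, TensorProduct.mk_apply, hρ, M.pα,
      TensorProduct.tmul_zero, sub_zero, LinearMap.smul_apply, LinearMap.lTensor_tmul,
      TensorProduct.smul_tmul']
  have := LinearMap.congr_fun key z
  rw [LinearMap.comp_apply, hz, map_zero] at this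
  rw [pow_one]
  exact this.symm

lemma MonD.exists_chi [IsNoetherianRing R] [Module.Free R A] [Module.Finite R A]
    (M : MonD J α p β ι ω) (hC0 : LZ J 0 C) :
    ∃ χ : Im M.muK →ₗ[R] A ⊗[R] C,
      (∀ z, χ ((Im.res M.muK) z) = p.lTensor A z) ∧ Function.Surjective χ ∧
      ∀ i, LZ J (i+1) R → LZ J (i+1) (Ke χ) := by
  obtain ⟨χ, hχ⟩ := exists_factor (Im.surj M.muK) (p.lTensor A) (fun z hz => by
    refine M.muK_zero hC0 z ?_
    have h1 : M.muK z = 0 := congrArg Subtype.val hz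
    have h2 : mu' α (β ∘ₗ p) z = 0 := congrArg Subtype.val h1
    exact congrArg Prod.fst h2)
  have hS := M.ses.lT A
  refine ⟨χ, hχ, fun y => ?_, fun i hi => ?_⟩
  · obtain ⟨z, rfl⟩ := hS.surj y
    exact ⟨_, hχ z⟩
  · have hw : ∀ x : A, M.muK (α.lTensor A (x ⊗ₜ[R] x)) = 0 := by
      intro x
      refine Subtype.ext (Prod.ext ?_ ?_)
      · change wg R (α x) (α x) = 0
        exact wg_self _
      · change - (β ∘ₗ p).lTensor A (α.lTensor A (x ⊗ₜ[R] x)) = 0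
        rw [LinearMap.lTensor_tmul, LinearMap.lTensor_tmul, M.bα, TensorProduct.tmul_zero, neg_zero]
    let g0 : A ⊗[R] A →ₗ[R] Ke χ :=
      Ke.lift _ ((Im.res M.muK) ∘ₗ α.lTensor A) (fun z => by
        rw [LinearMap.comp_apply, hχ, hS.exact.apply_apply_eq_zero])
    have hg0 : ∀ z, Im.inc M.muK (Ke.inc χ (g0 z)) =
      M.muK (α.lTensor A z) := fun z => rfl
    have hal : ∀ x, (TensorProduct.curry g0) x x = 0 := fun x =>
      Subtype.ext (Subtype.ext (hw x))
    let g : L2 R A →ₗ[R] Ke χ := L2.lift (TensorProduct.curry g0) hal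
    have hg : ∀ z, g (L2.mkT R z) = g0 z := by
      have : g ∘ₗ L2.mkT R = g0 := by
        apply TensorProduct.ext'
        intro x y
        exact L2.lift_wg (TensorProduct.curry g0) hal x y
      exact LinearMap.congr_fun this
    refine LZ.of_tors_dom J (f := g) ?_ (TC.of_surj J ?_) (LZ.L2 J hi)
    · refine TK_of_rad J _ M.spl ?_
      rintro ζ hζ f ⟨τ, ρE, σ, ρ, h1, h2, h3, h4⟩
      refine ⟨2, ?_⟩
      have hρ : ρ ∘ₗ α = f • LinearMap.id := LinearMap.ext fun a => M.ses.inj (by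
        have := h4 (α a)
        rw [M.pα, map_zero, add_zero] at this
        rw [LinearMap.comp_apply, this, LinearMap.smul_apply, map_smul]; rfl)
      have h5 : L2.map α ζ = 0 := by
        obtain ⟨z, rfl⟩ := L2.mkT_surj ζ
        rw [hg] at hζ
        have e1 : M.muK (α.lTensor A z) = 0 := by
          rw [← hg0, hζ, map_zero, map_zero]
        have e2 : mu α (α.lTensor A z) = 0 := congrArg (fun w => (Subtype.val w).1) e1
        have e3 : mu α ∘ₗ α.lTensor A = L2.map α ∘ₗ L2.mkT R := by
          apply TensorProduct.ext'
          intro x y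
          simp [L2.mkT_tmul]
        rw [← LinearMap.comp_apply, ← e3]
        exact e2
      have h7 := LinearMap.congr_fun (L2.map_comp α ρ) ζ
      rw [hρ, L2.map_smul_id, LinearMap.comp_apply, h5, map_zero] at h7
      rw [pow_two]
      exact h7
    · rintro ⟨w, hw⟩
      obtain ⟨z, rfl⟩ := Im.surj M.muK w
      rw [LinearMap.mem_ker, hχ] at hw
      obtain ⟨y, rfl⟩ := (hS.exact z).1 hw
      exact ⟨L2.mkT R y, hg y⟩

lemma MonD.W_zero [IsNoetherianRing R] [Module.Free R A] [Module.Finite R A]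
    (M : MonD J α p β ι ω) (hC0 : LZ J 0 C) {i : ℕ} (hR : LZ J (i+1) R) (hC : LZ J (i+1) C) :
    LZ J (i+1) (Im M.muK) := by
  obtain ⟨χ, h1, h2, h3⟩ := M.exists_chi hC0
  exact LZ.mid J (SES.ke h2) (h3 i hR) (LZ.tens' J hC)

lemma MonD.W_surj [IsNoetherianRing R] [Module.Free R A] [Module.Finite R A]
    (M : MonD J α p β ι ω) (hC0 : LZ J 0 C) {i : ℕ} (hR : LZ J (i+1) R) (hR' : LZ J (i+2) R) :
    Function.Surjective (lcMap J (i+1) (Im.res M.muK)) := by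
  obtain ⟨χ, h1, h2, h3⟩ := M.exists_chi hC0
  intro w
  obtain ⟨z, hz⟩ := lc_surj_of' J (M.ses.lT A) (i := i+1) (LZ.tens' J (LZ.free J hR'))
    (lcMap J (i+1) χ w)
  refine ⟨z, lc_inj_of' J (SES.ke h2) (h3 i hR) ?_⟩
  rw [← hz, ← lcMap_comp]
  congr 2
  exact LinearMap.ext h1

lemma MonD.W_ses [Module.Free R B] (M : MonD J α p β ι ω) :
    ∃ g : Ke (Phi α (β ∘ₗ p)) →ₗ[R] Ke (lam β),
      SES (Im.inc M.muK) g := by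
  have hn := lam_nat β p
  have hS := M.ses.rT B
  let g : Ke (Phi α (β ∘ₗ p)) →ₗ[R] Ke (lam β) :=
    Ke.lift (lam β) (L2.map p ∘ₗ LinearMap.fst R _ _ ∘ₗ Ke.inc (Phi α (β ∘ₗ p))) (by
      rintro ⟨⟨w, a⟩, hz⟩
      have e1 := LinearMap.congr_fun hn w
      have e2 : lam (β ∘ₗ p) w + α.rTensor B a = 0 := hz
      have e3 : lam (β ∘ₗ p) w = - α.rTensor B a := eq_neg_of_add_eq_zero_left e2
      rw [LinearMap.comp_apply, e3, map_neg, hS.exact.apply_apply_eq_zero, neg_zero] at e1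
      exact e1.symm)
  refine ⟨g, Subtype.val_injective, ?_, ?_⟩
  · rintro ⟨⟨w, a⟩, hz⟩
    constructor
    · intro h
      have h1 : L2.map p w = 0 := congrArg Subtype.val h
      obtain ⟨z, rfl⟩ := L2.ker_map M.ses w h1
      refine ⟨⟨M.muK z, z, rfl⟩, Subtype.ext (Prod.ext rfl ?_)⟩
      change - (β ∘ₗ p).lTensor A z = a
      have e2 : lam (β ∘ₗ p) (mu α z) + α.rTensor B a = 0 := hz
      have e1 := LinearMap.congr_fun (lam_mu α (β ∘ₗ p) M.bα) z
      rw [LinearMap.comp_apply] at e1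
      rw [e1, LinearMap.comp_apply, ← map_add] at e2
      have e3 := hS.inj (e2.trans (map_zero _).symm)
      exact (eq_neg_of_add_eq_zero_right e3).symm
    · rintro ⟨⟨_, z, rfl⟩, h⟩
      rw [← h]
      refine Subtype.ext ?_
      change L2.map p (mu α z) = 0
      have : L2.map p ∘ₗ mu α = 0 := by
        apply TensorProduct.ext'
        intro a x
        simp [M.pα]
      exact LinearMap.congr_fun this z
  · rintro ⟨ζ, hζ⟩
    obtain ⟨w, rfl⟩ := L2.map_surj M.ses.surj ζ
    have e1 := LinearMap.congr_fun hn w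
    rw [LinearMap.comp_apply, LinearMap.comp_apply, hζ] at e1
    obtain ⟨a, ha⟩ := (hS.exact _).1 e1
    refine ⟨⟨(w, -a), ?_⟩, rfl⟩
    change lam (β ∘ₗ p) w + α.rTensor B (-a) = 0
    rw [map_neg, ha, add_neg_cancel]

section
variable [IsNoetherianRing R] [Module.Free R A] [Module.Finite R A] [Module.Free R B]
  [Module.Finite R B]

lemma MonD.R3_zero (M : MonD J α p β ι ω) (hC0 : LZ J 0 C) {i : ℕ} (hR : LZ J (i+2) R)
    (hC : LZ J (i+2) C) : LZ J (i+2) (Ke (Phi α (β ∘ₗ p))) := by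
  obtain ⟨g, hg⟩ := M.W_ses
  exact LZ.mid J hg (M.W_zero hC0 (i := i+1) hR hC) (M.LZ_R2 hR)

lemma MonD.R3_surj (M : MonD J α p β ι ω) (hC0 : LZ J 0 C) {i : ℕ} (hR : LZ J (i+2) R)
    (hR' : LZ J (i+3) R) : Function.Surjective (lcMap J (i+2) M.muK) := by
  obtain ⟨g, hg⟩ := M.W_ses
  intro x
  obtain ⟨y, rfl⟩ := lc_surj_of J hg (M.LZ_R2 hR) x
  obtain ⟨z, rfl⟩ := M.W_surj hC0 (i := i+1) hR hR' y
  refine ⟨z, ?_⟩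
  rw [← lcMap_comp]
  rfl

end

/-- lam into Y -/
def lamY (b : X →ₗ[R] B) : L2 R X →ₗ[R] Ke (sig b) :=
  Ke.lift _ (lam b) (fun z => LinearMap.congr_fun (sig_lam b) z)

/-- Phi into Y -/
def MonD.PhiY (M : MonD J α p β ι ω) :
    L2 R P × (A ⊗[R] B) →ₗ[R] Ke (sig (β ∘ₗ p)) :=
  Ke.lift _ (Phi α (β ∘ₗ p)) (sig_Phi M.bα)

lemma MonD.PhiY_ses (M : MonD J α p β ι ω) :
    SES (Ke.inc (Phi α (β ∘ₗ p))) (Im.res M.PhiY) := by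
  refine ⟨Subtype.val_injective, ?_, Im.surj _⟩
  intro z
  constructor
  · intro h
    have h1 : M.PhiY z = 0 := congrArg Subtype.val h
    have h2 : Phi α (β ∘ₗ p) z = 0 := congrArg Subtype.val h1
    exact ⟨⟨z, h2⟩, rfl⟩
  · rintro ⟨⟨z, hz⟩, rfl⟩
    exact Subtype.ext (Subtype.ext hz)

variable [IsNoetherianRing R] [Module.Free R A] [Module.Finite R A] [Module.Free R B]
  [Module.Finite R B]

lemma MonD.M_surj (M : MonD J α p β ι ω) (hC0 : LZ J 0 C) {i : ℕ} (hR : LZ J (i+1) R)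
    (hR' : LZ J (i+2) R) (hC : LZ J (i+2) C) :
    Function.Surjective (lcMap J (i+1) (lamY (β ∘ₗ p))) := by
  intro y
  obtain ⟨y, rfl⟩ := lc_surj_of J (SES.im M.PhiY)
    (LZ.tors J (M.TC_Phi.tors J) i) y
  obtain ⟨z, rfl⟩ := lc_surj_of' J M.PhiY_ses (i := i+1) (M.R3_zero hC0 hR' hC) y
  refine ⟨lcMap J (i+1) (LinearMap.fst R _ _) z, ?_⟩
  have h1 : Im.inc M.PhiY ∘ₗ (Im.res M.PhiY) =
      lamY (β ∘ₗ p) ∘ₗ LinearMap.fst R _ _ +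
      (M.PhiY ∘ₗ LinearMap.inr R _ _) ∘ₗ LinearMap.snd R _ _ := by
    refine LinearMap.ext fun z => Subtype.ext ?_
    change lam (β ∘ₗ p) z.1 + α.rTensor B z.2 =
      lam (β ∘ₗ p) z.1 + (lam (β ∘ₗ p) 0 + α.rTensor B z.2)
    rw [map_zero, zero_add]
  rw [← lcMap_comp, ← lcMap_comp, h1, lcMap_add]
  refine (add_eq_left.2 ?_).symm
  refine (lcMap_comp J (i+1) (LinearMap.snd R (L2 R P) (A ⊗[R] B))
    (M.PhiY ∘ₗ LinearMap.inr R (L2 R P) (A ⊗[R] B)) z).trans ?_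
  have h2 : LZ J (i+1) (A ⊗[R] B) := LZ.tens J (LZ.free J hR)
  rw [h2 (lcMap J (i+1) (LinearMap.snd R (L2 R P) (A ⊗[R] B)) z), map_zero]

lemma MonD.M_ker (M : MonD J α p β ι ω) (hC0 : LZ J 0 C) {i : ℕ} (hR : LZ J (i+2) R)
    (hR' : LZ J (i+3) R) (ξ : lcH J (i+2) (L2 R P))
    (h : lcMap J (i+2) (lamY (β ∘ₗ p)) ξ = 0) : ∃ η, lcMap J (i+2) (mu α) η = ξ := by
  have h1 : Im.inc M.PhiY ∘ₗ (Im.res M.PhiY) ∘ₗ LinearMap.inl R _ _ =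
      lamY (β ∘ₗ p) := by
    refine LinearMap.ext fun z => Subtype.ext ?_
    change lam (β ∘ₗ p) z + α.rTensor B 0 = lam (β ∘ₗ p) z
    rw [map_zero, add_zero]
  rw [← h1, lcMap_comp] at h
  have h2 := lc_inj_of J (SES.im M.PhiY) (LZ.tors J (M.TC_Phi.tors J) i)
    (h.trans (map_zero _).symm)
  rw [lcMap_comp] at h2
  obtain ⟨y, hy⟩ := lc_exact2 J M.PhiY_ses (i+2) _ h2
  obtain ⟨η, rfl⟩ := M.R3_surj hC0 hR hR' y
  refine ⟨η, ?_⟩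
  have h3 : LinearMap.fst R _ _ ∘ₗ LinearMap.inl R (L2 R P) (A ⊗[R] B) = LinearMap.id := by
    ext; rfl
  rw [← lcMap_id J _ ξ, ← h3, lcMap_comp J _ (LinearMap.inl R (L2 R P) (A ⊗[R] B)), ← hy,
    ← lcMap_comp, ← lcMap_comp]
  rfl

end Syz

/-! ## Nilpotency, and step A -/
section StepA
variable {R : Type} [CommRing R]
variable {A P C B E X W Z : Type} [AddCommGroup A] [Module R A] [AddCommGroup P] [Module R P]
  [AddCommGroup C] [Module R C] [AddCommGroup B] [Module R B] [AddCommGroup E] [Module R E]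
  [AddCommGroup X] [Module R X] [AddCommGroup W] [Module R W] [AddCommGroup Z] [Module R Z]

variable {J : Ideal R} {α : A →ₗ[R] P} {p : P →ₗ[R] C} {β : C →ₗ[R] B} {ι : E →ₗ[R] C}
    {ω : E →ₗ[R] E →ₗ[R] R}

lemma nak (T : Submodule R X) (t : ℕ) (h : ∀ r ∈ J ^ t, ∀ x : X, r • x = 0)
    (hT : ⊤ ≤ T ⊔ J • (⊤ : Submodule R X)) : T = ⊤ := by
  have h1 : ∀ k, ⊤ ≤ T ⊔ J ^ k • (⊤ : Submodule R X) := by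
    intro k
    induction k with
    | zero => simp
    | succ k ih =>
      refine ih.trans (sup_le le_sup_left ?_)
      calc J ^ k • (⊤ : Submodule R X) ≤ J ^ k • (T ⊔ J • (⊤ : Submodule R X)) :=
            Submodule.smul_mono le_rfl hT
        _ = J ^ k • T ⊔ (J ^ k * J) • (⊤ : Submodule R X) := by
            rw [Submodule.smul_sup, ← Submodule.mul_smul]
        _ ≤ _ := by
            rw [← pow_succ]
            exact sup_le_sup_right Submodule.smul_le_right _
  have h2 : J ^ t • (⊤ : Submodule R X) = ⊥ := by
    rw [eq_bot_iff, Submodule.smul_le]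
    intro r hr x _
    exact h r hr x
  have := h1 t
  rw [h2, sup_bot_eq] at this
  exact top_le_iff.1 this

lemma MonD.TC_β [IsNoetherianRing R] (M : MonD J α p β ι ω) : TC J β := by
  refine TC_of_rad J _ M.spl ?_
  rintro v f ⟨τ, ρE, σ, ρ, h1, h2, h3, h4⟩
  exact ⟨1, p (τ v), by rw [h1, pow_one]⟩

lemma Im.LZ [IsNoetherianRing R] {f : X →ₗ[R] W} (h : TC J f) {i : ℕ} (hW : LZ J (i+2) W) :
    LZ J (i+2) (Im f) :=
  LZ.left J (SES.im f) hW (LZ.tors J (h.tors J) i)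

lemma MonD.sesE (M : MonD J α p β ι ω) : SES ι (Im.res β) := by
  refine ⟨M.inj, fun x => ⟨fun h => (M.exact x).1 ?_, ?_⟩, Im.surj β⟩
  · rw [← Im.inc_res, h, map_zero]
  · rintro ⟨y, rfl⟩
    apply Im.inj β
    rw [Im.inc_res, M.βι, map_zero]

lemma MonD.killE (M : MonD J α p β ι ω) {i : ℕ} (h : LZ J i R) (x y : E) :
    Kill J i (ω x y) E := by
  intro z
  have key : ω x y • (LinearMap.id : E →ₗ[R] E) =
      LinearMap.toSpanSingleton R E x ∘ₗ ω.flip y + LinearMap.toSpanSingleton R E y ∘ₗ ω x := by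
    refine LinearMap.ext fun z => ?_
    have := M.form.plu x y z
    rw [M.form.neg y z, M.form.neg z x] at this
    change ω x y • z = ω z y • x + ω x z • y
    rw [← sub_eq_zero, ← this]
    module
  conv_lhs => rw [← lcMap_id J i z]
  rw [← lcMap_smul, key, lcMap_add, lcMap_comp, lcMap_comp, h (lcMap J i (ω.flip y) z),
    h (lcMap J i (ω x) z), map_zero, map_zero, add_zero]

lemma MonD.killP [IsNoetherianRing R] [Module.Free R A] [Module.Finite R A] [Module.Free R B]
    [Module.Finite R B] (M : MonD J α p β ι ω) {i : ℕ} (h : LZ J (i+2) R) (x y : E) :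
    Kill J (i+2) (ω x y) P := by
  intro z
  apply lc_inj_of' J M.ses (LZ.free J h)
  rw [map_smul, map_zero]
  obtain ⟨u, hu⟩ := lc_exact2 J M.sesE (i+2) (lcMap J (i+2) p z)
    (Im.LZ (M.TC_β) (LZ.free J h) _)
  rw [← hu, ← map_smul, M.killE h, map_zero]

lemma MonD.exists_pow [IsNoetherianRing R] (M : MonD J α p β ι ω) :
    ∃ t : ℕ, J ^ t ≤ Ideal.span {g | ∃ x y, g = ω x y} :=
  Ideal.exists_pow_le_of_le_radical_of_fg M.rad0 (IsNoetherian.noetherian J)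

lemma MonD.nil [IsNoetherianRing R] (M : MonD J α p β ι ω) :
    ∃ t : ℕ, ∀ (i : ℕ) (X : Type) [AddCommGroup X] [Module R X],
      (∀ x y, Kill J i (ω x y) X) → ∀ r ∈ J ^ t, ∀ x : lcH J i X, r • x = 0 := by
  obtain ⟨t, ht⟩ := M.exists_pow
  refine ⟨t, fun i X _ _ h r hr x => ?_⟩
  have h1 : Ideal.span {g | ∃ x y, g = ω x y} ≤
      LinearMap.ker (LinearMap.toSpanSingleton R (lcH J i X) x) := by
    refine Ideal.span_le.2 ?_
    rintro _ ⟨u, v, rfl⟩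
    exact h u v x
  exact h1 (ht hr)

/-- tensoring with a vector -/
def tv (P : Type) [AddCommGroup P] [Module R P] (b : B) : P →ₗ[R] P ⊗[R] B :=
  (TensorProduct.mk R P B).flip b

lemma tv_apply (b : B) (x : P) : tv (R := R) P b x = x ⊗ₜ[R] b := rfl

lemma tv_mem {b : B} (hb : b ∈ J • (⊤ : Submodule R B)) (i : ℕ) (h : lcH J i P) :
    lcMap J i (tv (R := R) P b) h ∈ J • (⊤ : Submodule R (lcH J i (P ⊗[R] B))) := by
  induction hb using Submodule.smul_induction_on' with
  | smul r hr v _ =>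
    have : tv (R := R) P (r • v) = r • (tv P v) := LinearMap.map_smul _ _ _
    rw [this, lcMap_smul]
    exact Submodule.smul_mem_smul hr trivial
  | add v _ w _ hv hw =>
    have : tv (R := R) P (v + w) = tv P v + tv P w := LinearMap.map_add _ _ _
    rw [this, lcMap_add]
    exact Submodule.add_mem _ hv hw

/-- contraction by a functional -/
def ct (P : Type) [AddCommGroup P] [Module R P] (c : A →ₗ[R] R) : A ⊗[R] P →ₗ[R] P :=
  (TensorProduct.lid R P).toLinearMap ∘ₗ c.rTensor P

lemma ct_tmul (c : A →ₗ[R] R) (a : A) (x : P) : ct P c (a ⊗ₜ[R] x) = c a • x := by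
  simp [ct]

lemma ct_mem [Module.Free R A] [Module.Finite R A] {c : A →ₗ[R] R} (hc : ∀ a, c a ∈ J) (i : ℕ)
    (h : lcH J i (A ⊗[R] P)) : lcMap J i (ct P c) h ∈ J • (⊤ : Submodule R (lcH J i P)) := by
  have key : ct P c = ∑ j, c (Module.Free.chooseBasis R A j) •
      ct P ((Module.Free.chooseBasis R A).coord j) := by
    apply TensorProduct.ext'
    intro a x
    rw [LinearMap.sum_apply, ct_tmul]
    conv_lhs => rw [← (Module.Free.chooseBasis R A).sum_repr a]
    rw [map_sum, Finset.sum_smul]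
    refine Finset.sum_congr rfl fun j _ => ?_
    rw [LinearMap.smul_apply, ct_tmul, map_smul, smul_eq_mul, smul_smul, mul_comm]
    rfl
  rw [key, lcMap_sum]
  refine Submodule.sum_mem _ fun j _ => ?_
  rw [lcMap_smul]
  exact Submodule.smul_mem_smul (hc _) trivial

/-- wedge contraction -/
def kap (π : P →ₗ[R] R) : L2 R P →ₗ[R] P :=
  L2.lift ((LinearMap.lsmul R P) ∘ₗ π - ((LinearMap.lsmul R P) ∘ₗ π).flip) (by intro x; simp)

@[simp] lemma kap_wg (π : P →ₗ[R] R) (x y : P) : kap π (wg R x y) = π x • y - π y • x := by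
  rw [kap, L2.lift_wg]; rfl

/-- projection off e -/
def pQ (π : P →ₗ[R] R) (e : P) : P →ₗ[R] P := LinearMap.id - LinearMap.toSpanSingleton R P e ∘ₗ π

lemma pQ_apply (π : P →ₗ[R] R) (e x : P) : pQ π e x = x - π x • e := rfl

lemma π_pQ {π : P →ₗ[R] R} {e : P} (he : π e = 1) (x : P) : π (pQ π e x) = 0 := by
  rw [pQ_apply, map_sub, map_smul, he, smul_eq_mul, mul_one, sub_self]

lemma L2_split {π : P →ₗ[R] R} {e : P} :
    (LinearMap.id : L2 R P →ₗ[R] L2 R P) = L2.map (pQ π e) + wg R e ∘ₗ kap π :=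
  L2.hom_ext fun x y => by
    simp only [LinearMap.id_apply, LinearMap.add_apply, L2.map_wg, pQ_apply, LinearMap.comp_apply,
      kap_wg, map_sub, map_smul, LinearMap.sub_apply, LinearMap.smul_apply, wg_self, smul_zero,
      sub_zero]
    rw [wg_swap x e, smul_neg]
    abel

lemma kap_pQ {π : P →ₗ[R] R} {e : P} (he : π e = 1) : kap π ∘ₗ L2.map (pQ π e) = 0 :=
  L2.hom_ext fun x y => by
    simp [π_pQ he]

lemma kap_e {π : P →ₗ[R] R} {e : P} (he : π e = 1) :
    kap π ∘ₗ wg R e = LinearMap.id - LinearMap.toSpanSingleton R P e ∘ₗ π := by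
  ext x
  simp [he]

lemma kap_mu {π : P →ₗ[R] R} : kap π ∘ₗ mu α = ct P (π ∘ₗ α) - α ∘ₗ
    ((TensorProduct.rid R A).toLinearMap ∘ₗ π.lTensor A) := by
  apply TensorProduct.ext'
  intro a x
  simp [ct_tmul]

lemma lam_e (b : P →ₗ[R] B) (e : P) :
    lam b ∘ₗ wg R e = TensorProduct.mk R P B e ∘ₗ b - tv P (b e) := by
  ext x
  simp [tv_apply]

/-- decomposition of lam -/
lemma lam_split (b : P →ₗ[R] B) (π : P →ₗ[R] R) (e : P) :
    lam b = lam b ∘ₗ L2.map (pQ π e) + TensorProduct.mk R P B e ∘ₗ (b ∘ₗ kap π)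
      - tv P (b e) ∘ₗ kap π := by
  have : lam b = lam b ∘ₗ (L2.map (pQ π e) + wg R e ∘ₗ kap π) := by
    rw [← L2_split, LinearMap.comp_id]
  conv_lhs => rw [this]
  rw [LinearMap.comp_add, ← LinearMap.comp_assoc, lam_e, LinearMap.sub_comp, add_sub_assoc]
  rfl

lemma MonD.TC_sig [IsNoetherianRing R] (M : MonD J α p β ι ω) : TC J (sig (β ∘ₗ p)) := by
  refine TC_of_rad J _ M.spl ?_
  rintro y f ⟨τ, ρE, σ, ρ, h1, h2, h3, h4⟩
  obtain ⟨z, rfl⟩ := S2.mkT_surj y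
  refine ⟨1, τ.rTensor B z, ?_⟩
  have : sig (β ∘ₗ p) ∘ₗ τ.rTensor B = f • S2.mkT := by
    apply TensorProduct.ext'
    intro u v
    rw [LinearMap.comp_apply, LinearMap.rTensor_tmul, sig_tmul, LinearMap.comp_apply, h1,
      ← TensorProduct.smul_tmul', map_smul]
    rfl
  rw [← LinearMap.comp_apply, this, pow_one]
  rfl


lemma stepA_top [Module.Free R B] [Module.Finite R B] (b : P →ₗ[R] B) (π : P →ₗ[R] R) (e : P)
    (hb : b e ∈ J • (⊤ : Submodule R B)) (q t : ℕ) (hB : LZ J q B)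
    (hN : ∀ r ∈ J ^ t, ∀ x : lcH J q (P ⊗[R] B), r • x = 0)
    (hs : ∀ y : lcH J q (P ⊗[R] B), ∃ w, lcMap J q (lam b) w = y) :
    LinearMap.range (lcMap J q (lam b ∘ₗ L2.map (pQ π e))) = ⊤ := by
  refine nak (J := J) _ t hN ?_
  intro y _
  obtain ⟨w, rfl⟩ := hs y
  have h1 : lcMap J q (lam b) w = lcMap J q (lam b ∘ₗ L2.map (pQ π e)) w
      - lcMap J q (tv P (b e)) (lcMap J q (kap π) w) := by
    conv_lhs => rw [lam_split b π e]
    rw [lcMap_sub, lcMap_add, lcMap_comp J q (b ∘ₗ kap π),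
      hB (lcMap J q (b ∘ₗ kap π) w), map_zero, add_zero, lcMap_comp J q (kap π) (tv P (b e))]
  rw [h1]
  exact Submodule.sub_mem _ (Submodule.mem_sup_left (LinearMap.mem_range_self _ w))
    (Submodule.mem_sup_right (tv_mem hb q (lcMap J q (kap π) w)))

lemma stepA_zero [Module.Free R A] [Module.Finite R A] (b : P →ₗ[R] B) {π : P →ₗ[R] R} {e : P}
    (he : π e = 1) (hc : ∀ a, π (α a) ∈ J) (q t : ℕ) (hB : LZ J q B) (hA : LZ J q A)
    (hR : LZ J q R)
    (hN : ∀ r ∈ J ^ t, ∀ x : lcH J q P, r • x = 0)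
    (hT : LinearMap.range (lcMap J q (lam b ∘ₗ L2.map (pQ π e))) = ⊤)
    (hk : ∀ ξ, lcMap J q (lam b) ξ = 0 → ∃ η, lcMap J q (mu α) η = ξ) : LZ J q P := by
  have := nak (J := J) (⊥ : Submodule R (lcH J q P)) t hN (by
      intro h _
      refine Submodule.mem_sup_right ?_
      obtain ⟨w, hw⟩ : lcMap J q (tv P (b e)) h ∈
        LinearMap.range (lcMap J q (lam b ∘ₗ L2.map (pQ π e))) := hT ▸ trivial
      obtain ⟨η, hη⟩ := hk
        (lcMap J q (wg R e) h + lcMap J q (L2.map (pQ π e)) w) (by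
          rw [map_add, ← lcMap_comp, ← lcMap_comp, hw, lam_e, lcMap_sub,
            lcMap_comp J q b, hB (lcMap J q b h), map_zero, zero_sub, neg_add_cancel])
      have h1 := congrArg (lcMap J q (kap π)) hη
      rw [map_add, ← lcMap_comp, ← lcMap_comp, ← lcMap_comp, kap_pQ he, kap_e he, kap_mu,
        lcMap_zero, lcMap_sub, lcMap_sub, lcMap_id, lcMap_comp J q π, hR (lcMap J q π h),
        lcMap_comp J q ((TensorProduct.rid R A).toLinearMap ∘ₗ π.lTensor A) α,
        hA (lcMap J q ((TensorProduct.rid R A).toLinearMap ∘ₗ π.lTensor A) η), map_zero, map_zero,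
        sub_zero, sub_zero, add_zero] at h1
      rw [← h1]
      exact ct_mem (by exact hc) _ _)
  intro x
  have hx : x ∈ (⊥ : Submodule R (lcH J q P)) := this ▸ trivial
  exact hx

variable [IsNoetherianRing R] [Module.Free R A] [Module.Finite R A] [Module.Free R B]
  [Module.Finite R B]

/-- Step A -/
lemma MonD.stepA (M : MonD J α p β ι ω) (hC0 : LZ J 0 C) {π : P →ₗ[R] R} {e : P} (he : π e = 1)
    (hb : β (p e) ∈ J • (⊤ : Submodule R B)) (hc : ∀ a, π (α a) ∈ J) {i : ℕ}
    (hR2 : LZ J (i+2) R) (hR3 : LZ J (i+3) R) (hR4 : LZ J (i+4) R) (hC : LZ J (i+4) C) :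
    LZ J (i+3) C := by
  have hI2 : LZ J (i+2) (Im (sig (β ∘ₗ p))) := Im.LZ M.TC_sig (LZ.S2 J hR2 hR3)
  have hI3 : LZ J (i+3) (Im (sig (β ∘ₗ p))) := Im.LZ (i := i+1) M.TC_sig (LZ.S2 J hR3 hR4)
  have hinj := lc_inj_of J (SES.keIm (sig (β ∘ₗ p))) (i := i+2) hI2
  have hsurj := lc_surj_of J (SES.keIm (sig (β ∘ₗ p))) (i := i+3) hI3
  have hlam : ∀ w, lcMap J (i+3) (lam (β ∘ₗ p)) w = lcMap J (i+3) (Ke.inc (sig (β ∘ₗ p)))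
      (lcMap J (i+3) (lamY (β ∘ₗ p)) w) := fun w => by
    rw [← lcMap_comp]; rfl
  obtain ⟨t, ht⟩ := M.nil
  have hT := stepA_top (J := J) (β ∘ₗ p) π e hb (i+3) t (LZ.free J hR3)
    (ht (i+3) (P ⊗[R] B) (fun x y => Kill.tens J (M.killP (i := i+1) hR3 x y))) (by
      intro y
      obtain ⟨y, rfl⟩ := hsurj y
      obtain ⟨w, rfl⟩ := M.M_surj hC0 (i := i+2) hR3 hR4 hC y
      exact ⟨w, hlam w⟩)
  have hP : LZ J (i+3) P := stepA_zero (α := α) (β ∘ₗ p) he hc (i+3) t (LZ.free J hR3)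
    (LZ.free J hR3) hR3 (ht (i+3) P (fun x y => M.killP (i := i+1) hR3 x y)) hT (by
      intro ξ h
      refine M.M_ker hC0 (i := i+1) hR3 hR4 ξ (hinj ?_)
      rw [← hlam, h, map_zero])
  exact LZ.right J M.ses hP (LZ.free J hR4)

end StepA

/-! ## Steps B and C -/
section StepB
variable {R : Type} [CommRing R]
variable {A P C B E X W Z : Type} [AddCommGroup A] [Module R A] [AddCommGroup P] [Module R P]
  [AddCommGroup C] [Module R C] [AddCommGroup B] [Module R B] [AddCommGroup E] [Module R E]
  [AddCommGroup X] [Module R X] [AddCommGroup W] [Module R W] [AddCommGroup Z] [Module R Z]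

variable {J : Ideal R} {α : A →ₗ[R] P} {p : P →ₗ[R] C} {β : C →ₗ[R] B} {ι : E →ₗ[R] C}
    {ω : E →ₗ[R] E →ₗ[R] R}

/-- double connecting map -/
def dd (J : Ideal R) (s : X →ₗ[R] W) : lcH J 0 (W ⧸ LinearMap.range s) →ₗ[R] lcH J 2 (Ke s) :=
  lcδ J (SES.keIm s) 1 ∘ₗ lcδ J (SES.im s) 0

lemma dd_inj {s : X →ₗ[R] W} (hW : LZ J 0 W) (hX : LZ J 1 X) : Function.Injective (dd J s) :=
  (lc_δ_inj J (SES.keIm s) hX).comp (lc_δ_inj J (SES.im s) hW)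

lemma dd_surj {s : X →ₗ[R] W} (hW : LZ J 1 W) (hX : LZ J 2 X) : Function.Surjective (dd J s) :=
  (lc_δ_surj J (SES.keIm s) hX).comp (lc_δ_surj J (SES.im s) hW)

/-- induced map on kernels -/
def keMap (s s' : X →ₗ[R] W) (g : X →ₗ[R] X) (h : ∀ x, s (g x) = s' x) : Ke s' →ₗ[R] Ke s :=
  Ke.lift s (g ∘ₗ Ke.inc s') (fun x => by rw [LinearMap.comp_apply, h, Ke.zero])

/-- induced map on cokernels -/
def coMap (s s' : X →ₗ[R] W) (g : X →ₗ[R] X) (h : ∀ x, s (g x) = s' x) :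
    (W ⧸ LinearMap.range s') →ₗ[R] (W ⧸ LinearMap.range s) :=
  Submodule.mapQ _ _ LinearMap.id (by rintro _ ⟨x, rfl⟩; exact ⟨g x, h x⟩)

/-- induced map on images -/
def imMap (s s' : X →ₗ[R] W) (g : X →ₗ[R] X) (h : ∀ x, s (g x) = s' x) : Im s' →ₗ[R] Im s :=
  LinearMap.codRestrict (LinearMap.range s) (Im.inc s') (by
    rintro ⟨_, x, rfl⟩; exact ⟨g x, h x⟩)

lemma dd_nat (s s' : X →ₗ[R] W) (g : X →ₗ[R] X) (h : ∀ x, s (g x) = s' x)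
    (u : lcH J 0 (W ⧸ LinearMap.range s')) :
    lcMap J 2 (keMap s s' g h) (dd J s' u) = dd J s (lcMap J 0 (coMap s s' g h) u) := by
  have h1 := lc_δ_nat J (SES.keIm s') (SES.keIm s) (keMap s s' g h) g (imMap s s' g h) rfl (by
    refine LinearMap.ext fun x => Im.inj s ?_
    exact (h x).symm) 1 (lcδ J (SES.im s') 0 u)
  have h2 := lc_δ_nat J (SES.im s') (SES.im s) (imMap s s' g h) LinearMap.id (coMap s s' g h)
    rfl rfl 0 u
  exact h1.trans (congrArg (lcδ J (SES.keIm s) 1) h2)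

lemma sig_pQ (b : P →ₗ[R] B) (π : P →ₗ[R] R) (e : P) (x : P ⊗[R] B) :
    sig b ((pQ π e).rTensor B x) = sig (b ∘ₗ pQ π e) x := by
  have : sig b ∘ₗ (pQ π e).rTensor B = sig (b ∘ₗ pQ π e) := by
    apply TensorProduct.ext'; intro u v; rfl
  exact LinearMap.congr_fun this x

/-- contraction in the first variable -/
def ctB (B : Type) [AddCommGroup B] [Module R B] (π : P →ₗ[R] R) : P ⊗[R] B →ₗ[R] B :=
  ct B π

lemma ctB_tmul (π : P →ₗ[R] R) (x : P) (v : B) : ctB B π (x ⊗ₜ[R] v) = π x • v := ct_tmul _ _ _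

lemma pQ_ctB (π : P →ₗ[R] R) (e : P) (x : P ⊗[R] B) :
    x = (pQ π e).rTensor B x + e ⊗ₜ[R] ctB B π x := by
  have : LinearMap.id = (pQ π e).rTensor B + TensorProduct.mk R P B e ∘ₗ ctB B π := by
    apply TensorProduct.ext'
    intro u v
    simp [ctB_tmul, pQ_apply, TensorProduct.sub_tmul, TensorProduct.smul_tmul]
  exact LinearMap.congr_fun this x

lemma ctB_pQ {π : P →ₗ[R] R} {e : P} (he : π e = 1) (x : P ⊗[R] B) :
    ctB B π ((pQ π e).rTensor B x) = 0 := by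
  have : ctB B π ∘ₗ (pQ π e).rTensor B = 0 := by
    apply TensorProduct.ext'
    intro u v
    simp [ctB_tmul, π_pQ he]
  exact LinearMap.congr_fun this x

lemma lamY_nat (b : P →ₗ[R] B) (π : P →ₗ[R] R) (e : P) :
    keMap (sig b) (sig (b ∘ₗ pQ π e)) ((pQ π e).rTensor B) (sig_pQ b π e) ∘ₗ lamY (b ∘ₗ pQ π e)
      = lamY b ∘ₗ L2.map (pQ π e) := by
  refine LinearMap.ext fun x => Ke.inj _ ?_
  exact LinearMap.congr_fun (lam_nat b (pQ π e)) x

lemma lamY_pQ (b : P →ₗ[R] B) (π : P →ₗ[R] R) (e : P) {q : ℕ} (hP : LZ J q P)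
    (w : lcH J q (L2 R P)) :
    lcMap J q (lamY b) (lcMap J q (L2.map (pQ π e)) w) = lcMap J q (lamY b) w := by
  have h1 : w = lcMap J q (L2.map (pQ π e)) w := by
    conv_lhs => rw [← lcMap_id J q w, L2_split (π := π) (e := e), lcMap_add,
      lcMap_comp J q (kap π) (wg R e), hP (lcMap J q (kap π) w), map_zero, add_zero]
  rw [← h1]

/-- comparison lemma -/
lemma stepB_cmp (b : P →ₗ[R] B) (π : P →ₗ[R] R) (e : P) (hP2 : LZ J 2 P)
    (u : lcH J 0 (S2 R B ⧸ LinearMap.range (sig (b ∘ₗ pQ π e)))) (w : lcH J 2 (L2 R P))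
    (h : dd J (sig (b ∘ₗ pQ π e)) u = lcMap J 2 (lamY (b ∘ₗ pQ π e)) w) :
    dd J (sig b) (lcMap J 0 (coMap (sig b) (sig (b ∘ₗ pQ π e)) ((pQ π e).rTensor B)
      (sig_pQ b π e)) u) = lcMap J 2 (lamY b) w := by
  rw [← dd_nat, h, ← lcMap_comp, lamY_nat, lcMap_comp, lamY_pQ b π e hP2]

/-- the submodule G -/
def Gsub (J : Ideal R) (b : P →ₗ[R] B) (π : P →ₗ[R] R) (e : P) : Submodule R (S2 R B) :=
  ((((LinearMap.range (lcMap J 2 (lamY (b ∘ₗ pQ π e)))).comap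
    (dd J (sig (b ∘ₗ pQ π e)))).map (lcθ J _))).comap
    (LinearMap.range (sig (b ∘ₗ pQ π e))).mkQ

lemma mem_Gsub (b : P →ₗ[R] B) (π : P →ₗ[R] R) (e : P) (z : S2 R B) :
    z ∈ Gsub J b π e ↔ ∃ u w, dd J (sig (b ∘ₗ pQ π e)) u = lcMap J 2 (lamY (b ∘ₗ pQ π e)) w ∧
      lcθ J _ u = (LinearMap.range (sig (b ∘ₗ pQ π e))).mkQ z := by
  constructor
  · rintro ⟨u, ⟨w, hw⟩, hu⟩
    exact ⟨u, w, hw.symm, hu⟩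
  · rintro ⟨u, w, hw, hu⟩
    exact ⟨u, ⟨w, hw.symm⟩, hu⟩

lemma range_le_Gsub (b : P →ₗ[R] B) (π : P →ₗ[R] R) (e : P) :
    LinearMap.range (sig (b ∘ₗ pQ π e)) ≤ Gsub J b π e := by
  intro z hz
  rw [mem_Gsub]
  refine ⟨0, 0, by rw [map_zero, map_zero], ?_⟩
  rw [map_zero]
  exact ((Submodule.Quotient.mk_eq_zero _).2 hz).symm

lemma stepB_top (b : P →ₗ[R] B) (π : P →ₗ[R] R) (e : P) (hP2 : LZ J 2 P)
    (hP1 : LZ J 1 P) [Module.Free R B] [Module.Finite R B]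
    (h0 : LZ J 0 R) (h1 : LZ J 1 R) (h2 : LZ J 2 R) (hT : TC J (sig b))
    (hs : Function.Surjective (lcMap J 2 (lamY b))) :
    Gsub J b π e ⊔ LinearMap.range (S2.mkT ∘ₗ TensorProduct.mk R B B (b e)) = ⊤ := by
  rw [← top_le_iff]
  intro s _
  obtain ⟨y0, hy0⟩ := lcθ_surj J (hT.tors J ((LinearMap.range (sig b)).mkQ s))
  obtain ⟨w, hw⟩ := hs (dd J (sig b) y0)
  obtain ⟨u, hu⟩ := dd_surj (s := sig (b ∘ₗ pQ π e)) (LZ.S2 J h1 h2) (LZ.tens J hP2)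
    (lcMap J 2 (lamY (b ∘ₗ pQ π e)) w)
  have h3 := stepB_cmp b π e hP2 u w hu
  rw [hw] at h3
  have h4 := dd_inj (LZ.S2 J h0 h1) (LZ.tens J hP1) h3
  obtain ⟨z, hz⟩ := (LinearMap.range (sig (b ∘ₗ pQ π e))).mkQ_surjective (lcθ J _ u)
  have hzG : z ∈ Gsub J b π e := (mem_Gsub b π e z).2 ⟨u, w, hu, hz.symm⟩
  have h5 := congrArg (lcθ J _) h4
  rw [lcθ_map, ← hz, hy0] at h5
  have h6 : z - s ∈ LinearMap.range (sig b) := (Submodule.Quotient.eq _).1 h5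
  obtain ⟨x, hx⟩ := h6
  rw [pQ_ctB π e x, map_add, sig_pQ] at hx
  have h7 : s = (z - sig (b ∘ₗ pQ π e) x) - sig b (e ⊗ₜ[R] ctB B π x) := by
    rw [sub_sub, hx]; abel
  rw [h7]
  refine Submodule.sub_mem _ (Submodule.mem_sup_left (Submodule.sub_mem _ hzG
    (range_le_Gsub b π e (LinearMap.mem_range_self _ x)))) (Submodule.mem_sup_right ?_)
  exact ⟨ctB B π x, rfl⟩

lemma range_bB_le (b : P →ₗ[R] B) (e : P) (hb : b e ∈ J • (⊤ : Submodule R B)) :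
    LinearMap.range (S2.mkT ∘ₗ TensorProduct.mk R B B (b e)) ≤ J • (⊤ : Submodule R (S2 R B)) := by
  rintro _ ⟨v, rfl⟩
  have : Submodule.map (S2.mkT ∘ₗ (TensorProduct.mk R B B).flip v) (J • (⊤ : Submodule R B)) ≤
      J • (⊤ : Submodule R (S2 R B)) := by
    rw [Submodule.map_smul'']
    exact Submodule.smul_mono le_rfl le_top
  exact this ⟨b e, hb, rfl⟩

lemma nak_fg [Module.Finite R X] (G : Submodule R X) (h : ⊤ ≤ G ⊔ J • (⊤ : Submodule R X)) :
    ∃ r, r - 1 ∈ J ∧ ∀ x, r • x ∈ G := by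
  obtain ⟨r, hr, hr'⟩ := Submodule.exists_sub_one_mem_and_smul_eq_zero_of_fg_of_le_smul J
    (⊤ : Submodule R (X ⧸ G)) Module.Finite.fg_top (by
      have h1 := Submodule.map_mono (f := G.mkQ) h
      rw [Submodule.map_sup, Submodule.map_smul'', Submodule.map_top, Submodule.range_mkQ] at h1
      refine h1.trans (sup_le ?_ le_rfl)
      rintro _ ⟨x, hx, rfl⟩
      have : G.mkQ x = 0 := (Submodule.Quotient.mk_eq_zero _).2 hx
      rw [this]; exact Submodule.zero_mem _)
  refine ⟨r, hr, fun x => ?_⟩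
  exact (Submodule.Quotient.mk_eq_zero _).1 (hr' (G.mkQ x) trivial)

instance [Module.Finite R B] : Module.Finite R (S2 R B) :=
  Module.Finite.of_surjective (S2.mkT (R := R) (M := B)) S2.mkT_surj

lemma stepB_abs (b : P →ₗ[R] B) {π : P →ₗ[R] R} {e : P} (hP2 : LZ J 2 P)
    (hP1 : LZ J 1 P) [Module.Free R B] [Module.Finite R B]
    (hb : b e ∈ J • (⊤ : Submodule R B))
    (h0 : LZ J 0 R) (h1 : LZ J 1 R) (h2 : LZ J 2 R) (hT : TC J (sig b))
    (hs : Function.Surjective (lcMap J 2 (lamY b)))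
    (hi : ∀ w, lcMap J 2 (lamY b) w = 0 → w = 0) :
    ∃ r, r - 1 ∈ J ∧ ∀ v, ∃ x, sig (b ∘ₗ pQ π e) x = r • sig b (e ⊗ₜ[R] v) := by
  obtain ⟨r, hr, hG⟩ := nak_fg (J := J) (Gsub J b π e) (by
    refine (stepB_top b π e hP2 hP1 h0 h1 h2 hT hs).ge.trans ?_
    exact sup_le_sup_left (range_bB_le b e hb) _)
  refine ⟨r, hr, fun v => ?_⟩
  obtain ⟨u, w, hu, hu'⟩ := (mem_Gsub b π e _).1 (hG (sig b (e ⊗ₜ[R] v)))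
  have h3 := stepB_cmp b π e hP2 u w hu
  have h4 : lcMap J 0 (coMap (sig b) (sig (b ∘ₗ pQ π e)) ((pQ π e).rTensor B)
      (sig_pQ b π e)) u = 0 := by
    apply lcθ_inj J
    rw [lcθ_map, hu', map_zero]
    refine (Submodule.Quotient.mk_eq_zero _).2 ?_
    exact Submodule.smul_mem _ _ (LinearMap.mem_range_self _ _)
  rw [h4, map_zero] at h3
  rw [hi w h3.symm, map_zero] at hu
  have h5 := dd_inj (LZ.S2 J h0 h1) (LZ.tens J hP1) (hu.trans (map_zero _).symm)
  rw [h5, map_zero] at hu'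
  exact (Submodule.Quotient.mk_eq_zero _).1 hu'.symm

section
variable [IsNoetherianRing R] [Module.Free R A] [Module.Finite R A] [Module.Free R B]
  [Module.Finite R B]

lemma MonD.stepB (M : MonD J α p β ι ω) (hC0 : LZ J 0 C) {π : P →ₗ[R] R} {e : P}
    (hb : β (p e) ∈ J • (⊤ : Submodule R B)) (hP1 : LZ J 1 P) (hP2 : LZ J 2 P)
    (hR : ∀ i ≤ 3, LZ J i R) (hC3 : LZ J 3 C) :
    ∃ r, r - 1 ∈ J ∧ ∀ v, ∃ x, sig ((β ∘ₗ p) ∘ₗ pQ π e) x = r • sig (β ∘ₗ p) (e ⊗ₜ[R] v) := by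
  refine stepB_abs (J := J) (β ∘ₗ p) hP2 hP1 hb (hR 0 (by lia)) (hR 1 (by lia)) (hR 2 (by lia))
    M.TC_sig (M.M_surj hC0 (i := 1) (hR 2 (by lia)) (hR 3 (by lia)) hC3) ?_
  intro w hw
  obtain ⟨η, rfl⟩ := M.M_ker hC0 (i := 0) (hR 2 (by lia)) (hR 3 (by lia)) w hw
  have h1 : LZ J 2 (A ⊗[R] P) := LZ.tens' J hP2
  have h2 := h1 η
  rw [h2, map_zero]

end
end StepB

section StepC
variable {R : Type} [CommRing R]
variable {A P C B E X W Z : Type} [AddCommGroup A] [Module R A] [AddCommGroup P] [Module R P]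
  [AddCommGroup C] [Module R C] [AddCommGroup B] [Module R B] [AddCommGroup E] [Module R E]
  [AddCommGroup X] [Module R X] [AddCommGroup W] [Module R W] [AddCommGroup Z] [Module R Z]

variable {J : Ideal R} {α : A →ₗ[R] P} {p : P →ₗ[R] C} {β : C →ₗ[R] B} {ι : E →ₗ[R] C}
    {ω : E →ₗ[R] E →ₗ[R] R}

/-- abstract diagram chase -/
lemma stepC_abs (F : X →ₗ[R] W) (hF : TC J F) (g : W →ₗ[R] B) (B0 : Submodule R B)
    (hB : LZ J 0 B) (hK : Function.Surjective (lcMap J 1 (Im.res F)))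
    (k : X →ₗ[R] B0) (hk : ∀ x, (k x : B) = g (F x)) (hz : ∀ x, lcMap J 1 k x = 0) (y : W) :
    g y ∈ B0 := by
  obtain ⟨u, hu⟩ := lcθ_surj J (hF.tors J ((LinearMap.range F).mkQ y))
  let a : Im F →ₗ[R] B0 := LinearMap.codRestrict B0 (g ∘ₗ Im.inc F) (by
    rintro ⟨_, x, rfl⟩
    have := (k x).2
    rw [hk] at this
    exact this)
  have hak : a ∘ₗ Im.res F = k := LinearMap.ext fun x => Subtype.ext (hk x).symm
  let c : (W ⧸ LinearMap.range F) →ₗ[R] (B ⧸ B0) := Submodule.mapQ _ _ g (by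
    rintro _ ⟨x, rfl⟩
    have := (k x).2
    rw [hk] at this
    exact this)
  have h1 := lc_δ_nat J (SES.im F) (SES.mkQ B0) a g c rfl rfl 0 u
  obtain ⟨x, hx⟩ := hK (lcδ J (SES.im F) 0 u)
  rw [← hx, ← lcMap_comp, hak, hz] at h1
  have h2 := lc_δ_inj J (SES.mkQ B0) hB (h1.symm.trans (map_zero _).symm)
  have h3 := congrArg (lcθ J _) h2
  rw [lcθ_map, hu, map_zero] at h3
  exact (Submodule.Quotient.mk_eq_zero _).1 h3

lemma ctB_lam (b : P →ₗ[R] B) (π : P →ₗ[R] R) : ctB B π ∘ₗ lam b = b ∘ₗ kap π :=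
  L2.hom_ext fun x y => by simp [ctB_tmul]

variable [IsNoetherianRing R] [Module.Free R A] [Module.Finite R A] [Module.Free R B]
  [Module.Finite R B]

lemma MonD.stepC (M : MonD J α p β ι ω) (hC0 : LZ J 0 C) {π : P →ₗ[R] R}
    (hb : ∀ x, β (p x) ∈ J • (⊤ : Submodule R B)) (hc : ∀ a, π (α a) ∈ J) (hP1 : LZ J 1 P)
    (hR : ∀ i ≤ 2, LZ J i R) (hC2 : LZ J 2 C) (y : Ke (sig (β ∘ₗ p))) :
    ctB B π (Ke.inc _ y) ∈ J • (⊤ : Submodule R B) := by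
  have hm : ∀ z : A ⊗[R] B, ctB B π (α.rTensor B z) ∈ J • (⊤ : Submodule R B) := by
    intro z
    induction z using TensorProduct.induction_on with
    | zero => rw [map_zero, map_zero]; exact Submodule.zero_mem _
    | tmul a v =>
      rw [LinearMap.rTensor_tmul, ctB_tmul]
      exact Submodule.smul_mem_smul (hc a) trivial
    | add u v hu hv => rw [map_add, map_add]; exact Submodule.add_mem _ hu hv
  let k1 : P →ₗ[R] ↥(J • (⊤ : Submodule R B)) := LinearMap.codRestrict _ (β ∘ₗ p) hb
  let k2 : A ⊗[R] B →ₗ[R] ↥(J • (⊤ : Submodule R B)) :=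
    LinearMap.codRestrict _ (ctB B π ∘ₗ α.rTensor B) hm
  refine stepC_abs M.PhiY M.TC_Phi (ctB B π ∘ₗ Ke.inc _) (J • ⊤) (LZ.free J (hR 0 (by lia)))
    (lc_surj_of' J M.PhiY_ses (i := 1) (M.R3_zero hC0 (i := 0) (hR 2 (by lia)) hC2))
    ((k1 ∘ₗ kap π) ∘ₗ LinearMap.fst R _ _ + k2 ∘ₗ LinearMap.snd R _ _) ?_ ?_ y
  · rintro ⟨x, z⟩
    change β (p (kap π x)) + ctB B π (α.rTensor B z) =
      ctB B π (lam (β ∘ₗ p) x + α.rTensor B z)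
    rw [map_add]
    congr 1
    exact (LinearMap.congr_fun (ctB_lam (β ∘ₗ p) π) x).symm
  · intro x
    have h2 : LZ J 1 (A ⊗[R] B) := LZ.tens J (LZ.free J (hR 1 (by lia)))
    have e1 : lcMap J 1 ((k1 ∘ₗ kap π) ∘ₗ LinearMap.fst R (L2 R P) (A ⊗[R] B)) x = 0 := by
      rw [lcMap_comp, lcMap_comp J 1 (kap π) k1, hP1 (lcMap J 1 (kap π) _), map_zero]
    have e2 : lcMap J 1 (k2 ∘ₗ LinearMap.snd R (L2 R P) (A ⊗[R] B)) x = 0 := by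
      rw [lcMap_comp, h2 (lcMap J 1 (LinearMap.snd R (L2 R P) (A ⊗[R] B)) x), map_zero]
    rw [lcMap_add, e1, e2, add_zero]

/-- Conclusion: B is zero after Nakayama -/
lemma MonD.stepBC (M : MonD J α p β ι ω) (hC0 : LZ J 0 C) {π : P →ₗ[R] R} {e : P}
    (he : π e = 1) (hb : ∀ x, β (p x) ∈ J • (⊤ : Submodule R B)) (hc : ∀ a, π (α a) ∈ J)
    (hP1 : LZ J 1 P) (hP2 : LZ J 2 P) (hR : ∀ i ≤ 3, LZ J i R) (hC2 : LZ J 2 C)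
    (hC3 : LZ J 3 C) (v : B) : v ∈ J • (⊤ : Submodule R B) := by
  obtain ⟨r, hr, h⟩ := M.stepB hC0 (π := π) (hb e) hP1 hP2 hR hC3
  obtain ⟨x, hx⟩ := h v
  obtain ⟨y, hy⟩ := Ke.exists (sig (β ∘ₗ p)) (e ⊗ₜ[R] (r • v) - (pQ π e).rTensor B x) (by
    rw [map_sub, sig_pQ, hx, ← map_smul, TensorProduct.tmul_smul, sub_self])
  have h1 := M.stepC hC0 hb hc hP1 (fun i hi => hR i (by lia)) hC2 y
  rw [hy, map_sub, ctB_pQ he, sub_zero, ctB_tmul, he, one_smul] at h1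
  have h2 : v = r • v - (r - 1) • v := by module
  rw [h2]
  exact Submodule.sub_mem _ h1 (Submodule.smul_mem_smul hr trivial)

end StepC

/-! ## Steps D and F -/
section StepD
variable {R : Type} [CommRing R]
variable {A P C B E X W Z : Type} [AddCommGroup A] [Module R A] [AddCommGroup P] [Module R P]
  [AddCommGroup C] [Module R C] [AddCommGroup B] [Module R B] [AddCommGroup E] [Module R E]
  [AddCommGroup X] [Module R X] [AddCommGroup W] [Module R W] [AddCommGroup Z] [Module R Z]

variable {J : Ideal R} {α : A →ₗ[R] P} {p : P →ₗ[R] C} {β : C →ₗ[R] B} {ι : E →ₗ[R] C}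
    {ω : E →ₗ[R] E →ₗ[R] R}

/-- torsion-free dual -/
lemma LZ0.dual (h : LZ J 0 R) : LZ J 0 (X →ₗ[R] R) := by
  rw [LZ0_iff] at h ⊢
  rintro φ ⟨t, ht⟩
  refine LinearMap.ext fun x => h _ ⟨t, fun r hr => ?_⟩
  exact LinearMap.congr_fun (ht r hr) x

/-- precomposition -/
def pre (f : X →ₗ[R] W) : (W →ₗ[R] R) →ₗ[R] (X →ₗ[R] R) := LinearMap.lcomp R R f

lemma pre_apply (f : X →ₗ[R] W) (φ : W →ₗ[R] R) (x : X) : pre f φ x = φ (f x) := rfl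

lemma LZ1.dual [Module.Finite R X] (h0 : LZ J 0 R) (h1 : LZ J 1 R) : LZ J 1 (X →ₗ[R] R) := by
  obtain ⟨m, q, hq⟩ := Module.Finite.exists_fin' R X
  have hs : SES (pre q) (Im.res (pre (Ke.inc q))) := by
    refine ⟨?_, ?_, Im.surj _⟩
    · intro φ ψ h
      refine LinearMap.ext fun x => ?_
      obtain ⟨y, rfl⟩ := hq x
      exact LinearMap.congr_fun h y
    · intro φ
      constructor
      · intro h
        have h' : pre (Ke.inc q) φ = 0 := by
          rw [← Im.inc_res, h, map_zero]
        obtain ⟨χ, hχ⟩ := exists_factor hq φ (fun x hx => by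
          obtain ⟨y, rfl⟩ := Ke.exists q x hx
          exact LinearMap.congr_fun h' y)
        exact ⟨χ, LinearMap.ext hχ⟩
      · rintro ⟨χ, rfl⟩
        apply Im.inj
        rw [Im.inc_res, map_zero]
        refine LinearMap.ext fun y => ?_
        rw [pre_apply, pre_apply, Ke.zero, map_zero]
        rfl
  exact LZ.left J hs (LZ.free J h1) (LZ0.sub J (Im.inj _) (LZ0.dual h0))

lemma PForm.comap (h : PForm ω) {j : X →ₗ[R] E} (hj : Function.Injective j) :
    PForm (ω.compl₁₂ j j) := by
  refine ⟨fun x => h.alt _, fun x y z => hj ?_⟩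
  simpa using h.plu (j x) (j y) (j z)

lemma PForm.smul_eq (h : PForm ω) (x y z : E) : ω x y • z = ω z y • x + ω x z • y := by
  have := h.plu x y z
  rw [h.neg y z, h.neg z x] at this
  rw [← sub_eq_zero, ← this]
  module

lemma TC.surj_of {s : X →ₗ[R] W} (hT : TC J s) (hW : LZ J 0 W) (hX : LZ J 1 X)
    (hK : LZ J 2 (Ke s)) : Function.Surjective s := by
  intro y
  obtain ⟨u, hu⟩ := lcθ_surj J (hT.tors J ((LinearMap.range s).mkQ y))
  have h1 := dd_inj hW hX ((hK (dd J s u)).trans (map_zero _).symm)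
  rw [h1, map_zero] at hu
  exact (Submodule.Quotient.mk_eq_zero _).1 hu.symm

lemma TC.surj_of_inj {s : X →ₗ[R] W} (hT : TC J s) (hs : Function.Injective s) (hW : LZ J 0 W)
    (hX : LZ J 1 X) : Function.Surjective s := by
  intro y
  obtain ⟨u, hu⟩ := lcθ_surj J (hT.tors J ((LinearMap.range s).mkQ y))
  have h1 := lc_δ_inj J (SES.ofInj hs) hW ((hX (lcδ J (SES.ofInj hs) 0 u)).trans (map_zero _).symm)
  rw [h1, map_zero] at hu
  exact (Submodule.Quotient.mk_eq_zero _).1 hu.symm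

lemma subsing_of_basis [Module.Free R A] (hJ : J ≠ ⊤)
    (h : ∀ φ : A →ₗ[R] R, ∀ a, φ a ∈ J) : Subsingleton A := by
  let b := Module.Free.chooseBasis R A
  have : IsEmpty (Module.Free.ChooseBasisIndex R A) := by
    refine ⟨fun j => hJ ((Ideal.eq_top_iff_one J).2 ?_)⟩
    have := h (b.coord j) (b j)
    rwa [Module.Basis.coord_apply, Module.Basis.repr_self, Finsupp.single_eq_same] at this
  exact b.repr.toEquiv.subsingleton

lemma map_mem_of_smul_top (φ : X →ₗ[R] R) {x : X} (hx : x ∈ J • (⊤ : Submodule R X)) :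
    φ x ∈ J := by
  have : Submodule.map φ (J • (⊤ : Submodule R X)) ≤ J := by
    rw [Submodule.map_smul'']
    exact (Submodule.smul_mono le_rfl le_top).trans (by simp)
  exact this ⟨x, hx, rfl⟩

lemma extend_abs [IsNoetherianRing R] [Module.Free R A] [Module.Finite R A] [Module.Finite R P]
    (hs : SES α p) {ω : C →ₗ[R] C →ₗ[R] R} (hω : PForm ω)
    (hr : J ≤ (Ideal.span {g | ∃ x y, g = ω x y}).radical)
    (hρ : J ≤ (Ideal.span {f | ∃ ρ : P →ₗ[R] A, ∀ a, ρ (α a) = f • a}).radical)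
    (h0 : LZ J 0 R) (h1 : LZ J 1 R) (hC2 : LZ J 2 C) :
    Function.Surjective (pre α) := by
  have hT : TC J (pre α) := by
    refine TC_of_rad J _ hρ ?_
    rintro φ f ⟨ρ, hρ⟩
    refine ⟨1, φ ∘ₗ ρ, LinearMap.ext fun a => ?_⟩
    rw [pre_apply, LinearMap.comp_apply, hρ, map_smul, pow_one]
    rfl
  refine TC.surj_of hT (LZ0.dual h0) (LZ1.dual h0 h1) ?_
  let k : C →ₗ[R] Ke (pre α) := Ke.lift (pre α) (pre p ∘ₗ ω) (fun c => LinearMap.ext fun a => by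
    have : p (α a) = 0 := hs.exact.apply_apply_eq_zero a
    change ω c (p (α a)) = 0
    rw [this, map_zero])
  refine LZ.of_tors_dom J (f := k) (i := 1) ?_ ?_ hC2
  · refine TK_of_rad J _ hr ?_
    rintro c hc _ ⟨x, y, rfl⟩
    have hc' : ∀ z, ω c z = 0 := fun z => by
      obtain ⟨z, rfl⟩ := hs.surj z
      exact LinearMap.congr_fun (congrArg (Ke.inc (pre α)) hc) z
    refine ⟨1, ?_⟩
    rw [pow_one, hω.smul_eq, hω.neg x c, hc', hc', neg_zero, zero_smul, zero_smul, add_zero]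
  · refine TC_of_rad J _ hr ?_
    rintro ψ _ ⟨x, y, rfl⟩
    obtain ⟨φ, hφ⟩ := exists_factor hs.surj (Ke.inc (pre α) ψ) (fun x hx => by
      obtain ⟨a, rfl⟩ := (hs.exact x).1 hx
      exact LinearMap.congr_fun (Ke.zero (pre α) ψ) a)
    refine ⟨1, φ y • x - φ x • y, Ke.inj _ (LinearMap.ext fun z => ?_)⟩
    have e1 : Ke.inc (pre α) (k (φ y • x - φ x • y)) z = ω (φ y • x - φ x • y) (p z) := rfl
    have e2 := congrArg φ (hω.smul_eq x y (p z))
    rw [e1, pow_one, map_smul, LinearMap.smul_apply, ← hφ, ← map_smul, e2]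
    simp only [map_sub, map_add, map_smul, LinearMap.sub_apply, LinearMap.smul_apply, smul_eq_mul]
    rw [hω.neg (p z) y]
    ring

lemma MonD.ρα (M : MonD J α p β ι ω) :
    J ≤ (Ideal.span {f | ∃ ρ : P →ₗ[R] A, ∀ a, ρ (α a) = f • a}).radical := by
  refine M.spl.trans (Ideal.radical_mono (Ideal.span_mono ?_))
  rintro f ⟨τ, ρE, σ, ρ, h1, h2, h3, h4⟩
  refine ⟨ρ, fun a => M.ses.inj ?_⟩
  have := h4 (α a)
  rw [M.pα, map_zero, add_zero] at this
  rw [this, map_smul]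

/-- step F -/
lemma free_of_form [IsNoetherianRing R] {ω : P →ₗ[R] P →ₗ[R] R} (hω : PForm ω)
    (hr : J ≤ (Ideal.span {g | ∃ x y, g = ω x y}).radical) (hR0 : LZ J 0 R)
    (hP0 : LZ J 0 P) (hP1 : LZ J 1 P) {π : P →ₗ[R] R} {e : P} (he : π e = 1) :
    Module.Free R P := by
  let φ : Ke π →ₗ[R] R := ω.flip e ∘ₗ Ke.inc π
  have hφ : ∀ q, φ q = ω (Ke.inc π q) e := fun q => rfl
  have h2 : ∀ q q' : Ke π, ω (Ke.inc π q) (Ke.inc π q') = 0 := by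
    intro q q'
    have := congrArg π (hω.plu (Ke.inc π q) (Ke.inc π q') e)
    rw [map_add, map_add, map_smul, map_smul, map_smul, Ke.zero, Ke.zero, he, map_zero] at this
    simpa using this
  have h3 : ∀ x, ∃ q : Ke π, x = Ke.inc π q + π x • e := by
    intro x
    obtain ⟨q, hq⟩ := Ke.exists π (pQ π e x) (π_pQ he x)
    refine ⟨q, ?_⟩
    rw [hq, pQ_apply, sub_add_cancel]
  have h4 : ∀ x y, ω x y ∈ LinearMap.range φ := by
    intro x y
    obtain ⟨q, hq⟩ := h3 x
    obtain ⟨q', hq'⟩ := h3 y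
    refine ⟨π y • q - π x • q', ?_⟩
    conv_rhs => rw [hq, hq']
    rw [map_sub, map_smul, map_smul, hφ, hφ]
    simp only [map_add, map_smul, LinearMap.add_apply, LinearMap.smul_apply, h2,
      hω.alt, smul_eq_mul]
    rw [hω.neg e]
    ring
  have h5 : ∀ q q' : Ke π, φ q = 0 → φ q' • q = 0 := by
    intro q q' h
    apply Ke.inj
    have := hω.plu (Ke.inc π q) (Ke.inc π q') e
    rw [h2, zero_smul, zero_add, hω.neg e, ← hφ, ← hφ, h, neg_zero, zero_smul, add_zero] at this
    rw [map_smul, this, map_zero]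
  have hK0 : LZ J 0 (Ke π) := LZ0.sub J (Ke.inj π) hP0
  have hinj : Function.Injective φ := by
    rw [injective_iff_map_eq_zero]
    intro q hq
    refine (LZ0_iff J).1 hK0 q (torsE_of_rad J _ hr q ?_)
    rintro _ ⟨x, y, rfl⟩
    obtain ⟨q', hq'⟩ := h4 x y
    exact ⟨1, by rw [pow_one, ← hq', h5 q q' hq]⟩
  have hT : TC J φ := by
    refine TC_of_rad J _ hr ?_
    rintro y _ ⟨x, x', rfl⟩
    refine ⟨1, ?_⟩
    rw [pow_one, smul_eq_mul, mul_comm]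
    exact Submodule.smul_mem _ y (h4 x x')
  have hK1 : LZ J 1 (Ke π) := by
    refine LZ.retract J (f := Ke.inc π) (g := Ke.lift π (pQ π e) (π_pQ he)) ?_ hP1
    refine LinearMap.ext fun q => Ke.inj _ ?_
    rw [LinearMap.comp_apply, Ke.inc_lift, pQ_apply, Ke.zero, zero_smul, sub_zero]
    rfl
  have hsurj := hT.surj_of_inj hinj hR0 hK1
  let ψ : P →ₗ[R] R × R := (φ ∘ₗ Ke.lift π (pQ π e) (π_pQ he)).prod π
  have hψ : Function.Bijective ψ := by
    constructor
    · rw [injective_iff_map_eq_zero]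
      intro x hx
      have e1 : φ (Ke.lift π (pQ π e) (π_pQ he) x) = 0 := congrArg Prod.fst hx
      have e2 : π x = 0 := congrArg Prod.snd hx
      have e3 := congrArg (Ke.inc π) (hinj (e1.trans (map_zero φ).symm))
      rw [Ke.inc_lift, pQ_apply, e2, zero_smul, sub_zero, map_zero] at e3
      exact e3
    · rintro ⟨a, c⟩
      obtain ⟨q, hq⟩ := hsurj a
      refine ⟨Ke.inc π q + c • e, Prod.ext ?_ ?_⟩
      · change φ (Ke.lift π (pQ π e) (π_pQ he) (Ke.inc π q + c • e)) = a
        rw [← hq]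
        congr 1
        apply Ke.inj
        rw [Ke.inc_lift, pQ_apply, map_add, Ke.zero, map_smul, he, smul_eq_mul, mul_one, zero_add,
          add_sub_cancel_right]
      · change π (Ke.inc π q + c • e) = c
        rw [map_add, Ke.zero, map_smul, he, smul_eq_mul, mul_one, zero_add]
  exact Module.Free.of_equiv (LinearEquiv.ofBijective ψ hψ).symm

variable [IsNoetherianRing R] [Module.Free R A] [Module.Finite R A] [Module.Free R B]
  [Module.Finite R B] [Module.Finite R P]

/-- Final statement for monads with a free summand of rank one in the middle -/
lemma MonD.final (M : MonD J α p β ι ω) (hJ : J ≠ ⊤) {π : P →ₗ[R] R} {e : P}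
    (he : π e = 1) (hb : ∀ x, β (p x) ∈ J • (⊤ : Submodule R B))
    (ha : ∀ a, α a ∈ J • (⊤ : Submodule R P)) {k : ℕ} (hR : ∀ i ≤ k + 3, LZ J i R)
    (hP0 : LZ J 0 P) (hP1 : LZ J 1 P) (hP2 : LZ J 2 P) (hC : LZ J (k + 3) C) :
    Module.Free R E ∧ LZ J 1 E := by
  have hC0 : LZ J 0 C := LZ.right J M.ses hP0 (LZ.free J (hR 1 (by lia)))
  have hC2 : LZ J 2 C := LZ.right J M.ses hP2 (LZ.free J (hR 3 (by lia)))
  have hc : ∀ a, π (α a) ∈ J := fun a => map_mem_of_smul_top π (ha a)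
  have hC3 : LZ J 3 C := by
    clear hP2 hC2
    induction k with
    | zero => exact hC
    | succ k ih =>
      refine ih (fun i hi => hR i (by lia)) ?_
      exact M.stepA hC0 he (hb e) hc (i := k) (hR _ (by lia)) (hR _ (by lia)) (hR _ (by lia)) hC
  have hB : Subsingleton B := subsing_of_basis hJ fun φ v =>
    map_mem_of_smul_top φ (M.stepBC hC0 he hb hc hP1 hP2 (fun i hi => hR i (by lia)) hC2 hC3 v)
  have hι : Function.Surjective ι := fun c => (M.exact c).1 (Subsingleton.elim _ _)
  let ε : E ≃ₗ[R] C := LinearEquiv.ofBijective ι ⟨M.inj, hι⟩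
  have hsub : ∀ (X : Type) [AddCommGroup X] [Module R X] (j : X ≃ₗ[R] E),
      J ≤ (Ideal.span {g | ∃ x y, g = (ω.compl₁₂ j.toLinearMap j.toLinearMap) x y}).radical := by
    intro X _ _ j
    refine M.rad0.trans (Ideal.radical_mono (Ideal.span_mono ?_))
    rintro _ ⟨x, y, rfl⟩
    exact ⟨j.symm x, j.symm y, by simp⟩
  have hext := extend_abs (J := J) M.ses (M.form.comap (j := ε.symm.toLinearMap) ε.symm.injective)
    (hsub C ε.symm) M.ρα (hR 0 (by lia)) (hR 1 (by lia)) hC2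
  have hA : Subsingleton A := subsing_of_basis hJ fun φ a => by
    obtain ⟨ψ, rfl⟩ := hext φ
    exact map_mem_of_smul_top ψ (ha a)
  have hp : Function.Bijective p := by
    refine ⟨?_, M.ses.surj⟩
    rw [injective_iff_map_eq_zero]
    intro x hx
    obtain ⟨a, rfl⟩ := (M.ses.exact x).1 hx
    rw [Subsingleton.elim a 0, map_zero]
  let j : P ≃ₗ[R] E := (LinearEquiv.ofBijective p hp).trans ε.symm
  have hfree : Module.Free R P := free_of_form (M.form.comap (j := j.toLinearMap) j.injective)
    (hsub P j) (hR 0 (by lia)) hP0 hP1 he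
  exact ⟨Module.Free.of_equiv j, LZ.congr J j.symm hP1⟩

end StepD

/-! ## Construction of the data and the final assembly -/
section Build
variable {R : Type} [CommRing R]
variable {A P C B E X W Z : Type} [AddCommGroup A] [Module R A] [AddCommGroup P] [Module R P]
  [AddCommGroup C] [Module R C] [AddCommGroup B] [Module R B] [AddCommGroup E] [Module R E]
  [AddCommGroup X] [Module R X] [AddCommGroup W] [Module R W] [AddCommGroup Z] [Module R Z]

variable {J : Ideal R} {α : A →ₗ[R] P} {p : P →ₗ[R] C} {β : C →ₗ[R] B} {ι : E →ₗ[R] C}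
    {ω : E →ₗ[R] E →ₗ[R] R}

lemma exists_lift_smul [Module.Free R B] (b : P →ₗ[R] B) (f : R)
    (h : ∀ v, f • v ∈ LinearMap.range b) : ∃ τ : B →ₗ[R] P, ∀ v, b (τ v) = f • v := by
  let e := Module.Free.chooseBasis R B
  choose t ht using fun j => h (e j)
  refine ⟨e.constr ℕ t, fun v => ?_⟩
  have : b ∘ₗ e.constr ℕ t = f • LinearMap.id := e.ext fun j => by
    rw [LinearMap.comp_apply, Module.Basis.constr_basis, ht]; rfl
  exact LinearMap.congr_fun this v

lemma exists_lift_inj {α : A →ₗ[R] P} (hα : Function.Injective α) (g : X →ₗ[R] P)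
    (h : ∀ x, g x ∈ LinearMap.range α) : ∃ ρ : X →ₗ[R] A, ∀ x, α (ρ x) = g x := by
  refine ⟨(LinearEquiv.ofInjective α hα).symm.toLinearMap ∘ₗ g.codRestrict _ h, fun x => ?_⟩
  have := (LinearEquiv.ofInjective α hα).apply_symm_apply (g.codRestrict _ h x)
  exact congrArg Subtype.val this

lemma spl_mk [Module.Free R B] (hs : SES α p) (hι : Function.Injective ι)
    (hex : Function.Exact ι β) (hω : PForm ω) (x y : E) (f : R)
    (hf : ∀ v, f • v ∈ LinearMap.range (β ∘ₗ p)) : Spl α p β ι (ω x y * f) := by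
  obtain ⟨τ', hτ'⟩ := exists_lift_smul (β ∘ₗ p) f hf
  have hτ : ∀ v, β (p (τ' v)) = f • v := hτ'
  obtain ⟨x', hx'⟩ := hs.surj (ι x)
  obtain ⟨y', hy'⟩ := hs.surj (ι y)
  let σE : E →ₗ[R] P := LinearMap.toSpanSingleton R P x' ∘ₗ ω.flip y +
    LinearMap.toSpanSingleton R P y' ∘ₗ ω x
  have hσE : ∀ z, p (σE z) = ω x y • ι z := by
    intro z
    change p (ω z y • x' + ω x z • y') = _
    rw [map_add, map_smul, map_smul, hx', hy', ← map_smul, ← map_smul, ← map_add,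
      ← hω.smul_eq, map_smul]
  obtain ⟨ρE, hρE⟩ := exists_lift_inj hι (f • LinearMap.id - p ∘ₗ τ' ∘ₗ β) (fun c => by
    refine (hex _).1 ?_
    change β (f • c - p (τ' (β c))) = 0
    rw [map_sub, map_smul, hτ, sub_self])
  have hρE' : ∀ c, ι (ρE c) = f • c - p (τ' (β c)) := hρE
  let σ : C →ₗ[R] P := σE ∘ₗ ρE + ω x y • (τ' ∘ₗ β)
  have hσ : ∀ c, p (σ c) = (ω x y * f) • c := by
    intro c
    change p (σE (ρE c) + ω x y • τ' (β c)) = _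
    rw [map_add, hσE, hρE', map_smul, smul_sub, sub_add_cancel, smul_smul]
  obtain ⟨ρ, hρ⟩ := exists_lift_inj hs.inj ((ω x y * f) • LinearMap.id - σ ∘ₗ p) (fun z => by
    refine (hs.exact _).1 ?_
    change p ((ω x y * f) • z - σ (p z)) = 0
    rw [map_sub, map_smul, hσ, sub_self])
  have hρ' : ∀ z, α (ρ z) = (ω x y * f) • z - σ (p z) := hρ
  refine ⟨ω x y • τ', ω x y • ρE, σ, ρ, fun v => ?_, fun c => ?_, hσ, fun z => ?_⟩
  · rw [LinearMap.smul_apply, map_smul, map_smul, hτ, smul_smul]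
  · rw [LinearMap.smul_apply, LinearMap.smul_apply, map_smul, map_smul, hρE', smul_sub,
      sub_add_cancel, smul_smul]
  · rw [hρ', sub_add_cancel]

lemma spl_rad [Module.Free R B] (hs : SES α p) (hι : Function.Injective ι)
    (hex : Function.Exact ι β) (hω : PForm ω)
    (hr : J ≤ (Ideal.span {g | ∃ x y, g = ω x y}).radical) (c : ℕ)
    (hf : ∀ f ∈ J ^ c, ∀ v, f • v ∈ LinearMap.range (β ∘ₗ p)) :
    J ≤ (Ideal.span {f | Spl α p β ι f}).radical := by
  intro a ha
  obtain ⟨m, hm⟩ := hr ha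
  refine ⟨m + c, ?_⟩
  rw [pow_add]
  have hac : a ^ c ∈ J ^ c := Ideal.pow_mem_pow ha c
  refine Submodule.span_induction (p := fun v _ => v * a ^ c ∈ Ideal.span {f | Spl α p β ι f})
    ?_ ?_ ?_ ?_ hm
  · rintro _ ⟨x, y, rfl⟩
    exact Ideal.subset_span (spl_mk hs hι hex hω x y _ (hf _ hac))
  · rw [zero_mul]; exact Submodule.zero_mem _
  · intro u v _ _ hu hv
    rw [add_mul]; exact Submodule.add_mem _ hu hv
  · intro r u _ hu
    rw [smul_eq_mul, mul_assoc]; exact Ideal.mul_mem_left _ _ hu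

/-- class in monad homology -/
def mhMk (α : A →ₗ[R] P) (b : P →ₗ[R] B) : Ke b →ₗ[R] MonadHomology α b where
  toFun x := Submodule.Quotient.mk (p := (LinearMap.range α).comap (LinearMap.ker b).subtype) x
  map_add' _ _ := rfl
  map_smul' _ _ := rfl

lemma mhMk_surj (α : A →ₗ[R] P) (b : P →ₗ[R] B) : Function.Surjective (mhMk α b) :=
  Submodule.Quotient.mk_surjective ((LinearMap.range α).comap (LinearMap.ker b).subtype)

lemma mhMk_zero (α : A →ₗ[R] P) (b : P →ₗ[R] B) (x : Ke b) :
    mhMk α b x = 0 ↔ Ke.inc b x ∈ LinearMap.range α :=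
  Submodule.Quotient.mk_eq_zero ((LinearMap.range α).comap (LinearMap.ker b).subtype)

lemma exists_j' (hs : SES α p) (f : MonadHomology α (β ∘ₗ p) →ₗ[R] E) :
    ∃ j : Ke β →ₗ[R] E, (∀ x : Ke β, ∃ y : MonadHomology α (β ∘ₗ p), j x = f y ∧
      ∀ r : R, r • y = 0 → r • x = 0) ∧ ∀ y, ∃ x, j x = f y := by
  let g : Ke (β ∘ₗ p) →ₗ[R] Ke β := Ke.lift β (p ∘ₗ Ke.inc (β ∘ₗ p)) (fun x => Ke.zero _ x)
  have hg : Function.Surjective g := by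
    intro x
    obtain ⟨y, hy⟩ := hs.surj (Ke.inc β x)
    obtain ⟨z, rfl⟩ := Ke.exists (β ∘ₗ p) y (by rw [LinearMap.comp_apply, hy, Ke.zero])
    exact ⟨z, Ke.inj _ hy⟩
  obtain ⟨j, hj⟩ := exists_factor hg (f ∘ₗ mhMk α (β ∘ₗ p)) (fun x hx => by
    have : mhMk α (β ∘ₗ p) x = 0 := by
      rw [mhMk_zero]
      exact (hs.exact _).1 (congrArg (Ke.inc β) hx)
    rw [LinearMap.comp_apply, this, map_zero])
  refine ⟨j, fun x => ?_, fun y => ?_⟩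
  · obtain ⟨z, rfl⟩ := hg x
    refine ⟨mhMk α (β ∘ₗ p) z, hj z, fun r hr => ?_⟩
    rw [← map_smul, mhMk_zero] at hr
    apply Ke.inj
    have h1 : Ke.inc β (r • g z) = p (Ke.inc (β ∘ₗ p) (r • z)) := by
      rw [map_smul, map_smul, map_smul]; rfl
    rw [h1, map_zero]
    exact (hs.exact _).2 hr
  · obtain ⟨z, rfl⟩ := mhMk_surj α (β ∘ₗ p) y
    exact ⟨g z, hj z⟩

lemma smul_mem_of_le_ann {T : Submodule R X} {I : Ideal R}
    (h : I ≤ Module.annihilator R (X ⧸ T)) {r : R} (hr : r ∈ I) (x : X) : r • x ∈ T := by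
  have := Module.mem_annihilator.1 (h hr) (T.mkQ x)
  rw [← map_smul] at this
  exact (Submodule.Quotient.mk_eq_zero _).1 this

lemma smul_zero_of_le_ann {f : X →ₗ[R] W} {I : Ideal R}
    (h : I ≤ Module.annihilator R ↥(LinearMap.ker f)) {r : R} (hr : r ∈ I) (x : X) (hx : f x = 0) :
    r • x = 0 :=
  congrArg Subtype.val (Module.mem_annihilator.1 (h hr) ⟨x, hx⟩)

end Build

section Main
variable {K : Type} [Field K] {n : ℕ} {E X : Type} [AddCommGroup E] [Module (PolyS K n) E]
  [AddCommGroup X] [Module (PolyS K n) X]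

lemma rad_of_form {ω : E →ₗ[PolyS K n] E →ₗ[PolyS K n] PolyS K n}
    (h : ∀ p : PrimeSpectrum (PolyS K n), p.asIdeal ≠ irrel K n → ∃ x y, ω x y ∉ p.asIdeal)
    (j : X →ₗ[PolyS K n] E) (c : ℕ) (hj : ∀ r ∈ (irrel K n) ^ c, ∀ x, r • x ∈ LinearMap.range j) :
    irrel K n ≤ (Ideal.span {g | ∃ x y, g = (ω.compl₁₂ j j) x y}).radical := by
  rw [Ideal.radical_eq_sInf]
  refine le_sInf ?_
  rintro q ⟨hq, hq'⟩
  by_contra hle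
  obtain ⟨r, hr, hrq⟩ := SetLike.not_le_iff_exists.1 hle
  obtain ⟨x, y, hxy⟩ := h ⟨q, hq'⟩ (by rintro rfl; exact hle le_rfl)
  have hrc := Ideal.pow_mem_pow hr c
  obtain ⟨x', hx'⟩ := hj _ hrc x
  obtain ⟨y', hy'⟩ := hj _ hrc y
  have h1 : (ω.compl₁₂ j j) x' y' ∈ q := hq (Ideal.subset_span ⟨x', y', rfl⟩)
  rw [LinearMap.compl₁₂_apply, hx', hy', map_smul, map_smul, LinearMap.smul_apply, smul_eq_mul,
    smul_eq_mul] at h1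
  have hrc' : r ^ c ∉ q := fun h => hrq (hq'.mem_of_pow_mem c h)
  rcases hq'.mem_or_mem h1 with h2 | h2
  · exact hrc' h2
  · rcases hq'.mem_or_mem h2 with h3 | h3
    · exact hrc' h3
    · exact hxy h3

end Main

/-- Let `E` be a non-split rank two bundle on `ℙⁿ` (`n ≥ 6`) with
`H^l_*(E) = 0` for some `2 ≤ l ≤ n-2`.  Then in the minimal monad `0 → A → P → B → 0`
for `E`, the bundle `P` has no line bundle direct summands. -/
theorem middle_bundle_no_line_summand
    (K : Type) [Field K] (n : ℕ) (hn : 6 ≤ n)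
    (A B P : Type) [AddCommGroup A] [Module (PolyS K n) A]
    [AddCommGroup B] [Module (PolyS K n) B] [AddCommGroup P] [Module (PolyS K n) P]
    (hAfree : Module.Free (PolyS K n) A) (hAfin : Module.Finite (PolyS K n) A)
    (hBfree : Module.Free (PolyS K n) B) (hBfin : Module.Finite (PolyS K n) B)
    (hP : IsBundleModule K n P)
    (hP1 : Subsingleton (Hstar K n 1 P))
    (hPn1 : Subsingleton (Hstar K n (n-1) P))
    (α : A →ₗ[PolyS K n] P) (β : P →ₗ[PolyS K n] B)
    (hβα : β.comp α = 0)
    (hαinj : Function.Injective α)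
    (hsubbundle : ∀ p : PrimeSpectrum (PolyS K n), p.asIdeal ≠ irrel K n →
      Module.Free (Localization.AtPrime p.asIdeal)
        (LocalizedModule p.asIdeal.primeCompl (P ⧸ LinearMap.range α)))
    (hβsurj : ∃ c : ℕ, (irrel K n) ^ c ≤
      Module.annihilator (PolyS K n) (B ⧸ LinearMap.range β))
    (hαmin : LinearMap.range α ≤ (irrel K n) • (⊤ : Submodule (PolyS K n) P))
    (hβmin : LinearMap.range β ≤ (irrel K n) • (⊤ : Submodule (PolyS K n) B))
    (E : Type) [AddCommGroup E] [Module (PolyS K n) E]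
    (hcoh : ∃ f : MonadHomology α β →ₗ[PolyS K n] E, IsSheafIso K n f)
    (hE : IsRankTwoBundleModule K n E)
    (hnonsplit : ¬ Module.Free (PolyS K n) E)
    (l : ℕ) (hl1 : 2 ≤ l) (hl2 : l ≤ n - 2)
    (hvan : Subsingleton (Hstar K n l E)) :
    ¬ ∃ (Q L' : Submodule (PolyS K n) P), IsCompl Q L' ∧
        Nonempty (↥L' ≃ₗ[PolyS K n] PolyS K n) := by
  rintro ⟨Q, L', hcompl, ⟨ε⟩⟩
  haveI := hP.finite
  have lz : ∀ {i : ℕ} {M : Type} [AddCommGroup M] [Module (PolyS K n) M],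
      Subsingleton ((localCohomology (irrel K n) i).obj (ModuleCat.of (PolyS K n) M)) →
      LZ (irrel K n) i M := fun {i M} _ _ h => (LZ_iff _).2 (lcH_subsingleton _ i h)
  have hP0' : LZ (irrel K n) 0 P := lz hP.h0
  have hP1' : LZ (irrel K n) 1 P := lz hP.h1
  have hP2' : LZ (irrel K n) 2 P := lz hP1
  have hE0 : LZ (irrel K n) 0 E := lz hE.h0
  have hEl : LZ (irrel K n) (l + 1) E := lz hvan
  obtain ⟨k, rfl⟩ : ∃ k, l = k + 2 := ⟨l - 2, by omega⟩
  have hkn : k + 3 ≤ n := by omega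
  -- the quotient by the image of α
  have ses : SES α (LinearMap.range α).mkQ := SES.ofInj hαinj
  obtain ⟨βb, hβb⟩ : ∃ βb : (P ⧸ LinearMap.range α) →ₗ[PolyS K n] B,
      βb ∘ₗ (LinearMap.range α).mkQ = β := by
    refine ⟨(LinearMap.range α).liftQ β ?_, Submodule.liftQ_mkQ _ _ _⟩
    rintro _ ⟨a, rfl⟩
    exact LinearMap.congr_fun hβα a
  subst hβb
  obtain ⟨f, ⟨c1, hc1⟩, ⟨c2, hc2⟩⟩ := hcoh
  obtain ⟨j, hj1, hj2⟩ := exists_j' ses f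
  obtain ⟨c3, hc3⟩ := hβsurj
  have hC0 : LZ (irrel K n) 0 (P ⧸ LinearMap.range α) :=
    LZ.right _ ses hP0' (LZ.free _ (LZ_S K n 1 (by omega)))
  have hK0 : LZ (irrel K n) 0 (Ke βb) := LZ0.sub _ (Ke.inj βb) hC0
  have hjinj : Function.Injective j := by
    rw [injective_iff_map_eq_zero]
    intro x hx
    obtain ⟨y, hy, hyr⟩ := hj1 x
    refine (LZ0_iff _).1 hK0 x ⟨c1, fun r hr => hyr r ?_⟩
    exact smul_zero_of_le_ann hc1 hr y (hy ▸ hx)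
  have hjr : ∀ r ∈ (irrel K n) ^ c2, ∀ x, r • x ∈ LinearMap.range j := by
    intro r hr x
    obtain ⟨y, hy⟩ := smul_mem_of_le_ann hc2 hr x
    obtain ⟨z, hz⟩ := hj2 y
    exact ⟨z, hz.trans hy⟩
  have hjTC : TC (irrel K n) j := fun y => ⟨c2, fun r hr => hjr r hr y⟩
  obtain ⟨ω, hω, hω'⟩ := exists_form hE
  have hform := hω.comap hjinj
  have hrad := rad_of_form hω' j c2 hjr
  have M : MonD (irrel K n) α (LinearMap.range α).mkQ βb (Ke.inc βb) (ω.compl₁₂ j j) :=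
    ⟨ses, Ke.inj _, Ke.exact _, hform, hrad,
      spl_rad ses (Ke.inj _) (Ke.exact _) hform hrad c3
        (fun r hr v => smul_mem_of_le_ann hc3 hr v)⟩
  have hKl : LZ (irrel K n) (k + 3) (Ke βb) :=
    LZ.of_tors_cod _ (TK.of_inj _ hjinj) hjTC (i := k + 1) hEl
  have hCl : LZ (irrel K n) (k + 3) (P ⧸ LinearMap.range α) :=
    LZ.mid _ M.sesE hKl (Im.LZ M.TC_β (i := k + 1) (LZ.free _ (LZ_S K n (k + 3) hkn)))
  have hπ : (ε.toLinearMap ∘ₗ L'.projectionOnto Q hcompl.symm) ((ε.symm 1 : L') : P) = 1 := by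
    rw [LinearMap.comp_apply, Submodule.projectionOnto_apply_left]
    exact ε.apply_symm_apply 1
  obtain ⟨hfree, hK1⟩ := M.final (irrel_isMaximal K n).ne_top hπ
    (fun x => hβmin ⟨x, rfl⟩) (fun a => hαmin ⟨a, rfl⟩) (k := k)
    (fun i hi => LZ_S K n i (hi.trans hkn)) hP0' hP1' hP2' hCl
  have hjsurj := hjTC.surj_of_inj hjinj hE0 hK1
  exact hnonsplit (Module.Free.of_equiv (LinearEquiv.ofBijective j ⟨hjinj, hjsurj⟩))
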